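/- Let p and q be primes with p ≡ 5 (mod 8) and q ≡ 3 (mod 8), d = pq, and assume the Legendre symbol (p/q) = 1 and that q is a fourth power residue modulo p. Then for every n ≥ 1, the 2-class group of L_{n,d} is isomorphic to ℤ/2^{n+2}ℤ. -/

import Mathlib

open IntermediateField NumberField

/-- The quadratic field `ℚ(√m)` realized inside `ℂ` (for `m` of either sign). -/
noncomputable def quadField (m : ℤ) : IntermediateField ℚ ℂ :=
  IntermediateField.adjoin ℚ {z : ℂ | z ^ 2 = (m : ℂ)}

/-- The 2-class group of a number field `K ⊆ ℂ`: the 2-primary component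
(= 2-Sylow subgroup) of the ideal class group of its ring of integers. -/
noncomputable def twoClassGroup (K : IntermediateField ℚ ℂ) :
    Subgroup (ClassGroup (𝓞 K)) :=
  CommGroup.primaryComponent _ 2

/-- `h₂(m)`: the 2-class number of the quadratic field `ℚ(√m)`. -/
noncomputable def h2 (m : ℤ) : ℕ := Nat.card (twoClassGroup (quadField m))

/-- `L_{n,d} = ℚ(ζ_{2^{n+2}}, √d)`, the `n`-th layer of the cyclotomic
`ℤ₂`-extension of `ℚ(√d, √-1)`. -/
noncomputable def Lfield (n : ℕ) (d : ℤ) : IntermediateField ℚ ℂ :=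
  IntermediateField.adjoin ℚ
    ({z : ℂ | z ^ 2 ^ (n + 2) = 1} ∪ {z : ℂ | z ^ 2 = (d : ℂ)})

/-- `ℚ(ζ_{2^{n+2}} + ζ_{2^{n+2}}⁻¹, √d) = ℚ(2cos(2π/2^{n+2}), √d)`.
For `d > 0` this is the maximal real subfield `L_{n,d}⁺` of `L_{n,d}`;
for `d < 0` it is the `n`-th layer `K_{n,|d|}` of the cyclotomic
`ℤ₂`-extension of the imaginary quadratic field `ℚ(√d)`. -/
noncomputable def LplusField (n : ℕ) (d : ℤ) : IntermediateField ℚ ℂ :=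
  IntermediateField.adjoin ℚ
    ({((2 * Real.cos (2 * Real.pi / 2 ^ (n + 2)) : ℝ) : ℂ)} ∪ {z : ℂ | z ^ 2 = (d : ℂ)})

set_option linter.unusedSectionVars false
set_option linter.unusedVariables false
set_option linter.style.haveILetI false

section Part1
open Ideal

namespace TCG

/-- An extension `R → S` of Dedekind domains with an involution of `S` whose fixed ring is `R`. -/
structure Quad {R S : Type*} [CommRing R] [CommRing S] (f : R →+* S) (s : S ≃+* S) : Prop where
  inj : Function.Injective f
  invol : ∀ x, s (s x) = x
  fix : ∀ r, s (f r) = f r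
  mem : ∀ x, s x = x → ∃ r, f r = x
  skew : ∃ y, y ≠ 0 ∧ s y = -y

section Ideals

variable {R S : Type*} [CommRing R] [IsDedekindDomain R] [CommRing S] [IsDedekindDomain S]
variable {f : R →+* S} {s : S ≃+* S}

theorem cancel_le {I J A : Ideal S} (hA : A ≠ ⊥) (h : A * I ≤ A * J) : I ≤ J := by
  rw [← Ideal.dvd_iff_le] at h ⊢
  exact (mul_dvd_mul_iff_left hA).1 h

theorem exists_compl {J : Ideal S} (hJ : J ≠ ⊥) : ∃ J' : Ideal S, ∃ a : S, a ≠ 0 ∧ J' ≠ ⊥ ∧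
    J * J' = span {a} := by
  obtain ⟨a, ha, ha0⟩ := Submodule.exists_mem_ne_zero_of_ne_bot hJ
  have : J ∣ span {a} := by
    rw [Ideal.dvd_iff_le, Ideal.span_singleton_le_iff_mem]; exact ha
  obtain ⟨J', h⟩ := this
  refine ⟨J', a, ha0, ?_, h.symm⟩
  rintro rfl
  simp at h
  exact ha0 h

theorem Quad.map_le (q : Quad f s) {I J : Ideal R} (h : I.map f ≤ J.map f) : I ≤ J := by
  by_cases hJ : J = ⊥
  · subst hJ
    simp only [Ideal.map_bot, le_bot_iff] at h
    rw [Ideal.map_eq_bot_iff_of_injective q.inj] at h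
    simp [h]
  obtain ⟨J', a, ha, hJ', e⟩ := exists_compl hJ
  apply cancel_le hJ'
  rw [mul_comm J' J, e]
  intro r hr
  rw [Ideal.mem_span_singleton]
  have h1 : f r ∈ span {f a} := by
    have : (J' * I).map f ≤ (J * J').map f := by
      rw [Ideal.map_mul, Ideal.map_mul, mul_comm]
      exact Ideal.mul_mono_left h
    rw [e, Ideal.map_span, Set.image_singleton] at this
    exact this (Ideal.mem_map_of_mem f hr)
  rw [Ideal.mem_span_singleton] at h1
  obtain ⟨t, ht⟩ := h1
  have hfa : f a ≠ 0 := by rwa [Ne, map_eq_zero_iff f q.inj]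
  have : s t = t := by
    have h2 := congrArg s ht
    rw [map_mul, q.fix, q.fix, ht] at h2
    exact (mul_left_cancel₀ hfa h2).symm
  obtain ⟨t', rfl⟩ := q.mem t this
  exact ⟨t', q.inj (by rw [ht, map_mul])⟩

theorem Quad.map_inj (q : Quad f s) {I J : Ideal R} (h : I.map f = J.map f) : I = J :=
  le_antisymm (q.map_le h.le) (q.map_le h.ge)

theorem map_s_span (s : S ≃+* S) (x : S) : (span {x}).map s = span {s x} := by
  rw [Ideal.map_span, Set.image_singleton]

theorem map_f_span (f : R →+* S) (x : R) : (span {x}).map f = span {f x} := by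
  rw [Ideal.map_span, Set.image_singleton]

theorem mem_map_s {s : S ≃+* S} {I : Ideal S} {x : S} : s x ∈ I.map s ↔ x ∈ I := by
  constructor
  · intro h
    obtain ⟨y, hy, e⟩ := (Ideal.mem_map_iff_of_surjective s s.surjective).1 h
    rwa [← s.injective e]
  · exact Ideal.mem_map_of_mem s

theorem Quad.map_map (q : Quad f s) (I : Ideal S) : (I.map s).map s = I := by
  ext x
  rw [← q.invol x, mem_map_s, mem_map_s, q.invol]

theorem Quad.mem_s (q : Quad f s) {I : Ideal S} {x : S} : x ∈ I.map s ↔ s x ∈ I := by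
  rw [← mem_map_s (s := s) (I := I), q.invol]

theorem Quad.map_map_f (q : Quad f s) (J : Ideal R) : (J.map f).map s = J.map f := by
  change (Ideal.span (f '' J)).map s = Ideal.span (f '' J)
  rw [Ideal.map_span, ← Set.image_comp]
  congr 1
  ext x
  simp [q.fix]

theorem map_s_ne_bot (s : S ≃+* S) {I : Ideal S} (h : I ≠ ⊥) : I.map s ≠ ⊥ := by
  rwa [Ne, Ideal.map_eq_bot_iff_of_injective s.injective]

theorem Quad.map_f_ne_bot (q : Quad f s) {I : Ideal R} (h : I ≠ ⊥) : I.map f ≠ ⊥ := by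
  rwa [Ne, Ideal.map_eq_bot_iff_of_injective q.inj]

theorem Quad.nm (q : Quad f s) (x : S) : ∃ r, f r = x * s x :=
  q.mem _ (by rw [map_mul, q.invol, mul_comm])

theorem Quad.tr (q : Quad f s) (x : S) : ∃ r, f r = x + s x :=
  q.mem _ (by rw [map_add, q.invol, add_comm])

/-- Hurwitz: the product of an ideal and its conjugate comes from below. -/
theorem Quad.exists_norm (q : Quad f s) {I : Ideal S} (hI : I ≠ ⊥) :
    ∃ J : Ideal R, J ≠ ⊥ ∧ J.map f = I * I.map s := by
  let J : Ideal R := span {r | (∃ x ∈ I, f r = x * s x) ∨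
    ∃ x ∈ I, ∃ y ∈ I, f r = x * s y + y * s x}
  have key : J.map f = I * I.map s := by
    apply le_antisymm
    · rw [Ideal.map_le_iff_le_comap, Ideal.span_le]
      rintro r (⟨x, hx, e⟩ | ⟨x, hx, y, hy, e⟩)
      · change f r ∈ (I * I.map s)
        rw [e]
        exact Ideal.mul_mem_mul hx (mem_map_s.2 hx)
      · change f r ∈ (I * I.map s)
        rw [e]
        exact add_mem (Ideal.mul_mem_mul hx (mem_map_s.2 hy))
          (Ideal.mul_mem_mul hy (mem_map_s.2 hx))
    · rw [Ideal.mul_le]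
      intro x hx y hy
      rw [q.mem_s] at hy
      obtain ⟨n1, h1⟩ := q.nm x
      obtain ⟨n2, h2⟩ := q.nm (s y)
      obtain ⟨t, ht⟩ := q.tr (x * y)
      have m1 : f n1 ∈ J.map f := Ideal.mem_map_of_mem f (Ideal.subset_span (Or.inl ⟨x, hx, h1⟩))
      have m2 : f n2 ∈ J.map f :=
        Ideal.mem_map_of_mem f (Ideal.subset_span (Or.inl ⟨s y, hy, h2⟩))
      have m3 : f t ∈ J.map f :=
        Ideal.mem_map_of_mem f (Ideal.subset_span (Or.inr ⟨x, hx, s y, hy, by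
          rw [ht, q.invol, map_mul]; ring⟩))
      set 𝔍 := J.map f
      set z := x * y with hz
      by_cases hz0 : z = 0
      · rw [hz0]; exact zero_mem _
      have e : z * z = z * f t - f n1 * f n2 := by
        rw [ht, h1, h2, hz, q.invol, map_mul]; ring
      have hA : span {z} ⊔ 𝔍 ≠ ⊥ := by
        intro h
        rw [sup_eq_bot_iff] at h
        exact hz0 (by simpa using h.1)
      have : (span {z} ⊔ 𝔍) * (span {z} ⊔ 𝔍) ≤ (span {z} ⊔ 𝔍) * 𝔍 := by
        conv_lhs => rw [Ideal.mul_sup]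
        refine sup_le ?_ le_rfl
        rw [Ideal.sup_mul]
        refine sup_le ?_ ?_
        · rw [Ideal.span_singleton_mul_span_singleton, Ideal.span_singleton_le_iff_mem, e]
          refine sub_mem (Ideal.mul_mem_mul ?_ m3) (Ideal.mul_mem_mul ?_ m2)
          · exact Ideal.mem_sup_left (Ideal.mem_span_singleton_self z)
          · exact Ideal.mem_sup_right m1
        · rw [mul_comm]
          exact Ideal.mul_mono_left le_sup_left
      exact cancel_le hA this (Ideal.mem_sup_left (Ideal.mem_span_singleton_self z))
  refine ⟨J, ?_, key⟩
  rintro h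
  rw [h, Ideal.map_bot] at key
  rcases mul_eq_zero.1 key.symm with h | h
  · exact hI h
  · exact map_s_ne_bot s hI h

theorem map_s_isPrime (s : S ≃+* S) {P : Ideal S} (h : P.IsPrime) : (P.map s).IsPrime :=
  Ideal.map_isPrime_of_equiv s

/-- Trichotomy for primes in a quadratic extension. -/
theorem Quad.prime_cases (q : Quad f s) {P : Ideal S} (hP : P.IsPrime) (h0 : P ≠ ⊥) :
    (P.map s ≠ P ∧ (P.comap f).map f = P * P.map s) ∨
    (P.map s = P ∧ (P.comap f).map f = P) ∨
    (P.map s = P ∧ (P.comap f).map f = P ^ 2 ∧ ∀ x, x - s x ∈ P) := by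
  obtain ⟨J, hJ0, hJ⟩ := q.exists_norm h0
  set 𝔭 := P.comap f with h𝔭
  have hle : 𝔭.map f ≤ P := Ideal.map_comap_le
  have hJ𝔭 : J ≤ 𝔭 := by
    rw [h𝔭, ← Ideal.map_le_iff_le_comap, hJ]
    exact Ideal.mul_le_left
  have hsle : 𝔭.map f ≤ P.map s := by
    rw [← q.map_map_f]; exact Ideal.map_mono hle
  have hPp : Prime P := Ideal.prime_of_isPrime h0 hP
  by_cases hs : P.map s = P
  · right
    rw [hs] at hJ
    have h1 : 𝔭.map f ∣ P ^ 2 := by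
      rw [Ideal.dvd_iff_le, sq, ← hJ]; exact Ideal.map_mono hJ𝔭
    obtain ⟨i, hi, e⟩ := (dvd_prime_pow hPp 2).1 h1
    rw [associated_iff_eq] at e
    interval_cases i
    · exfalso
      rw [pow_zero, Ideal.one_eq_top] at e
      rw [e] at hle
      exact hP.ne_top (top_le_iff.1 hle)
    · left; exact ⟨hs, by rw [e, pow_one]⟩
    · right
      refine ⟨hs, e, fun x => ?_⟩
      have : P * span {x - s x} ≤ P * P := by
        rw [← sq, ← e, Ideal.mul_le]
        intro z hz w hw
        obtain ⟨v, rfl⟩ := Ideal.mem_span_singleton'.1 hw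
        have hsz : s z ∈ P := by rw [← q.mem_s, hs]; exact hz
        obtain ⟨t1, h1⟩ := q.tr z
        obtain ⟨t2, h2⟩ := q.tr (z * x)
        have m1 : t1 ∈ 𝔭 := by
          change f t1 ∈ P; rw [h1]; exact add_mem hz hsz
        have m2 : t2 ∈ 𝔭 := by
          change f t2 ∈ P; rw [h2, map_mul]
          exact add_mem (Ideal.mul_mem_right _ _ hz) (Ideal.mul_mem_right _ _ hsz)
        have : z * (v * (x - s x)) = v * (f t2 - s x * f t1) := by
          rw [h1, h2, map_mul]; ring
        rw [this]
        exact Ideal.mul_mem_left _ _ (sub_mem (Ideal.mem_map_of_mem f m2)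
          (Ideal.mul_mem_left _ _ (Ideal.mem_map_of_mem f m1)))
      exact cancel_le h0 this (Ideal.mem_span_singleton_self _)
  · left
    refine ⟨hs, le_antisymm ?_ ?_⟩
    · have hcop : P ⊔ P.map s = ⊤ := by
        have hm := hP.isMaximal h0
        have hm' := (map_s_isPrime s hP).isMaximal (map_s_ne_bot s h0)
        exact hm.coprime_of_ne hm' (Ne.symm hs)
      rw [Ideal.mul_eq_inf_of_coprime hcop]
      exact le_inf hle hsle
    · rw [← hJ]; exact Ideal.map_mono hJ𝔭

/-- Invariant ideals are products of ideals from below and ramified primes. -/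
theorem Quad.invariant_mem (q : Quad f s) (T : Submonoid (Ideal S))
    (hT : ∀ J : Ideal R, J ≠ ⊥ → J.map f ∈ T)
    (hP : ∀ P : Ideal S, P.IsPrime → P ≠ ⊥ → P.map s = P → (P.comap f).map f = P ^ 2 →
      (∀ x, x - s x ∈ P) → P ∈ T) :
    ∀ I : Ideal S, I ≠ ⊥ → I.map s = I → I ∈ T := by
  intro I
  induction I using WellFounded.induction (wellFounded_dvdNotUnit (α := Ideal S)) with
  | _ I ih =>
  intro h0 hI
  by_cases htop : I = ⊤
  · rw [htop, ← Ideal.one_eq_top]; exact one_mem T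
  obtain ⟨P, hPm, hle⟩ := Ideal.exists_le_maximal I htop
  have hPp := hPm.isPrime
  have hP0 : P ≠ ⊥ := by rintro rfl; exact h0 (le_bot_iff.1 hle)
  have step : ∀ A : Ideal S, A ∈ T → A.map s = A → A ∣ I → A ≠ ⊤ → I ∈ T := by
    rintro A hA hsA ⟨C, hC⟩ hAt
    have hA0 : A ≠ ⊥ := by rintro rfl; simp at hC; exact h0 hC
    have hC0 : C ≠ ⊥ := by rintro rfl; simp at hC; exact h0 hC
    have hCs : C.map s = C := by
      have : A * C.map s = A * C := by
        conv_rhs => rw [← hC, ← hI, hC, Ideal.map_mul, hsA]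
      exact mul_left_cancel₀ hA0 this
    rw [hC]
    refine mul_mem hA (ih C ⟨hC0, A, ?_, by rw [hC, mul_comm]⟩ hC0 hCs)
    rwa [Ideal.isUnit_iff]
  have hcne : P.comap f ≠ ⊥ := by
    obtain ⟨J, hJ0, hJ⟩ := q.exists_norm hP0
    intro h
    apply hJ0
    rw [← le_bot_iff, ← h, ← Ideal.map_le_iff_le_comap, hJ]
    exact Ideal.mul_le_left
  have hPI : P ∣ I := Ideal.dvd_iff_le.2 hle
  rcases q.prime_cases hPp hP0 with ⟨h1, h2⟩ | ⟨h1, h2⟩ | ⟨h1, h2, h3⟩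
  · refine step (P * P.map s) (h2 ▸ hT _ hcne) ?_ ?_ ?_
    · rw [Ideal.map_mul, q.map_map, mul_comm]
    · have hs' : P.map s ∣ I := by
        rw [Ideal.dvd_iff_le, ← hI]; exact Ideal.map_mono hle
      obtain ⟨C, hC⟩ := hPI
      have : P.map s ∣ C := by
        have hpr : Prime (P.map s) :=
          Ideal.prime_of_isPrime (map_s_ne_bot s hP0) (map_s_isPrime s hPp)
        rw [hC] at hs'
        rcases hpr.dvd_or_dvd hs' with h | h
        · exfalso
          rw [Ideal.dvd_iff_le] at h
          exact h1 (hPm.eq_of_le (map_s_isPrime s hPp).ne_top h).symm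
        · exact h
      rw [hC]
      exact mul_dvd_mul_left P this
    · intro h
      exact hPp.ne_top (top_le_iff.1 (h ▸ Ideal.mul_le_left))
  · exact step P (h2 ▸ hT _ hcne) h1 hPI hPp.ne_top
  · exact step P (hP P hPp hP0 h1 h2 h3) h1 hPI hPp.ne_top

end Ideals
end TCG
end Part1

section Part2
open Ideal

namespace TCG

section Grp

variable {C : Type*} [CommGroup C] [Finite C]

theorem grp_index_two {q0 g : C} (h2 : ∀ c : C, c ^ 2 = 1 → c = 1 ∨ c = q0)
    (hg : ∀ c : C, c ^ 2 ≠ g) (c : C) : ∃ b, c = b ^ 2 ∨ c = g * b ^ 2 := by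
  classical
  let φ : C →* C := powMonoidHom 2
  have hk : Nat.card φ.ker ≤ 2 := by
    have : (φ.ker : Set C) ⊆ {1, q0} := by
      intro x hx
      have hx' : x ^ 2 = 1 := hx
      simpa using h2 x hx'
    calc Nat.card φ.ker = (φ.ker : Set C).ncard := rfl
      _ ≤ ({1, q0} : Set C).ncard := Set.ncard_le_ncard this (Set.toFinite _)
      _ ≤ 2 := Set.ncard_insert_le _ _ |>.trans (by simp)
  have hi : φ.range.index ≤ 2 := by
    have h1 := φ.range.card_mul_index
    have h3 := φ.ker.card_mul_index
    rw [Subgroup.index_ker] at h3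
    have hpos : 0 < Nat.card φ.range := Nat.card_pos
    have : φ.range.index = Nat.card φ.ker := by
      apply Nat.eq_of_mul_eq_mul_left hpos
      rw [h1, mul_comm, h3]
    omega
  have hgr : g ∉ φ.range := by
    rintro ⟨b, hb⟩; exact hg b hb
  have hi0 : φ.range.index ≠ 0 := Subgroup.index_ne_zero_of_finite
  have hi1 : φ.range.index ≠ 1 := by
    rw [Ne, Subgroup.index_eq_one]
    intro h; rw [h] at hgr; exact hgr trivial
  have hi2 : φ.range.index = 2 := by omega
  by_cases hc : c ∈ φ.range
  · obtain ⟨b, hb⟩ := hc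
    exact ⟨b, Or.inl hb.symm⟩
  · have : g⁻¹ * c ∈ φ.range := by
      rw [Subgroup.mul_mem_iff_of_index_two hi2, inv_mem_iff]
      tauto
    obtain ⟨b, hb⟩ := this
    refine ⟨b, Or.inr ?_⟩
    have : b ^ 2 = g⁻¹ * c := hb
    rw [this]; simp

theorem exists_odd_card : ∃ a m : ℕ, Odd m ∧ Nat.card C = 2 ^ a * m := by
  obtain ⟨a, m, hm, h⟩ := Nat.exists_eq_two_pow_mul_odd (n := Nat.card C) Nat.card_pos.ne'
  exact ⟨a, m, hm, h⟩

theorem grp_cyc {q0 g : C} (h2 : ∀ c : C, c ^ 2 = 1 → c = 1 ∨ c = q0)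
    (hg : ∀ c : C, c ^ 2 ≠ g) : ∃ m : ℕ, Odd m ∧ ∀ c : C, ∃ k : ℕ, c ^ m = g ^ k := by
  obtain ⟨a, m, hm, hcard⟩ := exists_odd_card (C := C)
  refine ⟨m, hm, fun c => ?_⟩
  have key : ∀ k : ℕ, ∃ j : ℕ, ∃ b : C, c = g ^ j * b ^ (2 ^ k) := by
    intro k
    induction k with
    | zero => exact ⟨0, c, by simp⟩
    | succ k ih =>
      obtain ⟨j, b, e⟩ := ih
      obtain ⟨b', rfl | rfl⟩ := grp_index_two h2 hg b
      · exact ⟨j, b', by rw [e, ← pow_mul, pow_succ' 2 k]⟩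
      · refine ⟨j + 2 ^ k, b', ?_⟩
        rw [e, mul_pow, ← pow_mul, pow_succ' 2 k, pow_add, mul_assoc]
  obtain ⟨j, b, e⟩ := key a
  refine ⟨j * m, ?_⟩
  rw [e, mul_pow, ← pow_mul, ← pow_mul, ← hcard, pow_card_eq_one', mul_one]

theorem grp_final {g : C} {e : ℕ} (h1 : ∀ k : ℕ, g ^ k = 1 → 2 ^ e ∣ k)
    (h2 : ∃ m, Odd m ∧ g ^ (2 ^ e * m) = 1)
    (h3 : ∃ M, Odd M ∧ ∀ c : C, ∃ k : ℕ, c ^ M = g ^ k) :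
    Nonempty (CommGroup.primaryComponent C 2 ≃* Multiplicative (ZMod (2 ^ e))) := by
  obtain ⟨m, hm, hgm⟩ := h2
  obtain ⟨M, hM, hc⟩ := h3
  have hm0 : 0 < m := hm.pos
  have hord : orderOf (g ^ m) = 2 ^ e := by
    apply Nat.dvd_antisymm
    · rw [orderOf_dvd_iff_pow_eq_one, ← pow_mul, mul_comm, hgm]
    · have : g ^ (m * orderOf (g ^ m)) = 1 := by rw [pow_mul, pow_orderOf_eq_one]
      have h := h1 _ this
      exact (Nat.Coprime.dvd_mul_left
        ((Nat.coprime_two_left.2 hm).pow_left e)).1 h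
  have heq : CommGroup.primaryComponent C 2 = Subgroup.zpowers (g ^ m) := by
    ext c
    constructor
    · rintro ⟨k, hk⟩
      have hcop : (orderOf c).Coprime (m * M) := by
        exact Nat.Coprime.coprime_dvd_left (orderOf_dvd_of_pow_eq_one hk)
          ((Nat.coprime_two_left.2 (hm.mul hM)).pow_left k)
      obtain ⟨k', hk'⟩ := hc c
      have hmem : c ^ (m * M) ∈ Subgroup.zpowers (g ^ m) := by
        rw [mul_comm, pow_mul, hk', ← pow_mul, mul_comm, pow_mul]
        exact Subgroup.pow_mem _ (Subgroup.mem_zpowers _) _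
      obtain ⟨r, hr⟩ := exists_pow_eq_self_of_coprime hcop.symm
      rw [← hr]
      exact Subgroup.pow_mem _ hmem _
    · intro h
      have hd : orderOf c ∣ 2 ^ e := by
        rw [← hord]; exact orderOf_dvd_of_mem_zpowers h
      exact ⟨e, orderOf_dvd_iff_pow_eq_one.1 hd⟩
  have hcyc : IsCyclic (Subgroup.zpowers (g ^ m)) := inferInstance
  have hcard : Nat.card (Subgroup.zpowers (g ^ m)) = Nat.card (Multiplicative (ZMod (2 ^ e))) := by
    rw [Nat.card_zpowers, hord, Nat.card_congr (Multiplicative.toAdd (α := ZMod (2 ^ e))),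
      Nat.card_zmod]
  rw [heq]
  exact ⟨mulEquivOfCyclicCardEq hcard⟩

end Grp

section Cl

variable {S : Type*} [CommRing S] [IsDedekindDomain S]

/-- Principal ideals. -/
def Pr (I : Ideal S) : Prop := ∃ a, I = span {a}

/-- Odd class number (exponent version). -/
def OddCl (S : Type*) [CommRing S] : Prop := ∃ h : ℕ, Odd h ∧ ∀ I : Ideal S, ∃ a, I ^ h = span {a}

theorem Pr.one : Pr (1 : Ideal S) := ⟨1, by simp⟩

theorem Pr.mul {I J : Ideal S} (h : Pr I) (h' : Pr J) : Pr (I * J) := by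
  obtain ⟨a, rfl⟩ := h
  obtain ⟨b, rfl⟩ := h'
  exact ⟨a * b, by rw [Ideal.span_singleton_mul_span_singleton]⟩

theorem Pr.pow {I : Ideal S} (h : Pr I) (n : ℕ) : Pr (I ^ n) := by
  obtain ⟨a, rfl⟩ := h
  exact ⟨a ^ n, by rw [Ideal.span_singleton_pow]⟩

theorem Pr.of_mul {I J : Ideal S} (hI : Pr I) (hI0 : I ≠ ⊥) (h : Pr (I * J)) : Pr J := by
  obtain ⟨a, rfl⟩ := hI
  obtain ⟨b, hb⟩ := h
  have : b ∈ span {a} := by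
    have : b ∈ span {a} * J := by rw [hb]; exact Ideal.mem_span_singleton_self b
    exact Ideal.mul_le_left this
  obtain ⟨c, rfl⟩ := Ideal.mem_span_singleton.1 this
  rw [← Ideal.span_singleton_mul_span_singleton] at hb
  exact ⟨c, mul_left_cancel₀ hI0 hb⟩

theorem Pr.of_mul_right {I J : Ideal S} (hI : Pr I) (hI0 : I ≠ ⊥) (h : Pr (J * I)) : Pr J :=
  hI.of_mul hI0 (by rwa [mul_comm])

theorem Pr.map {R : Type*} [CommRing R] {I : Ideal R} (h : Pr I) (f : R →+* S) :
    Pr (I.map f) := by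
  obtain ⟨a, rfl⟩ := h
  exact ⟨f a, by rw [Ideal.map_span, Set.image_singleton]⟩

theorem Pr.map_e {R : Type*} [CommRing R] {I : Ideal R} (h : Pr I) (f : R ≃+* S) :
    Pr (I.map f) := by
  obtain ⟨a, rfl⟩ := h
  exact ⟨f a, by rw [Ideal.map_span, Set.image_singleton]⟩

/-- class of a nonzero ideal -/
noncomputable def clm (I : Ideal S) (h : I ≠ ⊥) : ClassGroup S :=
  ClassGroup.mk0 ⟨I, mem_nonZeroDivisors_iff_ne_zero.2 h⟩

theorem clm_surj (c : ClassGroup S) : ∃ I : Ideal S, ∃ h : I ≠ ⊥, clm I h = c := by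
  obtain ⟨⟨I, hI⟩, rfl⟩ := ClassGroup.mk0_surjective c
  exact ⟨I, mem_nonZeroDivisors_iff_ne_zero.1 hI, rfl⟩

theorem clm_one_iff {I : Ideal S} (h : I ≠ ⊥) : clm I h = 1 ↔ Pr I := by
  unfold clm Pr
  rw [ClassGroup.mk0_eq_one_iff]
  constructor
  · rintro ⟨a, ha⟩; exact ⟨a, ha⟩
  · rintro ⟨a, ha⟩; exact ⟨⟨a, ha⟩⟩

theorem clm_mul {I J : Ideal S} (h : I ≠ ⊥) (h' : J ≠ ⊥) (h'' : I * J ≠ ⊥) :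
    clm (I * J) h'' = clm I h * clm J h' := by
  unfold clm
  rw [← map_mul]; rfl

theorem clm_pow {I : Ideal S} (h : I ≠ ⊥) (n : ℕ) (h' : I ^ n ≠ ⊥) :
    clm (I ^ n) h' = clm I h ^ n := by
  unfold clm
  rw [← map_pow]; rfl

theorem ne_mul {I J : Ideal S} (h : I ≠ ⊥) (h' : J ≠ ⊥) : I * J ≠ ⊥ := mul_ne_zero h h'

theorem ne_pow {I : Ideal S} (h : I ≠ ⊥) (n : ℕ) : I ^ n ≠ ⊥ := pow_ne_zero n h

theorem oddCl_of [Finite (ClassGroup S)] (H : ∀ I : Ideal S, I ≠ ⊥ → Pr (I ^ 2) → Pr I) :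
    OddCl S := by
  obtain ⟨a, m, hm, hcard⟩ := exists_odd_card (C := ClassGroup S)
  refine ⟨m, hm, fun I => ?_⟩
  by_cases h0 : I = ⊥
  · exact ⟨0, by rw [h0, ← Ideal.zero_eq_bot, zero_pow hm.pos.ne']; simp⟩
  have key : ∀ k : ℕ, ∀ J : Ideal S, J ≠ ⊥ → Pr (J ^ (2 ^ k)) → Pr J := by
    intro k
    induction k with
    | zero => intro J _ h; simpa using h
    | succ k ih =>
      intro J hJ h
      apply ih J hJ
      apply H _ (ne_pow hJ _)
      rwa [← pow_mul, ← pow_succ]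
  apply key a _ (ne_pow h0 _)
  rw [← pow_mul, mul_comm, ← hcard, ← clm_one_iff (ne_pow h0 _), clm_pow h0]
  exact pow_card_eq_one'

theorem cyc_of [Finite (ClassGroup S)] {Q G : Ideal S} (hQ : Q ≠ ⊥) (hG : G ≠ ⊥)
    (H : ∀ I : Ideal S, I ≠ ⊥ → Pr (I ^ 2) → Pr I ∨ Pr (I * Q))
    (hns : ∀ J : Ideal S, J ≠ ⊥ → ¬ Pr (G * J ^ 2)) :
    ∃ m : ℕ, Odd m ∧ ∀ I : Ideal S, I ≠ ⊥ → ∃ k : ℕ, Pr (I ^ m * G ^ k) := by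
  have h2 : ∀ c : ClassGroup S, c ^ 2 = 1 → c = 1 ∨ c = (clm Q hQ)⁻¹ := by
    intro c hc
    obtain ⟨I, hI, rfl⟩ := clm_surj c
    rw [← clm_pow hI 2 (ne_pow hI 2), clm_one_iff] at hc
    rcases H I hI hc with h | h
    · left; rwa [clm_one_iff]
    · right
      rw [← clm_one_iff (ne_mul hI hQ), clm_mul hI hQ] at h
      exact eq_inv_of_mul_eq_one_left h
  have h3 : ∀ c : ClassGroup S, c ^ 2 ≠ (clm G hG)⁻¹ := by
    intro c hc
    obtain ⟨I, hI, rfl⟩ := clm_surj c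
    apply hns I hI
    rw [← clm_one_iff (ne_mul hG (ne_pow hI 2)), clm_mul hG (ne_pow hI 2), clm_pow hI, hc]
    simp
  obtain ⟨m, hm, H⟩ := grp_cyc h2 h3
  refine ⟨m, hm, fun I hI => ?_⟩
  obtain ⟨k, hk⟩ := H (clm I hI)
  refine ⟨k, ?_⟩
  rw [← clm_one_iff (ne_mul (ne_pow hI m) (ne_pow hG k)), clm_mul (ne_pow hI m) (ne_pow hG k),
    clm_pow hI, clm_pow hG, hk]
  simp

theorem fin_of [Finite (ClassGroup S)] {G : Ideal S} (hG : G ≠ ⊥) {e : ℕ}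
    (h1 : ∀ k : ℕ, Pr (G ^ k) → 2 ^ e ∣ k)
    (h2 : ∃ m, Odd m ∧ Pr (G ^ (2 ^ e * m)))
    (h3 : ∃ M, Odd M ∧ ∀ I : Ideal S, I ≠ ⊥ → ∃ k : ℕ, Pr (I ^ M * G ^ k)) :
    Nonempty (CommGroup.primaryComponent (ClassGroup S) 2 ≃* Multiplicative (ZMod (2 ^ e))) := by
  apply grp_final (g := (clm G hG)⁻¹)
  · intro k hk
    apply h1
    rw [← clm_one_iff (ne_pow hG k), clm_pow hG]
    simpa using hk
  · obtain ⟨m, hm, h⟩ := h2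
    refine ⟨m, hm, ?_⟩
    rw [← clm_one_iff (ne_pow hG _), clm_pow hG] at h
    rw [inv_pow, h, inv_one]
  · obtain ⟨M, hM, h⟩ := h3
    refine ⟨M, hM, fun c => ?_⟩
    obtain ⟨I, hI, rfl⟩ := clm_surj c
    obtain ⟨k, hk⟩ := h I hI
    refine ⟨k, ?_⟩
    rw [← clm_one_iff (ne_mul (ne_pow hI M) (ne_pow hG k)), clm_mul (ne_pow hI M) (ne_pow hG k),
      clm_pow hI, clm_pow hG] at hk
    rw [inv_pow]
    exact eq_inv_of_mul_eq_one_left hk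

/-- every ideal class has finite order -/
theorem pr_card [Finite (ClassGroup S)] {I : Ideal S} (h : I ≠ ⊥) :
    ∃ a m : ℕ, Odd m ∧ Pr (I ^ (2 ^ a * m)) := by
  obtain ⟨a, m, hm, hcard⟩ := exists_odd_card (C := ClassGroup S)
  refine ⟨a, m, hm, ?_⟩
  rw [← hcard, ← clm_one_iff (ne_pow h _), clm_pow h]
  exact pow_card_eq_one'

end Cl
end TCG
end Part2

section Part3
open Ideal

namespace TCG

section Count

variable {G H : Type*} [CommGroup G] [CommGroup H]

/-- subgroup of squares -/
def sqS (G : Type*) [CommGroup G] : Subgroup G := (powMonoidHom 2 : G →* G).range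

theorem mem_sqS {x : G} : x ∈ sqS G ↔ ∃ y, y ^ 2 = x := Iff.rfl

theorem count (F : H →* G) (N : G →* H) (hN : ∀ r, N (F r) = r ^ 2) {a : ℕ} (ha : a ≠ 0)
    (hH : (sqS H).index = a) (hG : (sqS G).index = a ^ 2) :
    N.range.index ≤ (F.range ⊔ sqS G).relIndex ((sqS H).comap N) ∧
      (F.range ⊔ sqS G) ≤ (sqS H).comap N ∧ N.range.index ≠ 0 := by
  have h1 : sqS H ≤ N.range := by
    rintro x ⟨y, rfl⟩
    exact ⟨F y, hN y⟩
  have h2 : (F.range ⊔ sqS G) ≤ (sqS H).comap N := by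
    rw [sup_le_iff]
    constructor
    · rintro x ⟨y, rfl⟩
      exact ⟨y, (hN y).symm⟩
    · rintro x ⟨y, rfl⟩
      exact ⟨N y, by simp⟩
  have e1 : ((sqS H).comap N).index * N.range.index = a := by
    rw [Subgroup.index_comap, ← hH]
    exact Subgroup.relIndex_mul_index h1
  have e2 := Subgroup.relIndex_mul_index h2
  have e3 : (sqS G).relIndex (F.range ⊔ sqS G) * (F.range ⊔ sqS G).index = a ^ 2 := by
    rw [← hG]; exact Subgroup.relIndex_mul_index le_sup_right
  have e4 : (sqS G).relIndex (F.range ⊔ sqS G) ∣ a := by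
    rw [Subgroup.relIndex_sup_right, ← Subgroup.index_comap, ← hH]
    apply Subgroup.index_dvd_of_le
    rintro x ⟨y, rfl⟩
    exact ⟨F y, by simp⟩
  have hle : (sqS G).relIndex (F.range ⊔ sqS G) ≤ a := Nat.le_of_dvd (Nat.pos_of_ne_zero ha) e4
  set A := ((sqS H).comap N).index
  set B := N.range.index
  set κ := (F.range ⊔ sqS G).relIndex ((sqS H).comap N)
  refine ⟨?_, h2, ?_⟩
  · have hA : 0 < A := by
      rcases Nat.eq_zero_or_pos A with h | h
      · rw [h] at e1; simp at e1; exact absurd e1.symm ha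
      · exact h
    rw [← e2] at e3
    have h5 : a ^ 2 ≤ a * (κ * A) := by
      rw [← e3]; exact Nat.mul_le_mul_right _ hle
    have h6 : a ≤ κ * A := by
      rw [sq] at h5; exact Nat.le_of_mul_le_mul_left h5 (Nat.pos_of_ne_zero ha)
    rw [← e1, mul_comm A B] at h6
    exact Nat.le_of_mul_le_mul_right h6 hA
  · intro h
    rw [h] at e1; simp at e1; exact absurd e1.symm ha

theorem count_surj (F : H →* G) (N : G →* H) (hN : ∀ r, N (F r) = r ^ 2) {a : ℕ} (ha : a ≠ 0)
    (hH : (sqS H).index = a) (hG : (sqS G).index = a ^ 2)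
    (hk : ∀ ε v, N ε = v ^ 2 → ∃ b e, ε = F b * e ^ 2) (u : H) : ∃ e, N e = u := by
  obtain ⟨h1, h2, h3⟩ := count F N hN ha hH hG
  have : (sqS H).comap N ≤ F.range ⊔ sqS G := by
    rintro x ⟨v, hv⟩
    obtain ⟨b, e, rfl⟩ := hk x v hv.symm
    exact Subgroup.mul_mem_sup ⟨b, rfl⟩ ⟨e, rfl⟩
  rw [Subgroup.relIndex_eq_one.2 this] at h1
  have : N.range.index = 1 := by omega
  rw [Subgroup.index_eq_one] at this
  have hu : u ∈ N.range := this ▸ Subgroup.mem_top u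
  exact hu

theorem count_two (F : H →* G) (N : G →* H) (hN : ∀ r, N (F r) = r ^ 2) {a : ℕ} (ha : a ≠ 0)
    (hH : (sqS H).index = a) (hG : (sqS G).index = a ^ 2)
    (hk : ∀ ε v ε' v', N ε = v ^ 2 → N ε' = v' ^ 2 → (¬ ∃ b e, ε = F b * e ^ 2) →
      (¬ ∃ b e, ε' = F b * e ^ 2) → ∃ b e, ε * ε' = F b * e ^ 2)
    (H1 : Subgroup H) (hH1 : H1.index = 2) (hle : N.range ≤ H1) :
    (∀ u ∈ H1, ∃ e, N e = u) ∧ ∃ ε v, N ε = v ^ 2 ∧ ¬ ∃ b e, ε = F b * e ^ 2 := by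
  obtain ⟨h1, h2, h3⟩ := count F N hN ha hH hG
  have hmem : ∀ x, x ∈ F.range ⊔ sqS G ↔ ∃ b e, x = F b * e ^ 2 := by
    intro x
    rw [Subgroup.mem_sup]
    constructor
    · rintro ⟨_, ⟨b, rfl⟩, _, ⟨e, rfl⟩, rfl⟩
      exact ⟨b, e, rfl⟩
    · rintro ⟨b, e, rfl⟩
      exact ⟨_, ⟨b, rfl⟩, _, ⟨e, rfl⟩, rfl⟩
  have hdvd : 2 ∣ N.range.index := by
    rw [← hH1]; exact Subgroup.index_dvd_of_le hle
  have hne : ∃ ε v, N ε = v ^ 2 ∧ ¬ ∃ b e, ε = F b * e ^ 2 := by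
    by_contra hcon
    push Not at hcon
    have : (sqS H).comap N ≤ F.range ⊔ sqS G := by
      rintro x ⟨v, hv⟩
      rw [hmem]
      exact hcon x v hv.symm
    rw [Subgroup.relIndex_eq_one.2 this] at h1
    omega
  refine ⟨?_, hne⟩
  have hrel : (F.range ⊔ sqS G).relIndex ((sqS H).comap N) = 2 := by
    obtain ⟨ε0, v0, hε0, hn0⟩ := hne
    rw [Subgroup.relIndex, Subgroup.index_eq_two_iff]
    refine ⟨⟨ε0, ⟨v0, hε0.symm⟩⟩, fun b => ?_⟩
    obtain ⟨b, vb, hvb⟩ := b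
    have hvb' : N b = vb ^ 2 := hvb.symm
    simp only [Subgroup.mem_subgroupOf]
    change Xor (b * ε0 ∈ _) (b ∈ _)
    rw [hmem, hmem]
    by_cases hb : ∃ c e, b = F c * e ^ 2
    · right
      refine ⟨hb, ?_⟩
      rintro ⟨c', e', h⟩
      obtain ⟨c, e, rfl⟩ := hb
      apply hn0
      refine ⟨c⁻¹ * c', e⁻¹ * e', ?_⟩
      have : ε0 = (F c * e ^ 2)⁻¹ * (F c' * e' ^ 2) := by rw [← h, inv_mul_cancel_left]
      rw [this]
      simp only [map_mul, map_inv, mul_pow, mul_inv_rev, inv_pow]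
      simp only [mul_comm, mul_left_comm, mul_assoc]
    · left
      exact ⟨hk b vb ε0 v0 hvb' hε0 hb hn0, hb⟩
  rw [hrel] at h1
  have hi : N.range.index = 2 := by
    have := Nat.le_of_dvd (Nat.pos_of_ne_zero h3) hdvd
    omega
  have heq : N.range = H1 := by
    have h5 := Subgroup.relIndex_mul_index hle
    rw [hH1, hi] at h5
    have : N.range.relIndex H1 = 1 := by omega
    exact le_antisymm hle (Subgroup.relIndex_eq_one.1 this)
  intro u hu
  rw [← heq] at hu
  exact hu

end Count

section Amb

variable {R S : Type*} [CommRing R] [IsDedekindDomain R] [CommRing S] [IsDedekindDomain S]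
variable {f : R →+* S} {s : S ≃+* S}

theorem span_ne {a : S} : span {a} ≠ ⊥ ↔ a ≠ 0 := by simp

theorem Quad.f_ne (q : Quad f s) {r : R} : f r ≠ 0 ↔ r ≠ 0 := by
  rw [Ne, map_eq_zero_iff f q.inj]

theorem Quad.hil (q : Quad f s) {α : S} {β : R} (hβ : β ≠ 0) (h : α * s α = f β ^ 2) :
    ∃ w, w ≠ 0 ∧ α * s w = w * f β := by
  by_cases hw : α + f β = 0
  · obtain ⟨y, hy, hsy⟩ := q.skew
    refine ⟨y, hy, ?_⟩
    rw [eq_neg_of_add_eq_zero_left hw, hsy]; ring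
  · refine ⟨α + f β, hw, ?_⟩
    rw [map_add, q.fix, mul_add, h]; ring

theorem Quad.isUnit_of (q : Quad f s) {r : R} (h : IsUnit (f r)) : IsUnit r := by
  obtain ⟨t, ht⟩ := h.exists_right_inv
  have : s t = t := by
    have h2 := congrArg s ht
    rw [map_mul, q.fix, map_one, ← ht] at h2
    exact h.mul_left_cancel h2
  obtain ⟨t', rfl⟩ := q.mem t this
  refine IsUnit.of_mul_eq_one t' (q.inj ?_)
  rw [map_mul, ht, map_one]

theorem Quad.assoc (q : Quad f s) {r r' : R} (h : span {f r} = span {f r'}) :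
    ∃ u, IsUnit u ∧ r = u * r' := by
  rw [← map_f_span, ← map_f_span] at h
  have := q.map_inj h
  rw [Ideal.span_singleton_eq_span_singleton] at this
  obtain ⟨u, hu⟩ := this.symm
  exact ⟨u, u.isUnit, by rw [← hu, mul_comm]⟩

theorem assoc_span {a b : S} (h : span {a} = span {b}) : ∃ u, IsUnit u ∧ a = u * b := by
  rw [Ideal.span_singleton_eq_span_singleton] at h
  obtain ⟨u, hu⟩ := h.symm
  exact ⟨u, u.isUnit, by rw [← hu, mul_comm]⟩

/-- condition (U): units that are norms up to squares are norms of units -/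
def NormU (f : R →+* S) (s : S ≃+* S) : Prop :=
  ∀ (u : R) (α : S) (β : R), IsUnit u → α ≠ 0 → β ≠ 0 → f u * f β ^ 2 = α * s α →
    ∃ e, IsUnit e ∧ f u = e * s e

theorem span_unit_mul {u a : S} (hu : IsUnit u) : span {u * a} = span {a} :=
  Ideal.span_singleton_mul_left_unit hu a

theorem Quad.amb (q : Quad f s) (hR : OddCl R) (U : NormU f s) {I : Ideal S} (hI : I ≠ ⊥)
    (h2 : Pr (I ^ 2)) : ∃ X : Ideal S, X ≠ ⊥ ∧ X.map s = X ∧ Pr (I * X) := by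
  obtain ⟨h, ho, hR⟩ := hR
  obtain ⟨α0, hα0⟩ := h2
  obtain ⟨J, hJ0, hJ⟩ := q.exists_norm hI
  obtain ⟨β, hβ⟩ := hR J
  set I' := I ^ h with hI'
  have hI'0 : I' ≠ ⊥ := ne_pow hI h
  set α' := α0 ^ h with hα'
  have e1 : I' ^ 2 = span {α'} := by
    rw [hI', ← pow_mul, mul_comm, pow_mul, hα0, Ideal.span_singleton_pow]
  have e2 : I' * I'.map s = span {f β} := by
    rw [hI', Ideal.map_pow, ← mul_pow, ← hJ, ← Ideal.map_pow, hβ, map_f_span]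
  have hβ0 : β ≠ 0 := by
    rintro rfl
    rw [map_zero] at e2
    have : I' * I'.map s ≠ ⊥ := ne_mul hI'0 (map_s_ne_bot s hI'0)
    apply this; rw [e2]; simp
  have hα'0 : α' ≠ 0 := by
    intro h0
    rw [h0] at e1
    exact ne_pow hI'0 2 (by rw [e1]; simp)
  obtain ⟨r, hr⟩ := q.nm α'
  have e3 : span {f r} = span {f (β ^ 2)} := by
    rw [hr, ← Ideal.span_singleton_mul_span_singleton, ← map_s_span, ← e1, Ideal.map_pow,
      ← mul_pow, e2, Ideal.span_singleton_pow, map_pow]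
  obtain ⟨u, hu, hur⟩ := q.assoc e3
  obtain ⟨e, he, hue⟩ := U u α' β hu hα'0 hβ0 (by rw [← hr, hur, map_mul, map_pow])
  obtain ⟨e', hee⟩ := he.exists_right_inv
  have he' : IsUnit e' := IsUnit.of_mul_eq_one e (by rw [mul_comm]; exact hee)
  have e4 : (e' * α') * s (e' * α') = f β ^ 2 := by
    have hs : s e * s e' = 1 := by rw [← map_mul, hee, map_one]
    have : α' * s α' = e * s e * f β ^ 2 := by rw [← hr, hur, map_mul, map_pow, hue]
    calc (e' * α') * s (e' * α') = e' * s e' * (α' * s α') := by rw [map_mul]; ring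
      _ = (e * e') * (s e * s e') * f β ^ 2 := by rw [this]; ring
      _ = _ := by rw [hee, hs]; ring
  obtain ⟨w, hw0, hw⟩ := q.hil hβ0 e4
  set α'' := e' * α'
  have e5 : I' ^ 2 = span {α''} := by rw [span_unit_mul he', e1]
  have hα0 : α'' ≠ 0 := mul_ne_zero he'.ne_zero hα'0
  refine ⟨span {w} * I'.map s, ne_mul (span_ne.2 hw0) (map_s_ne_bot s hI'0), ?_, ?_⟩
  · rw [Ideal.map_mul, map_s_span, q.map_map]
    apply mul_left_cancel₀ (show span {α''} ≠ 0 from span_ne.2 hα0)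
    calc span {α''} * (span {s w} * I') = span {α'' * s w} * I' := by
          rw [← mul_assoc, Ideal.span_singleton_mul_span_singleton]
      _ = span {w} * (span {f β} * I') := by
          rw [hw, ← Ideal.span_singleton_mul_span_singleton, mul_assoc]
      _ = I' ^ 2 * (span {w} * I'.map s) := by rw [← e2]; ring
      _ = _ := by rw [e5]
  · obtain ⟨k, rfl⟩ := ho
    have hk : Pr ((I ^ 2) ^ k) := Pr.pow ⟨_, ‹I ^ 2 = _›⟩ k
    apply hk.of_mul (ne_pow (ne_pow hI 2) k)
    have : (I ^ 2) ^ k * (I * (span {w} * I'.map s)) = span {w} * (I' * I'.map s) := by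
      rw [hI']; ring
    rw [this, e2]
    exact Pr.mul ⟨_, rfl⟩ ⟨_, rfl⟩

theorem oddCl_up (q : Quad f s) [Finite (ClassGroup S)] (hR : OddCl R) (U : NormU f s)
    (hram : ∀ P : Ideal S, P.IsPrime → P ≠ ⊥ → (P.comap f).map f = P ^ 2 →
      (∀ x, x - s x ∈ P) → Pr P) : OddCl S := by
  apply oddCl_of
  intro I hI h2
  obtain ⟨X, hX0, hXs, hIX⟩ := q.amb hR U hI h2
  obtain ⟨h, ho, hR⟩ := hR
  let T : Submonoid (Ideal S) :=
    { carrier := {I | Pr (I ^ h)}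
      mul_mem' := by
        intro a b ha hb
        change Pr ((a * b) ^ h)
        rw [mul_pow]; exact Pr.mul ha hb
      one_mem' := by
        change Pr (1 ^ h)
        rw [one_pow]; exact Pr.one }
  have hXT : Pr (X ^ h) := by
    refine q.invariant_mem T ?_ ?_ X hX0 hXs
    · intro J _
      change Pr ((J.map f) ^ h)
      rw [← Ideal.map_pow]
      exact Pr.map (hR J) f
    · intro P hP hP0 _ hP2 hx
      exact (hram P hP hP0 hP2 hx).pow h
  have h3 : Pr (I ^ h) := by
    apply hXT.of_mul_right (ne_pow hX0 h)
    rw [← mul_pow]; exact hIX.pow h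
  obtain ⟨k, rfl⟩ := ho
  apply (h2.pow k).of_mul (ne_pow (ne_pow hI 2) k)
  rwa [← pow_mul, ← pow_succ]

theorem isUnit_s {e : S} (h : IsUnit e) : IsUnit (s e) := h.map s

theorem Quad.nm_unit (q : Quad f s) {e : S} (h : IsUnit e) : ∃ r, IsUnit r ∧ f r = e * s e := by
  obtain ⟨r, hr⟩ := q.nm e
  exact ⟨r, q.isUnit_of (by rw [hr]; exact h.mul (isUnit_s h)), hr⟩

/-- If `ε^h * s z = z * f v` with `z = a * e`, `s a = ± a`, then `ε` is in `f(Rˣ) (Sˣ)²` -/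
theorem Quad.ker_end (q : Quad f s) {ε e a : S} {v : R} {h : ℕ} (ho : Odd h) (hε : IsUnit ε)
    (hv : IsUnit v) (he : IsUnit e) (ha : a ≠ 0) (hsa : s a = a ∨ s a = -a)
    (H : ε ^ h * s (a * e) = a * e * f v) : ∃ b e', IsUnit b ∧ IsUnit e' ∧ ε = f b * e' ^ 2 := by
  obtain ⟨k, rfl⟩ := ho
  obtain ⟨n, hn, hne⟩ := q.nm_unit he
  obtain ⟨n', hnn⟩ := hn.exists_right_inv
  have hn' : IsUnit n' := IsUnit.of_mul_eq_one n (by rw [mul_comm]; exact hnn)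
  obtain ⟨ε', hεε⟩ := hε.exists_right_inv
  have hε' : IsUnit ε' := IsUnit.of_mul_eq_one ε (by rw [mul_comm]; exact hεε)
  have key : ∃ c, IsUnit c ∧ ε ^ (2 * k + 1) * s e = f c * e := by
    rcases hsa with hsa | hsa
    · refine ⟨v, hv, ?_⟩
      rw [map_mul, hsa] at H
      apply mul_left_cancel₀ ha
      linear_combination H
    · refine ⟨-v, hv.neg, ?_⟩
      rw [map_mul, hsa] at H
      apply mul_left_cancel₀ ha
      rw [map_neg]
      linear_combination -H
  obtain ⟨c, hc, hce⟩ := key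
  refine ⟨c * n', e * ε' ^ k, hc.mul hn', he.mul (hε'.pow k), ?_⟩
  have h1 : f n * f n' = 1 := by rw [← map_mul, hnn, map_one]
  have h2 : ε ^ k * ε' ^ k = 1 := by rw [← mul_pow, hεε, one_pow]
  have h3 : ε ^ (2 * k + 1) = f c * e ^ 2 * f n' := by
    have : ε ^ (2 * k + 1) * (s e * e) = f c * e ^ 2 := by
      linear_combination e * hce
    have h4 : s e * e = f n := by rw [hne, mul_comm]
    rw [h4] at this
    rw [← this, mul_assoc, h1, mul_one]
  rw [map_mul, mul_pow]
  calc ε = ε ^ (2 * k + 1) * (ε' ^ k) ^ 2 := by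
        have : ε ^ (2 * k + 1) = ε * (ε ^ k) ^ 2 := by ring
        rw [this, mul_assoc, ← mul_pow, h2]; ring
    _ = _ := by rw [h3]; ring

theorem Quad.unit_w (q : Quad f s) {ε w : S} {v : R} (hε : IsUnit ε) (hv : IsUnit v)
    (H : ε * s w = w * f v) : (span {w}).map s = span {w} := by
  rw [map_s_span, ← span_unit_mul hε, H, mul_comm, span_unit_mul (hv.map f)]

theorem skew_pow {X : S} (hX : s X = -X) (k : ℕ) : s (X ^ k) = X ^ k ∨ s (X ^ k) = -X ^ k := by
  rw [map_pow, hX]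
  rcases neg_one_pow_eq_or S k with h | h <;> rw [neg_pow, h] <;> simp

/-- Kernel lemma A -/
theorem Quad.kerA (q : Quad f s) (hR : OddCl R) {X : S} (hX0 : X ≠ 0) (hX : s X = -X)
    (hram : ∀ P : Ideal S, P.IsPrime → P ≠ ⊥ → (∀ x, x - s x ∈ P) → P = span {X})
    {ε : S} {v : R} (hε : IsUnit ε) (hv : IsUnit v) (H : ε * s ε = f v ^ 2) :
    ∃ b e', IsUnit b ∧ IsUnit e' ∧ ε = f b * e' ^ 2 := by
  obtain ⟨h, ho, hR⟩ := hR
  obtain ⟨w, hw0, hw⟩ := q.hil hv.ne_zero H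
  let T : Submonoid (Ideal S) :=
    { carrier := {I | ∃ b : R, ∃ k : ℕ, I ^ h = span {X ^ k * f b}}
      mul_mem' := by
        rintro a b ⟨b1, k1, h1⟩ ⟨b2, k2, h2⟩
        refine ⟨b1 * b2, k1 + k2, ?_⟩
        rw [mul_pow, h1, h2, Ideal.span_singleton_mul_span_singleton, map_mul]
        congr 2; ring
      one_mem' := ⟨1, 0, by simp⟩ }
  have hT : span {w} ∈ T := by
    refine q.invariant_mem T ?_ ?_ _ (span_ne.2 hw0) (q.unit_w hε hv hw)
    · intro J _
      obtain ⟨b, hb⟩ := hR J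
      exact ⟨b, 0, by rw [← Ideal.map_pow, hb, map_f_span]; simp⟩
    · intro P hP hP0 _ _ hx
      exact ⟨1, h, by rw [hram P hP hP0 hx, Ideal.span_singleton_pow]; simp⟩
  obtain ⟨b, k, hbk⟩ := hT
  rw [Ideal.span_singleton_pow] at hbk
  obtain ⟨e, he, hwe⟩ := assoc_span hbk
  have ha : X ^ k * f b ≠ 0 := by
    intro h0
    rw [h0, mul_zero] at hwe
    exact pow_ne_zero h hw0 hwe
  refine q.ker_end (a := X ^ k * f b) (e := e) (v := v ^ h) ho hε (hv.pow h) he ha ?_ ?_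
  · rw [map_mul, q.fix]
    rcases skew_pow hX k with h | h
    · left; rw [h]
    · right; rw [h]; ring
  · rw [mul_comm _ e, ← hwe, map_pow, ← mul_pow, hw, mul_pow, map_pow]

/-- norm as hom on units -/
noncomputable def Quad.Nu (q : Quad f s) : Sˣ →* Rˣ where
  toFun e := (Classical.choose_spec (q.nm_unit e.isUnit)).1.unit
  map_one' := by
    ext
    apply q.inj
    simp only [IsUnit.unit_spec]
    rw [(Classical.choose_spec (q.nm_unit (1 : Sˣ).isUnit)).2]
    simp
  map_mul' a b := by
    ext
    apply q.inj
    simp only [IsUnit.unit_spec, Units.val_mul, map_mul]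
    rw [(Classical.choose_spec (q.nm_unit a.isUnit)).2,
      (Classical.choose_spec (q.nm_unit b.isUnit)).2]
    have := (Classical.choose_spec (q.nm_unit (a * b).isUnit)).2
    simp only [Units.val_mul, map_mul] at this ⊢
    rw [this]; ring

theorem Quad.Nu_spec (q : Quad f s) (e : Sˣ) : f (q.Nu e) = e * s e := by
  change f ((Classical.choose_spec (q.nm_unit e.isUnit)).1.unit : R) = _
  simp only [IsUnit.unit_spec]
  exact (Classical.choose_spec (q.nm_unit e.isUnit)).2

theorem Quad.Nu_F (q : Quad f s) (r : Rˣ) : q.Nu (Units.map f r) = r ^ 2 := by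
  ext
  apply q.inj
  rw [q.Nu_spec]
  simp [q.fix, sq]

theorem Quad.normA (q : Quad f s) {a : ℕ} (ha : a ≠ 0) (hH : (sqS Rˣ).index = a)
    (hG : (sqS Sˣ).index = a ^ 2)
    (hk : ∀ (ε : S) (v : R), IsUnit ε → IsUnit v → ε * s ε = f v ^ 2 →
      ∃ b e', IsUnit b ∧ IsUnit e' ∧ ε = f b * e' ^ 2) {u : R} (hu : IsUnit u) :
    ∃ e, IsUnit e ∧ f u = e * s e := by
  have := count_surj (Units.map (f : R →* S)) q.Nu q.Nu_F ha hH hG (by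
    intro ε v h
    obtain ⟨b, e', hb, he, h'⟩ := hk ε v ε.isUnit v.isUnit (by
      rw [← q.Nu_spec, h]; simp)
    refine ⟨hb.unit, he.unit, ?_⟩
    ext
    simp [h']) hu.unit
  obtain ⟨e, he⟩ := this
  refine ⟨e, e.isUnit, ?_⟩
  rw [← q.Nu_spec, he]; simp

end Amb
end TCG
end Part3

section Part4
open Ideal

namespace TCG

section Lev

/-- norm as monoid hom -/
noncomputable def Quad.Nm {R S : Type*} [CommRing R] [CommRing S]
    {f : R →+* S} {s : S ≃+* S} (q : Quad f s) : S →* R where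
  toFun x := Classical.choose (q.mem (x * s x) (by rw [map_mul, q.invol, mul_comm]))
  map_one' := by
    apply q.inj
    rw [Classical.choose_spec (q.mem (1 * s 1) (by simp))]; simp
  map_mul' a b := by
    apply q.inj
    have ha := Classical.choose_spec (q.mem (a * s a) (by rw [map_mul, q.invol, mul_comm]))
    have hb := Classical.choose_spec (q.mem (b * s b) (by rw [map_mul, q.invol, mul_comm]))
    have hab := Classical.choose_spec (q.mem ((a * b) * s (a * b))
      (by rw [map_mul, q.invol, mul_comm]))
    rw [hab, map_mul f, ha, hb, map_mul s]
    ring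

theorem Quad.Nm_spec {R S : Type*} [CommRing R] [CommRing S]
    {f : R →+* S} {s : S ≃+* S} (q : Quad f s) (x : S) : f (q.Nm x) = x * s x :=
  Classical.choose_spec (q.mem (x * s x) (by rw [map_mul, q.invol, mul_comm]))

/-- total positivity -/
def TPos {R : Type*} [CommRing R] (r : R) : Prop := ∀ φ : R →+* ℂ, ∃ t : ℝ, 0 < t ∧ φ r = t

/-- totally real -/
def TReal (R : Type*) [CommRing R] : Prop := ∀ (φ : R →+* ℂ) (r : R), ∃ t : ℝ, φ r = t

/-- The arithmetic facts about a layer of the real cyclotomic tower. -/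
structure Lev (p q : ℕ) {R : Type*} [CommRing R] (x : R) (ν : R →* ℤ) (N : ℕ) : Prop where
  inj : ∀ m : ℤ, (m : R) = 0 → m = 0
  real : TReal R
  pos1 : TPos (2 + x)
  pos2 : TPos (2 - x)
  nu1 : ν (2 + x) = 2
  nu2 : ν (2 - x) = 2
  congr : ∀ (m : ℤ) (r r' : R), (m : R) ∣ r - r' → m ∣ ν r - ν r'
  div : ∀ r, r ∣ (ν r : R)
  ne : ∀ r, r ≠ 0 → ν r ≠ 0
  pp : (span {(p : R)}).IsPrime
  qp : (span {(q : R)}).IsPrime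
  pip : (span {2 - x}).IsPrime
  two : ∃ k : ℕ, (2 : R) ∣ (2 - x) ^ k
  odd : OddCl R
  sqpos : ∀ u : R, IsUnit u → TPos u → ∃ v, IsUnit v ∧ u = v ^ 2
  card : (sqS Rˣ).index = 2 ^ N
  neg : ∃ u, IsUnit u ∧ ν u = -1
  rep : ∀ (D : ℤ) (t r a b : R), t ≠ 0 → t ^ 2 * r = a ^ 2 - D * b ^ 2 →
    ∃ T A B : ℤ, T ≠ 0 ∧ T ^ 2 * ν r = A ^ 2 - D * B ^ 2

variable {p q : ℕ} {R S : Type*} [CommRing R] [IsDedekindDomain R] [CommRing S] [IsDedekindDomain S]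
variable {f : R →+* S} {s : S ≃+* S} {x : R} {ν : R →* ℤ} {N : ℕ}

theorem Lev.nu_zero (L : Lev p q x ν N) : ν 0 = 0 := by
  have := L.div 0
  exact L.inj _ (zero_dvd_iff.1 this)

theorem Lev.dvd_nu (L : Lev p q x ν N) {m : ℤ} {r : R} (h : (m : R) ∣ r) : m ∣ ν r := by
  have := L.congr m r 0 (by simpa using h)
  simpa [L.nu_zero] using this

theorem Lev.unit_of (L : Lev p q x ν N) {r : R} (h : ν r = 1 ∨ ν r = -1) : IsUnit r := by
  have := L.div r
  rcases h with h | h <;> rw [h] at this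
  · exact isUnit_of_dvd_one (by simpa using this)
  · exact isUnit_of_dvd_one (by simpa using this)

theorem Lev.nu_unit (L : Lev p q x ν N) {u : R} (h : IsUnit u) : ν u = 1 ∨ ν u = -1 :=
  Int.isUnit_iff.1 (h.map ν)

theorem Lev.ninj (L : Lev p q x ν N) (m : ℕ) (h : (m : R) = 0) : m = 0 := by
  have := L.inj m (by simpa using h)
  simpa using this

theorem Lev.phi_inj (L : Lev p q x ν N) (φ : R →+* ℂ) : Function.Injective φ := by
  rw [injective_iff_map_eq_zero]
  intro r hr
  by_contra h0
  obtain ⟨t, ht⟩ := L.div r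
  have := congrArg φ ht
  rw [map_mul, hr, zero_mul, map_intCast] at this
  exact L.ne r h0 (by exact_mod_cast this)

theorem Quad.ext (q : Quad f s) (φ : R →+* ℂ) (hφ : Function.Injective φ) :
    ∃ ψ : S →+* ℂ, ∀ r, ψ (f r) = φ r := by
  letI := f.toAlgebra
  letI := φ.toAlgebra
  haveI : FaithfulSMul R S := (faithfulSMul_iff_algebraMap_injective R S).2 q.inj
  haveI : FaithfulSMul R ℂ := (faithfulSMul_iff_algebraMap_injective R ℂ).2 hφ
  haveI : Algebra.IsIntegral R S := by
    constructor
    intro y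
    obtain ⟨t, ht⟩ := q.tr y
    obtain ⟨n, hn⟩ := q.nm y
    refine ⟨Polynomial.X ^ 2 - (Polynomial.C t * Polynomial.X - Polynomial.C n), ?_, ?_⟩
    · apply Polynomial.monic_X_pow_sub
      refine lt_of_le_of_lt (b := (1 : WithBot ℕ)) ((Polynomial.degree_sub_le _ _).trans ?_)
        (by norm_num)
      refine max_le (Polynomial.degree_C_mul_X_le _) (Polynomial.degree_C_le.trans (by norm_num))
    · have h1 : (algebraMap R S) t = y + s y := ht
      have h2 : (algebraMap R S) n = y * s y := hn
      simp only [Polynomial.eval₂_sub, Polynomial.eval₂_mul, Polynomial.eval₂_X_pow,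
        Polynomial.eval₂_C, Polynomial.eval₂_X, h1, h2]
      ring
  haveI : Algebra.IsAlgebraic R S := inferInstance
  let ψ : S →ₐ[R] ℂ := IsAlgClosed.lift
  exact ⟨ψ, fun r => ψ.commutes r⟩

theorem TPos.ne {r : R} (h : TPos r) (φ : R →+* ℂ) : φ r ≠ 0 := by
  obtain ⟨t, ht, e⟩ := h φ
  rw [e]; exact_mod_cast ht.ne'

theorem Lev.pi_assoc (L : Lev p q x ν N) : ∃ v, IsUnit v ∧ 2 + x = v * (2 - x) := by
  have h1 := L.div (2 - x)
  rw [L.nu2] at h1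
  obtain ⟨t, ht⟩ := h1
  have ht' : (2 : R) = (2 - x) * t := by simpa using ht
  have e : 2 + x = (2 * t - 1) * (2 - x) := by linear_combination 2 * ht'
  refine ⟨_, L.unit_of ?_, e⟩
  left
  have := congrArg ν e
  rw [map_mul, L.nu1, L.nu2] at this
  omega

theorem Lev.pi_ne (L : Lev p q x ν N) : 2 - x ≠ 0 := by
  intro h
  have := L.nu2
  rw [h, L.nu_zero] at this
  norm_num at this

theorem Lev.two_ne (L : Lev p q x ν N) : (2 : R) ≠ 0 := by
  intro h
  have := L.inj 2 (by simpa using h)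
  norm_num at this

theorem prime_max {P Q : Ideal R} (hQ : Q.IsPrime) (hQ0 : Q ≠ ⊥) (hP : P ≠ ⊤) (h : Q ≤ P) :
    P = Q := ((hQ.isMaximal hQ0).eq_of_le hP h).symm

/-- the data of a step of the tower -/
structure Step (f : R →+* S) (s : S ≃+* S) (x : R) (X : S) : Prop where
  quad : Quad f s
  sqX : X ^ 2 = f (2 + x)
  neg : s X = -X

theorem Step.X_ne (st : Step f s x X) (L : Lev p q x ν N) : X ≠ 0 := by
  intro h
  have := st.sqX
  rw [h, zero_pow two_ne_zero] at this
  have h2 := L.nu1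
  rw [(map_eq_zero_iff f st.quad.inj).1 this.symm, L.nu_zero] at h2
  norm_num at h2

/-- new norm map -/
noncomputable def Quad.nu (qd : Quad f s) (ν : R →* ℤ) : S →* ℤ := ν.comp qd.Nm

theorem Quad.nu_eq (qd : Quad f s) (ν : R →* ℤ) {y : S} {r : R} (h : f r = y * s y) :
    qd.nu ν y = ν r := by
  have : qd.Nm y = r := qd.inj (by rw [qd.Nm_spec, h])
  change ν (qd.Nm y) = _
  rw [this]

theorem Step.nuX (st : Step f s x X) (L : Lev p q x ν N) :
    st.quad.nu ν X = 2 ∨ st.quad.nu ν X = -2 := by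
  rw [st.quad.nu_eq ν (r := (-1) * (2 + x)) (by rw [map_mul, ← st.sqX, st.neg]; simp; ring)]
  rw [map_mul, L.nu1]
  rcases L.nu_unit (u := -1) isUnit_one.neg with h | h <;> rw [h] <;> simp

theorem Step.nu_pm (st : Step f s x X) (L : Lev p q x ν N) :
    st.quad.nu ν (2 + X) = 2 ∧ st.quad.nu ν (2 - X) = 2 := by
  constructor
  · rw [st.quad.nu_eq ν (r := 2 - x), L.nu2]
    have h := st.sqX
    rw [map_add, map_ofNat] at h
    rw [map_sub, map_add, st.neg, map_ofNat, map_ofNat]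
    linear_combination h
  · rw [st.quad.nu_eq ν (r := 2 - x), L.nu2]
    have h := st.sqX
    rw [map_add, map_ofNat] at h
    rw [map_sub, map_sub, st.neg, map_ofNat, map_ofNat]
    linear_combination h

theorem Step.div (st : Step f s x X) (L : Lev p q x ν N) (y : S) :
    y ∣ ((st.quad.nu ν y : ℤ) : S) := by
  have h1 : y ∣ f (st.quad.Nm y) := by
    rw [st.quad.Nm_spec]; exact dvd_mul_right _ _
  have h2 := map_dvd f (L.div (st.quad.Nm y))
  rw [map_intCast] at h2
  exact h1.trans h2

theorem Step.unit_of (st : Step f s x X) (L : Lev p q x ν N) {y : S}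
    (h : st.quad.nu ν y = 1 ∨ st.quad.nu ν y = -1) : IsUnit y := by
  have := st.div L y
  rcases h with h | h <;> rw [h] at this
  · exact isUnit_of_dvd_one (by simpa using this)
  · exact isUnit_of_dvd_one (by simpa using this)

theorem Step.assocX (st : Step f s x X) (L : Lev p q x ν N) : ∃ v, IsUnit v ∧ 2 - X = v * X := by
  have h1 := st.div L X
  have h2 : X ∣ 2 := by
    rcases st.nuX L with h | h <;> rw [h] at h1
    · simpa using h1
    · simpa using h1
  obtain ⟨t, ht⟩ := h2
  have e : 2 - X = (t - 1) * X := by linear_combination ht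
  refine ⟨_, st.unit_of L ?_, e⟩
  have := congrArg (st.quad.nu ν) e
  rw [map_mul, (st.nu_pm L).2] at this
  rcases st.nuX L with h | h <;> rw [h] at this <;> omega

theorem Step.span_sq (st : Step f s x X) (L : Lev p q x ν N) :
    (span {2 - x}).map f = span {X} ^ 2 := by
  obtain ⟨v, hv, e⟩ := L.pi_assoc
  rw [map_f_span, Ideal.span_singleton_pow, st.sqX, e, map_mul, span_unit_mul (hv.map f)]

theorem Step.primeX (st : Step f s x X) (L : Lev p q x ν N) : (span {X}).IsPrime := by
  have hnu : ¬ IsUnit X := by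
    intro h
    have := Int.isUnit_iff.1 (h.map (st.quad.nu ν))
    rcases st.nuX L with h | h <;> rw [h] at this <;> omega
  have hX0 := st.X_ne L
  have hX0' : span {X} ≠ ⊥ := span_ne.2 hX0
  obtain ⟨P, hPm, hle⟩ := Ideal.exists_le_maximal (span {X}) (by
    rwa [Ne, Ideal.span_singleton_eq_top])
  have hXP : X ∈ P := hle (Ideal.mem_span_singleton_self X)
  have hP0 : P ≠ ⊥ := by
    rintro rfl; exact hX0 (by simpa using hXP)
  have hcm : P.comap f = span {2 - x} := by
    apply prime_max L.pip (span_ne.2 L.pi_ne)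
    · intro h
      rw [Ideal.eq_top_iff_one] at h
      have : f 1 ∈ P := h
      rw [map_one] at this
      exact hPm.ne_top ((Ideal.eq_top_iff_one _).2 this)
    · rw [← Ideal.map_le_iff_le_comap, st.span_sq L, sq]
      exact Ideal.mul_le_left.trans hle
  have key : P = span {X} := by
    rcases st.quad.prime_cases hPm.isPrime hP0 with ⟨h1, h2⟩ | ⟨h1, h2⟩ | ⟨h1, h2, h3⟩
    · exfalso
      rw [hcm, st.span_sq L] at h2
      have hcop : P ⊔ P.map s = ⊤ :=
        hPm.coprime_of_ne ((map_s_isPrime s hPm.isPrime).isMaximal (map_s_ne_bot s hP0))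
          (Ne.symm h1)
      have : span {X} ≤ P * P.map s := by
        rw [Ideal.mul_eq_inf_of_coprime hcop, Ideal.span_singleton_le_iff_mem]
        refine ⟨hXP, ?_⟩
        rw [SetLike.mem_coe, st.quad.mem_s, st.neg]
        exact neg_mem hXP
      rw [← h2] at this
      have h5 : span {X} * 1 ≤ span {X} * span {X} := by rwa [mul_one, ← sq]
      have := cancel_le hX0' h5
      rw [Ideal.one_eq_top, top_le_iff, Ideal.span_singleton_eq_top] at this
      exact hnu this
    · exfalso
      rw [hcm, st.span_sq L] at h2
      have h5 : span {X} * 1 ≤ span {X} * span {X} := by rw [mul_one, ← sq, h2]; exact hle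
      have := cancel_le hX0' h5
      rw [Ideal.one_eq_top, top_le_iff, Ideal.span_singleton_eq_top] at this
      exact hnu this
    · rw [hcm, st.span_sq L] at h2
      have h6 : P ∣ span {X} := Ideal.dvd_iff_le.2 hle
      obtain ⟨C, hC⟩ := h6
      rw [hC, mul_pow] at h2
      have h7 : P ^ 2 * C ^ 2 = P ^ 2 * 1 := by rw [h2, mul_one]
      have h8 := mul_left_cancel₀ (pow_ne_zero 2 hP0) h7
      have h9 : C = 1 := by
        have : IsUnit (C ^ 2) := by rw [h8]; exact isUnit_one
        have := (isUnit_pow_iff two_ne_zero).1 this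
        rwa [Ideal.isUnit_iff, ← Ideal.one_eq_top] at this
      rw [hC, h9, mul_one]
  rw [← key]; exact hPm.isPrime

theorem Lev.two_mem (L : Lev p q x ν N) {P : Ideal R} (hP : P.IsPrime) (h : (2 : R) ∈ P) :
    2 - x ∈ P := by
  obtain ⟨k, hk⟩ := L.two
  exact hP.mem_of_pow_mem k (Ideal.mem_of_dvd P hk h)

theorem Step.ram (st : Step f s x X) (L : Lev p q x ν N) (P : Ideal S) (hP : P.IsPrime)
    (hP0 : P ≠ ⊥) (h : ∀ y, y - s y ∈ P) : P = span {X} := by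
  apply prime_max (st.primeX L) (span_ne.2 (st.X_ne L)) hP.ne_top
  rw [Ideal.span_singleton_le_iff_mem]
  have h1 := h X
  rw [st.neg, sub_neg_eq_add, ← two_mul] at h1
  rcases hP.mem_or_mem h1 with h2 | h2
  · have h3 : 2 - x ∈ P.comap f := by
      haveI := hP
      apply L.two_mem (Ideal.IsPrime.comap f)
      rw [Ideal.mem_comap, map_ofNat]; exact h2
    have h4 : span {X} ^ 2 ≤ P := by
      rw [← st.span_sq L, Ideal.map_le_iff_le_comap, Ideal.span_singleton_le_iff_mem]
      exact h3
    rw [Ideal.span_singleton_pow, Ideal.span_singleton_le_iff_mem] at h4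
    exact hP.mem_of_pow_mem 2 h4
  · exact h2

theorem Step.real (st : Step f s x X) (L : Lev p q x ν N) : TReal S := by
  intro φ y
  obtain ⟨t, ht, e⟩ := L.pos1 (φ.comp f)
  have hX : ∃ c : ℝ, φ X = c ∧ c ≠ 0 := by
    have h1 : (φ X) ^ 2 = ((Real.sqrt t : ℝ) : ℂ) ^ 2 := by
      rw [← map_pow, st.sqX]
      change (φ.comp f) _ = _
      rw [e, ← Complex.ofReal_pow, Real.sq_sqrt ht.le]
    have h0 : Real.sqrt t ≠ 0 := (Real.sqrt_pos.2 ht).ne'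
    rcases sq_eq_sq_iff_eq_or_eq_neg.1 h1 with h | h
    · exact ⟨_, h, h0⟩
    · exact ⟨-Real.sqrt t, by rw [h]; simp, neg_ne_zero.2 h0⟩
  obtain ⟨c, hc, hc0⟩ := hX
  obtain ⟨a, ha⟩ := st.quad.tr y
  obtain ⟨b, hb⟩ := st.quad.mem ((y - s y) * X) (by
    rw [map_mul, map_sub, st.quad.invol, st.neg]; ring)
  obtain ⟨ta, ea⟩ := L.real (φ.comp f) a
  obtain ⟨tb, eb⟩ := L.real (φ.comp f) b
  refine ⟨(ta + tb / c) / 2, ?_⟩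
  have h1 : φ (y + s y) = ta := by rw [← ha, ← ea]; rfl
  have h2 : φ (y - s y) * c = tb := by rw [← hc, ← map_mul, ← hb, ← eb]; rfl
  rw [map_add] at h1
  rw [map_sub] at h2
  have hc' : (c : ℂ) ≠ 0 := by exact_mod_cast hc0
  push_cast
  rw [← h1, ← h2]
  field_simp
  ring

theorem Step.pos (st : Step f s x X) (L : Lev p q x ν N) : TPos (2 + X) ∧ TPos (2 - X) := by
  have key : ∀ φ : S →+* ℂ, ∃ c : ℝ, φ X = c ∧ 0 < 2 + c ∧ 0 < 2 - c := by
    intro φ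
    obtain ⟨c, hc⟩ := st.real L φ X
    obtain ⟨t, ht, e⟩ := L.pos2 (φ.comp f)
    refine ⟨c, hc, ?_⟩
    have h1 : (2 + c) * (2 - c) = t := by
      have h2 : φ ((2 + X) * (2 - X)) = t := by
        rw [← e]
        change φ _ = φ (f _)
        congr 1
        have h := st.sqX
        rw [map_add, map_ofNat] at h
        rw [map_sub, map_ofNat]
        linear_combination -h
      simp only [map_mul, map_add, map_sub, map_ofNat, hc] at h2
      exact_mod_cast h2
    constructor <;> nlinarith
  constructor
  · intro φ
    obtain ⟨c, hc, h1, h2⟩ := key φ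
    exact ⟨2 + c, h1, by rw [map_add, hc, map_ofNat]; simp⟩
  · intro φ
    obtain ⟨c, hc, h1, h2⟩ := key φ
    exact ⟨2 - c, h2, by rw [map_sub, hc, map_ofNat]; simp⟩

theorem TPos.down {u : S} (st : Step f s x X) (L : Lev p q x ν N) (hu : TPos u) {r : R}
    (hr : f r = u * s u) : TPos r := by
  intro φ
  obtain ⟨ψ, hψ⟩ := st.quad.ext φ (L.phi_inj φ)
  obtain ⟨t1, h1, e1⟩ := hu ψ
  obtain ⟨t2, h2, e2⟩ := hu (ψ.comp (s : S →+* S))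
  refine ⟨t1 * t2, mul_pos h1 h2, ?_⟩
  rw [← hψ, hr, map_mul, e1]
  change _ * (ψ.comp (s : S →+* S)) u = _
  rw [e2]; simp

theorem Step.sqpos (st : Step f s x X) (L : Lev p q x ν N) (u : S) (hu : IsUnit u)
    (hpos : TPos u) : ∃ v, IsUnit v ∧ u = v ^ 2 := by
  obtain ⟨r, hr, e⟩ := st.quad.nm_unit hu
  obtain ⟨v, hv, rfl⟩ := L.sqpos r hr (hpos.down st L e)
  obtain ⟨b, e', hb, he', h⟩ := st.quad.kerA L.odd (st.X_ne L) st.neg (st.ram L) hu hv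
    (by rw [← e, map_pow])
  have hbp : TPos b := by
    intro φ
    obtain ⟨ψ, hψ⟩ := st.quad.ext φ (L.phi_inj φ)
    obtain ⟨t1, h1, e1⟩ := hpos ψ
    obtain ⟨t2, e2⟩ := st.real L ψ e'
    obtain ⟨t3, e3⟩ := L.real φ b
    refine ⟨t3, ?_, e3⟩
    have h4 : t1 = t3 * t2 ^ 2 := by
      have := congrArg ψ h
      rw [map_mul, map_pow, hψ, e1, e2, e3] at this
      exact_mod_cast this
    by_contra hneg
    push Not at hneg
    nlinarith [sq_nonneg t2, mul_nonneg (neg_nonneg.2 hneg) (sq_nonneg t2)]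
  obtain ⟨v', hv', rfl⟩ := L.sqpos b hb hbp
  exact ⟨f v' * e', (hv'.map f).mul he', by rw [h, map_pow]; ring⟩

theorem Step.normU (st : Step f s x X) (L : Lev p q x ν N) (hS : (sqS Sˣ).index = 2 ^ (2 * N))
    {u : R} (hu : IsUnit u) : ∃ e, IsUnit e ∧ f u = e * s e := by
  refine st.quad.normA (a := 2 ^ N) (by positivity) L.card (by rw [hS]; ring) ?_ hu
  intro ε v hε hv h
  exact st.quad.kerA L.odd (st.X_ne L) st.neg (st.ram L) hε hv h

theorem Step.prime (st : Step f s x X) (L : Lev p q x ν N) {l : ℕ} (hl : l.Prime) (hl2 : l ≠ 2)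
    (hns : ∀ z : ℤ, ¬ ((l : ℤ) ∣ z ^ 2 - 2)) (hlp : (span {(l : R)}).IsPrime) :
    (span {(l : S)}).IsPrime := by
  have hl0 : (l : R) ≠ 0 := fun h => hl.ne_zero (L.ninj l h)
  have hl0' : (l : S) ≠ 0 := by
    rw [← map_natCast f]; exact st.quad.f_ne.2 hl0
  have hmap : (span {(l : R)}).map f = span {(l : S)} := by rw [map_f_span, map_natCast]
  have hnt : span {(l : S)} ≠ ⊤ := by
    rw [← hmap]
    intro h
    have h2 : (span {(l : R)}).map f = (⊤ : Ideal R).map f := by rw [h, Ideal.map_top]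
    exact hlp.ne_top (st.quad.map_inj h2)
  obtain ⟨P, hPm, hle⟩ := Ideal.exists_le_maximal _ hnt
  have hP0 : P ≠ ⊥ := by
    rintro rfl
    rw [le_bot_iff] at hle; exact span_ne.2 hl0' hle
  have hcm : P.comap f = span {(l : R)} := by
    apply prime_max hlp (span_ne.2 hl0)
    · intro h
      rw [Ideal.eq_top_iff_one] at h
      have : f 1 ∈ P := h
      rw [map_one] at this
      exact hPm.ne_top ((Ideal.eq_top_iff_one _).2 this)
    · rw [← Ideal.map_le_iff_le_comap, hmap]; exact hle
  have h2l : (2 : R) ∉ span {(l : R)} := by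
    intro h
    obtain ⟨k, hk⟩ := hl.odd_of_ne_two hl2
    apply hlp.ne_top
    rw [Ideal.eq_top_iff_one]
    have : (1 : R) = (l : R) - k * 2 := by rw [hk]; push_cast; ring
    rw [this]
    exact sub_mem (Ideal.mem_span_singleton_self _) (Ideal.mul_mem_left _ _ h)
  rcases st.quad.prime_cases hPm.isPrime hP0 with ⟨h1, h2⟩ | ⟨h1, h2⟩ | ⟨h1, h2, h3⟩
  · exfalso
    have hcop : P ⊔ P.map s = ⊤ :=
      hPm.coprime_of_ne ((map_s_isPrime s hPm.isPrime).isMaximal (map_s_ne_bot s hP0))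
        (Ne.symm h1)
    have h1' : (1 : S) ∈ P ⊔ P.map s := by rw [hcop]; trivial
    obtain ⟨a, ha, e, he, hae⟩ := Submodule.mem_sup.1 h1'
    obtain ⟨z, hz⟩ := st.quad.tr (X * e)
    rw [st.quad.mem_s] at he
    have hzX : f z - X ∈ P := by
      have : f z - X = -X * a - X * s e := by
        rw [hz, map_mul, st.neg]
        linear_combination X * hae
      rw [this]
      exact sub_mem (Ideal.mul_mem_left _ _ ha) (Ideal.mul_mem_left _ _ he)
    have h5 : z ^ 2 - (2 + x) ∈ P.comap f := by
      rw [Ideal.mem_comap]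
      have : f (z ^ 2 - (2 + x)) = (f z - X) * (f z + X) := by
        rw [map_sub, ← st.sqX, map_pow]; ring
      rw [this]
      exact Ideal.mul_mem_right _ _ hzX
    rw [hcm, Ideal.mem_span_singleton] at h5
    have := L.congr l _ _ (by simpa using h5)
    rw [map_pow, L.nu1] at this
    exact hns _ this
  · rw [← hmap, ← hcm, h2]; exact hPm.isPrime
  · exfalso
    have h4 := h3 X
    rw [st.neg, sub_neg_eq_add, ← two_mul] at h4
    have h5 : 2 * 2 * (2 + x) ∈ P.comap f := by
      rw [Ideal.mem_comap]
      have : f (2 * 2 * (2 + x)) = 2 * X * (2 * X) := by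
        rw [map_mul, ← st.sqX, map_mul, map_ofNat]; ring
      rw [this]
      exact Ideal.mul_mem_right _ _ h4
    rw [hcm] at h5
    rcases hlp.mem_or_mem h5 with h6 | h6
    · rcases hlp.mem_or_mem h6 with h7 | h7 <;> exact h2l h7
    · rw [Ideal.mem_span_singleton] at h6
      have := L.dvd_nu (m := l) (by simpa using h6)
      rw [L.nu1] at this
      have h8 : l ∣ 2 := by exact_mod_cast this
      exact hl2 ((Nat.prime_dvd_prime_iff_eq hl Nat.prime_two).1 h8)

theorem Step.lev [Finite (ClassGroup S)] (st : Step f s x X) (L : Lev p q x ν N)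
    (hS : (sqS Sˣ).index = 2 ^ (2 * N))
    (hp : p.Prime) (hp2 : p ≠ 2) (hpn : ∀ z : ℤ, ¬ ((p : ℤ) ∣ z ^ 2 - 2))
    (hq : q.Prime) (hq2 : q ≠ 2) (hqn : ∀ z : ℤ, ¬ ((q : ℤ) ∣ z ^ 2 - 2)) :
    Lev p q X (st.quad.nu ν) (2 * N) where
  inj m h := L.inj m (st.quad.inj (by rw [map_intCast, h, map_zero]))
  real := st.real L
  pos1 := (st.pos L).1
  pos2 := (st.pos L).2
  nu1 := (st.nu_pm L).1
  nu2 := (st.nu_pm L).2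
  congr m y y' h := by
    apply L.congr
    obtain ⟨z, hz⟩ := h
    have hy : y = y' + m * z := by linear_combination hz
    obtain ⟨c, hc⟩ := st.quad.tr (y' * s z)
    refine ⟨c + m * st.quad.Nm z, ?_⟩
    apply st.quad.inj
    rw [map_sub, map_mul, map_add, map_mul, hc, st.quad.Nm_spec, st.quad.Nm_spec, st.quad.Nm_spec,
      map_intCast, hy]
    simp only [map_add, map_mul, map_intCast, st.quad.invol]
    ring
  div := st.div L
  ne y hy := by
    apply L.ne
    rw [← st.quad.f_ne, st.quad.Nm_spec]
    exact mul_ne_zero hy (by simpa using hy)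
  pp := st.prime L hp hp2 hpn L.pp
  qp := st.prime L hq hq2 hqn L.qp
  pip := by
    obtain ⟨v, hv, e⟩ := st.assocX L
    rw [e, span_unit_mul hv]; exact st.primeX L
  two := by
    obtain ⟨k, hk⟩ := L.two
    refine ⟨2 * k, ?_⟩
    obtain ⟨v, hv, e⟩ := st.assocX L
    have h1 := map_dvd f hk
    rw [map_ofNat, map_pow] at h1
    have h2 : f (2 - x) ∣ (2 - X) ^ 2 := by
      rw [← Ideal.mem_span_singleton, ← map_f_span, st.span_sq L, Ideal.span_singleton_pow,
        Ideal.mem_span_singleton, e, mul_pow]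
      exact dvd_mul_left _ _
    rw [pow_mul]
    exact h1.trans (pow_dvd_pow_of_dvd h2 k)
  odd := by
    apply oddCl_up st.quad L.odd
    · intro u α β hu _ _ _
      exact st.normU L hS hu
    · intro P hP hP0 _ h
      exact ⟨X, st.ram L P hP hP0 h⟩
  sqpos := st.sqpos L
  card := hS
  neg := by
    obtain ⟨u, hu, h⟩ := L.neg
    obtain ⟨e, he, h'⟩ := st.normU L hS hu
    exact ⟨e, he, by rw [st.quad.nu_eq ν h', h]⟩
  rep D t r a b ht h := by
    obtain ⟨c, hc⟩ := st.quad.tr (a * s b)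
    have h' := congrArg s h
    simp only [map_mul, map_sub, map_pow, map_intCast] at h'
    refine L.rep D (st.quad.Nm t) (st.quad.Nm r) (st.quad.Nm a + D * st.quad.Nm b) c ?_ ?_
    · rw [← st.quad.f_ne, st.quad.Nm_spec]
      exact mul_ne_zero ht (by simpa using ht)
    · apply st.quad.inj
      simp only [map_mul, map_sub, map_pow, map_intCast, map_add, st.quad.Nm_spec, hc,
        st.quad.invol]
      have : (t * s t) ^ 2 * (r * s r) = (t ^ 2 * r) * (s t ^ 2 * s r) := by ring
      rw [this, h, h']; ring

end Lev
end TCG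
end Part4

section Part5
open Ideal

namespace TCG

section NT

theorem nt_descent {l : ℕ} (hl : l.Prime) {D' c : ℤ} (hD : ¬ (l : ℤ) ∣ D')
    (hc : ¬ IsSquare ((c : ℤ) : ZMod l)) :
    ∀ (n : ℕ) (T A B : ℤ), T.natAbs = n → T ≠ 0 → T ^ 2 * c = A ^ 2 - (l * D') * B ^ 2 → False := by
  haveI := Fact.mk hl
  have hlp : Prime (l : ℤ) := Nat.prime_iff_prime_int.1 hl
  intro n
  induction n using Nat.strong_induction_on with
  | _ n ih =>
  intro T A B hn hT h
  have h1 : ((T : ZMod l)) ^ 2 * (c : ZMod l) = (A : ZMod l) ^ 2 := by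
    have := congrArg (Int.cast : ℤ → ZMod l) h
    push_cast at this
    simpa using this
  have hT0 : (T : ZMod l) = 0 := by
    by_contra h0
    apply hc
    refine ⟨(A : ZMod l) / T, ?_⟩
    field_simp
    rw [mul_comm]; linear_combination h1
  rw [ZMod.intCast_zmod_eq_zero_iff_dvd] at hT0
  have hA : (l : ℤ) ∣ A := by
    rw [← ZMod.intCast_zmod_eq_zero_iff_dvd]
    rw [(ZMod.intCast_zmod_eq_zero_iff_dvd T l).2 hT0] at h1
    have : (A : ZMod l) ^ 2 = 0 := by rw [← h1]; ring
    exact pow_eq_zero_iff two_ne_zero |>.1 this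
  obtain ⟨T', rfl⟩ := hT0
  obtain ⟨A', rfl⟩ := hA
  have hl0 : (l : ℤ) ≠ 0 := hlp.ne_zero
  have h2 : D' * B ^ 2 = l * (A' ^ 2 - T' ^ 2 * c) := by
    apply mul_left_cancel₀ hl0
    linear_combination h
  have hB : (l : ℤ) ∣ B := by
    have : (l : ℤ) ∣ D' * B ^ 2 := ⟨_, h2⟩
    rcases hlp.dvd_or_dvd this with h | h
    · exact absurd h hD
    · exact hlp.dvd_of_dvd_pow h
  obtain ⟨B', rfl⟩ := hB
  have hT'0 : T' ≠ 0 := by rintro rfl; simp at hT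
  refine ih T'.natAbs ?_ T' A' B' rfl hT'0 ?_
  · rw [← hn, Int.natAbs_mul, Int.natAbs_natCast]
    have : 0 < T'.natAbs := Int.natAbs_pos.2 hT'0
    have := hl.two_le
    nlinarith
  · apply mul_left_cancel₀ (pow_ne_zero 2 hl0)
    linear_combination h

/-- arithmetic hypotheses on the two primes -/
structure Ari (p q : ℕ) : Prop where
  hp : p.Prime
  hq : q.Prime
  hp8 : p % 8 = 5
  hq8 : q % 8 = 3
  h4 : ∃ x : ZMod p, x ^ 4 = (q : ZMod p)

variable {p q : ℕ}

theorem Ari.p2 (a : Ari p q) : p ≠ 2 := by have := a.hp8; omega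
theorem Ari.q2 (a : Ari p q) : q ≠ 2 := by have := a.hq8; omega
theorem Ari.pq (a : Ari p q) : p ≠ q := by have := a.hq8; have := a.hp8; omega

theorem Ari.p_two (a : Ari p q) : ¬ IsSquare (2 : ZMod p) := by
  haveI := Fact.mk a.hp
  rw [ZMod.exists_sq_eq_two_iff a.p2]
  have := a.hp8; omega

theorem Ari.p_negtwo (a : Ari p q) : ¬ IsSquare (-2 : ZMod p) := by
  haveI := Fact.mk a.hp
  rw [ZMod.exists_sq_eq_neg_two_iff a.p2]
  have := a.hp8; omega

theorem Ari.q_two (a : Ari p q) : ¬ IsSquare (2 : ZMod q) := by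
  haveI := Fact.mk a.hq
  rw [ZMod.exists_sq_eq_two_iff a.q2]
  have := a.hq8; omega

theorem Ari.q_negone (a : Ari p q) : ¬ IsSquare (-1 : ZMod q) := by
  haveI := Fact.mk a.hq
  rw [ZMod.exists_sq_eq_neg_one_iff]
  have := a.hq8; omega

theorem not_dvd_of {l : ℕ} (h : ¬ IsSquare (2 : ZMod l)) (z : ℤ) : ¬ ((l : ℤ) ∣ z ^ 2 - 2) := by
  intro hd
  apply h
  rw [← ZMod.intCast_zmod_eq_zero_iff_dvd] at hd
  push_cast at hd
  exact ⟨z, by linear_combination -hd⟩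

theorem Ari.q_ne (a : Ari p q) : (q : ZMod p) ≠ 0 := by
  rw [Ne, ZMod.natCast_eq_zero_iff]
  intro h
  exact a.pq ((Nat.prime_dvd_prime_iff_eq a.hp a.hq).1 h)

theorem Ari.p_twoq (a : Ari p q) : ¬ IsSquare ((2 * q : ℤ) : ZMod p) := by
  haveI := Fact.mk a.hp
  rintro ⟨z, hz⟩
  obtain ⟨y, hy⟩ := a.h4
  push_cast at hz
  apply a.p_two
  have hy0 : y ≠ 0 := by
    rintro rfl
    apply a.q_ne; rw [← hy]; ring
  refine ⟨z / y ^ 2, ?_⟩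
  field_simp
  rw [← hy] at hz
  linear_combination hz

theorem Ari.nd1 (a : Ari p q) : ¬ (p : ℤ) ∣ q := by
  intro h
  exact a.pq ((Nat.prime_dvd_prime_iff_eq a.hp a.hq).1 (by exact_mod_cast h))

theorem Ari.nd2 (a : Ari p q) : ¬ (q : ℤ) ∣ p := by
  intro h
  exact a.pq ((Nat.prime_dvd_prime_iff_eq a.hq a.hp).1 (by exact_mod_cast h)).symm

/-- `±2` is not represented by the forms of discriminant `± pq` -/
theorem Ari.ntp (a : Ari p q) {D T A B c : ℤ} (hD : D = p * q ∨ D = -(p * q))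
    (hc : c = 2 ∨ c = -2 ∨ c = 2 * q) (hT : T ≠ 0) (h : T ^ 2 * c = A ^ 2 - D * B ^ 2) : False := by
  have hc' : ¬ IsSquare ((c : ℤ) : ZMod p) := by
    rcases hc with rfl | rfl | rfl
    · simpa using a.p_two
    · simpa using a.p_negtwo
    · exact a.p_twoq
  rcases hD with rfl | rfl
  · exact nt_descent a.hp a.nd1 hc' _ T A B rfl hT h
  · exact nt_descent a.hp (D' := -q) (by simpa using a.nd1) hc' _ T A B rfl hT
      (by linear_combination h)

theorem Ari.ntq (a : Ari p q) {T A B : ℤ} (hT : T ≠ 0)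
    (h : T ^ 2 * (-1) = A ^ 2 - (p * q) * B ^ 2) : False :=
  nt_descent a.hq (D' := p) (c := -1) a.nd2 (by simpa using a.q_negone) _ T A B rfl hT
    (by linear_combination h)

end NT

section Base

variable {p q : ℕ} {R : Type*} [CommRing R] [IsDedekindDomain R]

theorem lev_base (a : Ari p q) (e : R ≃+* ℤ) : Lev p q (0 : R) (e : R →* ℤ) 1 := by
  have hcast : ∀ r : R, r = ((e r : ℤ) : R) := fun r => e.injective (by simp)
  have hev : ∀ m : ℤ, e (m : R) = m := fun m => by simp
  have hphi : ∀ (φ : R →+* ℂ) (r : R), φ r = ((e r : ℤ) : ℝ) := by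
    intro φ r
    conv_lhs => rw [hcast r]
    simp
  have hspan : ∀ l : ℕ, l.Prime → (span {(l : R)}).IsPrime := by
    intro l hl
    have h0 : (l : R) ≠ 0 := by
      intro h
      have := congrArg e h
      simp at this
      exact hl.ne_zero this
    rw [Ideal.span_singleton_prime h0]
    rw [← MulEquiv.prime_iff (e : R ≃* ℤ)]
    simpa using Nat.prime_iff_prime_int.1 hl
  have h2 : e (2 : R) = 2 := by simpa using hev 2
  refine ⟨?_, ?_, ?_, ?_, ?_, ?_, ?_, ?_, ?_, hspan p a.hp, hspan q a.hq, ?_, ⟨1, by simp⟩, ?_, ?_,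
    ?_, ?_, ?_⟩
  · intro m h
    have := congrArg e h
    simpa using this
  · intro φ r
    exact ⟨_, hphi φ r⟩
  · intro φ
    refine ⟨2, by norm_num, ?_⟩
    rw [hphi]; simp [h2]
  · intro φ
    refine ⟨2, by norm_num, ?_⟩
    rw [hphi]; simp [h2]
  · simp [h2]
  · simp [h2]
  · intro m r r' h
    have := map_dvd e h
    simpa using this
  · intro r
    have : ((e r : ℤ) : R) = r := (hcast r).symm
    change r ∣ ((e r : ℤ) : R)
    rw [this]
  · intro r hr
    change e r ≠ 0
    simpa using hr
  · have := hspan 2 Nat.prime_two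
    simpa using this
  · refine ⟨1, odd_one, fun I => ?_⟩
    have hI : IsPrincipalIdealRing R := IsPrincipalIdealRing.of_surjective (e.symm : ℤ →+* R)
      e.symm.surjective
    obtain ⟨b, hb⟩ := (hI.principal I).principal
    exact ⟨b, by rw [pow_one]; exact hb⟩
  · intro u hu hpos
    refine ⟨1, isUnit_one, ?_⟩
    have h1 := Int.isUnit_iff.1 (hu.map (e : R →* ℤ))
    rcases h1 with h1 | h1
    · change e u = 1 at h1
      apply e.injective; simp [h1]
    · exfalso
      change e u = -1 at h1
      obtain ⟨t, ht, e1⟩ := hpos ((Int.castRingHom ℂ).comp (e : R →+* ℤ))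
      simp [h1] at e1
      have : t = -1 := by exact_mod_cast e1.symm
      linarith
  · let E : Rˣ ≃* ℤˣ := Units.mapEquiv (e : R ≃* ℤ)
    have h1 : sqS Rˣ = ⊥ := by
      rw [eq_bot_iff]
      rintro _ ⟨y, rfl⟩
      rw [Subgroup.mem_bot]
      apply E.injective
      simp only [powMonoidHom_apply, map_pow, map_one]
      exact Int.units_sq _
    rw [h1, Subgroup.index_bot, Nat.card_congr E.toEquiv]
    simp
  · exact ⟨-1, isUnit_one.neg, by simp⟩
  · intro D t r a b ht h
    refine ⟨e t, e a, e b, by simpa using ht, ?_⟩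
    have := congrArg e h
    simpa using this

end Base

section Cases

variable {p q : ℕ} {R S : Type*} [CommRing R] [IsDedekindDomain R] [CommRing S] [IsDedekindDomain S]
variable {f : R →+* S} {s : S ≃+* S} {x : R} {ν : R →* ℤ} {N : ℕ}

theorem ideal_sq_inj {I J : Ideal S} (h : I ^ 2 = J ^ 2) : I = J := by
  apply dvd_antisymm
  · exact (UniqueFactorizationMonoid.pow_dvd_pow_iff_dvd two_ne_zero).1 h.dvd
  · exact (UniqueFactorizationMonoid.pow_dvd_pow_iff_dvd two_ne_zero).1 h.symm.dvd

theorem comap_ne_top {P : Ideal S} (hP : P.IsPrime) : P.comap f ≠ ⊤ := by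
  intro h
  rw [Ideal.eq_top_iff_one] at h
  have : f 1 ∈ P := h
  rw [map_one] at this
  exact hP.ne_top ((Ideal.eq_top_iff_one _).2 this)

theorem Lev.pos_norm (L : Lev p q x ν N) (qd : Quad f s) {g : S} {d : ℕ} (hd : d ≠ 0)
    (hg : s g = -g) (hg2 : g ^ 2 = -(d : S)) {α : S} {r : R} (hα : α ≠ 0) (hr : f r = α * s α) :
    TPos r := by
  intro φ
  obtain ⟨a, ha⟩ := qd.tr α
  obtain ⟨b, hb⟩ := qd.mem ((α - s α) * g) (by rw [map_mul, map_sub, qd.invol, hg]; ring)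
  have h1 : 4 * d * r = d * a ^ 2 + b ^ 2 := by
    apply qd.inj
    simp only [map_mul, map_add, map_pow, map_natCast, map_ofNat, ha, hb, hr]
    rw [mul_pow, hg2]; ring
  obtain ⟨tr, er⟩ := L.real φ r
  obtain ⟨ta, ea⟩ := L.real φ a
  obtain ⟨tb, eb⟩ := L.real φ b
  have h2 : 4 * d * tr = d * ta ^ 2 + tb ^ 2 := by
    have := congrArg φ h1
    simp only [map_mul, map_add, map_pow, map_natCast, map_ofNat, ea, eb, er] at this
    exact_mod_cast this
  refine ⟨tr, ?_, er⟩
  have hr0 : r ≠ 0 := by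
    rw [← qd.f_ne, hr]; exact mul_ne_zero hα (by simpa using hα)
  have htr : tr ≠ 0 := by
    rintro rfl
    apply hr0
    apply L.phi_inj φ
    rw [er]; simp
  have hd' : (0 : ℝ) < d := by exact_mod_cast Nat.pos_of_ne_zero hd
  have : 0 ≤ tr := by
    by_contra hneg
    push Not at hneg
    nlinarith [mul_pos hd' (neg_pos.2 hneg), mul_nonneg hd'.le (sq_nonneg ta), sq_nonneg tb]
  exact lt_of_le_of_ne this (Ne.symm htr)

theorem Lev.normU_imag (L : Lev p q x ν N) (qd : Quad f s) {g : S} {d : ℕ} (hd : d ≠ 0)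
    (hg : s g = -g) (hg2 : g ^ 2 = -(d : S)) : NormU f s := by
  intro u α β hu hα hβ h
  have h1 : TPos (u * β ^ 2) := L.pos_norm qd hd hg hg2 hα (by rw [← h, map_mul, map_pow])
  have h2 : TPos u := by
    intro φ
    obtain ⟨t, ht, e⟩ := h1 φ
    obtain ⟨tu, eu⟩ := L.real φ u
    obtain ⟨tb, eb⟩ := L.real φ β
    refine ⟨tu, ?_, eu⟩
    rw [map_mul, map_pow, eu, eb] at e
    have e' : tu * tb ^ 2 = t := by exact_mod_cast e
    by_contra hneg
    push Not at hneg
    nlinarith [mul_nonneg (neg_nonneg.2 hneg) (sq_nonneg tb)]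
  obtain ⟨v, hv, rfl⟩ := L.sqpos u hu h2
  exact ⟨f v, hv.map f, by rw [qd.fix, map_pow, sq]⟩

/-- the prime above 2 downstairs -/
theorem Lev.comap_pi (L : Lev p q x ν N) {P : Ideal S} (hP : P.IsPrime) (h : (2 : S) ∈ P) :
    P.comap f = span {2 - x} := by
  apply prime_max L.pip (span_ne.2 L.pi_ne) (comap_ne_top hP)
  rw [Ideal.span_singleton_le_iff_mem]
  haveI := hP
  apply L.two_mem (Ideal.IsPrime.comap f)
  rw [Ideal.mem_comap, map_ofNat]; exact h

theorem Lev.caseB (L : Lev p q x ν N) (qd : Quad f s) [Finite (ClassGroup S)] {j z : S}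
    (hj : s j = -j) (hj2 : j ^ 2 = -1) (hz : z * s z = 1) (hzx : z + s z = f x) :
    OddCl S := by
  apply oddCl_up qd L.odd (L.normU_imag qd one_ne_zero hj (by simpa using hj2))
  intro P hP hP0 hP2 hx
  have h1 := hx j
  rw [hj, sub_neg_eq_add, ← two_mul] at h1
  have h2 : (2 : S) ∈ P := by
    have : (2 : S) = -j * (2 * j) := by linear_combination 2 * hj2
    rw [this]; exact Ideal.mul_mem_left _ _ h1
  refine ⟨1 - z, ideal_sq_inj ?_⟩
  rw [← hP2, L.comap_pi hP h2, map_f_span, Ideal.span_singleton_pow]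
  have : f (2 - x) = -s z * (1 - z) ^ 2 := by
    rw [map_sub, map_ofNat, ← hzx]; linear_combination (z - 2) * hz
  rw [this, span_unit_mul]
  apply IsUnit.neg
  exact IsUnit.of_mul_eq_one z (by rw [mul_comm]; exact hz)

/-- no ideal class with norm `π` is a square -/
theorem Lev.noSq (L : Lev p q x ν N) (a : Ari p q) (qd : Quad f s) {g : S} {D : ℤ}
    (hD : D = p * q ∨ D = -(p * q)) (hg : s g = -g) (hg2 : g ^ 2 = (D : S))
    {G : Ideal S} (hG : G * G.map s = span {f (2 - x)}) {J : Ideal S} (hJ : J ≠ ⊥) :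
    ¬ Pr (G * J ^ 2) := by
  rintro ⟨α, hα⟩
  have hD0 : D ≠ 0 := by
    have h1 : (p : ℤ) * q ≠ 0 := by
      exact_mod_cast mul_ne_zero a.hp.ne_zero a.hq.ne_zero
    rcases hD with rfl | rfl
    · exact h1
    · exact neg_ne_zero.2 h1
  obtain ⟨h, ho, hR⟩ := L.odd
  obtain ⟨J0, hJ00, hJ0⟩ := qd.exists_norm hJ
  obtain ⟨β, hβ⟩ := hR J0
  have hβ0 : β ≠ 0 := by
    rintro rfl
    exact ne_pow hJ00 h (by rw [hβ]; simp)
  obtain ⟨r, hr⟩ := qd.nm (α ^ h)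
  have e1 : span {f r} = span {f ((2 - x) ^ h * β ^ 2)} := by
    rw [hr, ← Ideal.span_singleton_mul_span_singleton, ← map_s_span, ← Ideal.span_singleton_pow,
      ← hα, Ideal.map_pow, ← mul_pow, Ideal.map_mul]
    have : (G * J ^ 2 * (map s G * map s (J ^ 2))) ^ h
        = (G * map s G) ^ h * ((J * map s J) ^ h) ^ 2 := by rw [Ideal.map_pow]; ring
    rw [this, hG, ← hJ0, ← Ideal.map_pow, hβ, map_f_span, Ideal.span_singleton_pow,
      Ideal.span_singleton_pow, Ideal.span_singleton_mul_span_singleton]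
    simp
  obtain ⟨u, hu, hur⟩ := qd.assoc e1
  obtain ⟨a', ha'⟩ := qd.tr (α ^ h)
  obtain ⟨b', hb'⟩ := qd.mem ((α ^ h - s (α ^ h)) * g)
    (by rw [map_mul, map_sub, qd.invol, hg]; ring)
  have e2 : (2 * (D : R)) ^ 2 * r = (D * a') ^ 2 - D * b' ^ 2 := by
    apply qd.inj
    simp only [map_mul, map_sub, map_pow, map_intCast, map_ofNat, ha', hb', hr]
    simp only [mul_pow, hg2]
    ring
  have hne : (2 * (D : R)) ≠ 0 := by
    intro h0
    have := L.inj (2 * D) (by push_cast; exact h0)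
    omega
  obtain ⟨T, A, B, hT, e3⟩ := L.rep D _ r _ _ hne e2
  obtain ⟨k, rfl⟩ := ho
  rw [hur, map_mul, map_mul, map_pow, map_pow, L.nu2] at e3
  have hT' : T * 2 ^ k * ν β ≠ 0 :=
    mul_ne_zero (mul_ne_zero hT (by positivity)) (L.ne β hβ0)
  rcases L.nu_unit hu with hν | hν
  · refine a.ntp hD (c := 2) (A := A) (B := B) (Or.inl rfl) hT' ?_
    rw [hν] at e3
    rw [← e3]; ring
  · refine a.ntp hD (c := -2) (A := A) (B := B) (Or.inr (Or.inl rfl)) hT' ?_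
    rw [hν] at e3
    rw [← e3]; ring

theorem amb_two (qd : Quad f s) (hR : OddCl R) (U : NormU f s) {Q : Ideal S} (hQ0 : Q ≠ ⊥)
    (hQ : Pr (Q ^ 2))
    (hram : ∀ P : Ideal S, P.IsPrime → P ≠ ⊥ → (P.comap f).map f = P ^ 2 →
      (∀ x, x - s x ∈ P) → ∃ i : ℕ, Pr (P * Q ^ i)) (I : Ideal S) (hI : I ≠ ⊥)
    (h2 : Pr (I ^ 2)) : Pr I ∨ Pr (I * Q) := by
  obtain ⟨X, hX0, hXs, hIX⟩ := qd.amb hR U hI h2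
  obtain ⟨h, ho, hR⟩ := hR
  let T : Submonoid (Ideal S) :=
    { carrier := {I | ∃ i : ℕ, Pr (I ^ h * Q ^ i)}
      mul_mem' := by
        rintro a b ⟨i, hi⟩ ⟨j, hj⟩
        refine ⟨i + j, ?_⟩
        have : (a * b) ^ h * Q ^ (i + j) = (a ^ h * Q ^ i) * (b ^ h * Q ^ j) := by ring
        rw [this]; exact hi.mul hj
      one_mem' := ⟨0, by rw [one_pow, pow_zero, mul_one]; exact Pr.one⟩ }
  have hXT : ∃ i : ℕ, Pr (X ^ h * Q ^ i) := by
    refine qd.invariant_mem T ?_ ?_ X hX0 hXs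
    · intro J _
      refine ⟨0, ?_⟩
      rw [← Ideal.map_pow, pow_zero, mul_one]
      exact Pr.map (hR J) f
    · intro P hP hP0 _ hP2 hx
      obtain ⟨i, hi⟩ := hram P hP hP0 hP2 hx
      refine ⟨i * h, ?_⟩
      rw [pow_mul, ← mul_pow]; exact hi.pow h
  obtain ⟨i, hi⟩ := hXT
  have hred : ∀ Y : Ideal S, Pr (I ^ h * Y) → Pr (I * Y) := by
    intro Y hY
    obtain ⟨k, rfl⟩ := ho
    apply (h2.pow k).of_mul (ne_pow (ne_pow hI 2) k)
    have : (I ^ 2) ^ k * (I * Y) = I ^ (2 * k + 1) * Y := by ring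
    rwa [this]
  have hX2 : Pr (X ^ 2) := by
    apply h2.of_mul (ne_pow hI 2)
    rw [← mul_pow]; exact hIX.pow 2
  have h3 : Pr (I ^ h * Q ^ i) := by
    apply (hX2.pow h).of_mul (ne_pow (ne_pow hX0 2) h)
    have : (X ^ 2) ^ h * (I ^ h * Q ^ i) = (I * X) ^ h * (X ^ h * Q ^ i) := by ring
    rw [this]; exact (hIX.pow h).mul hi
  have h4 := hred _ h3
  rcases Nat.even_or_odd' i with ⟨k, rfl | rfl⟩
  · left
    apply (hQ.pow k).of_mul_right (ne_pow (ne_pow hQ0 2) k)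
    rwa [← pow_mul]
  · right
    apply (hQ.pow k).of_mul_right (ne_pow (ne_pow hQ0 2) k)
    have : I * Q * (Q ^ 2) ^ k = I * Q ^ (2 * k + 1) := by ring
    rwa [this]

/-- ideal `(l, g)` -/
def idl (l : ℕ) (g : S) : Ideal S := span {(l : S)} ⊔ span {g}

theorem idl_sq {l m : ℕ} {g : S} (hc : l.Coprime m) {c : S} (hcu : IsUnit c)
    (hg : g ^ 2 = c * (l * m)) : idl l g ^ 2 = span {(l : S)} := by
  have hb : ∃ u v : ℤ, (u : S) * l + v * m = 1 := by
    refine ⟨l.gcdA m, l.gcdB m, ?_⟩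
    have := Nat.gcd_eq_gcd_ab l m
    rw [Nat.Coprime.gcd_eq_one hc] at this
    have h2 := congrArg (Int.cast : ℤ → S) this
    push_cast at h2
    rw [h2]; ring
  obtain ⟨u, v, huv⟩ := hb
  obtain ⟨c', hcc⟩ := hcu.exists_right_inv
  unfold idl
  apply le_antisymm
  · rw [sq, Ideal.sup_mul, Ideal.mul_sup, Ideal.mul_sup]
    simp only [Ideal.span_singleton_mul_span_singleton, sup_le_iff,
      Ideal.span_singleton_le_span_singleton]
    refine ⟨⟨dvd_mul_right _ _, dvd_mul_right _ _⟩, dvd_mul_left _ _, ?_⟩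
    rw [← sq, hg]; exact ⟨c * m, by ring⟩
  · rw [Ideal.span_singleton_le_iff_mem]
    have : (l : S) = u * (l * l) + v * c' * (g * g) := by
      rw [← sq g, hg]
      linear_combination (-(l : S)) * huv - v * l * m * hcc
    have h1 : (l : S) ∈ span {(l : S)} ⊔ span {g} :=
      Ideal.mem_sup_left (Ideal.mem_span_singleton_self _)
    have h2 : g ∈ span {(l : S)} ⊔ span {g} :=
      Ideal.mem_sup_right (Ideal.mem_span_singleton_self _)
    have h3 := add_mem (Ideal.mul_mem_left _ (u : S) (Ideal.mul_mem_mul h1 h1))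
      (Ideal.mul_mem_left _ (v * c') (Ideal.mul_mem_mul h2 h2))
    rw [← this, ← sq] at h3
    exact h3

theorem idl_mul {l m : ℕ} {g : S} (hc : l.Coprime m) {c : S} (hcu : IsUnit c)
    (hg : g ^ 2 = c * (l * m)) : idl l g * idl m g = span {g} := by
  apply ideal_sq_inj
  rw [mul_pow, idl_sq hc hcu hg, idl_sq hc.symm hcu (by rw [hg]; ring),
    Ideal.span_singleton_mul_span_singleton, Ideal.span_singleton_pow, hg, span_unit_mul hcu]

theorem ram_pq (qd : Quad f s) (L : Lev p q x ν N) (a : Ari p q) {g c : S} (hcu : IsUnit c)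
    (hg : g ^ 2 = c * (p * q)) {P : Ideal S} (hP : P.IsPrime)
    (hP2 : (P.comap f).map f = P ^ 2) (hgP : g ∈ P) : P = idl p g ∨ P = idl q g := by
  have hcop : p.Coprime q := (Nat.coprime_primes a.hp a.hq).2 a.pq
  have h1 : c * (p * q) ∈ P := by
    rw [← hg, sq]; exact Ideal.mul_mem_left _ _ hgP
  have h2 := (hP.mem_or_mem h1).resolve_left (fun h => hP.ne_top (Ideal.eq_top_of_isUnit_mem _ h hcu))
  rcases hP.mem_or_mem h2 with h3 | h3
  · left
    apply ideal_sq_inj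
    rw [idl_sq hcop hcu hg, ← hP2]
    have : P.comap f = span {(p : R)} := by
      refine prime_max L.pp (span_ne.2 fun h => a.hp.ne_zero (L.ninj _ h)) (comap_ne_top hP) ?_
      rw [Ideal.span_singleton_le_iff_mem, Ideal.mem_comap, map_natCast]; exact h3
    rw [this, map_f_span, map_natCast]
  · right
    apply ideal_sq_inj
    rw [idl_sq hcop.symm hcu (by rw [hg]; ring), ← hP2]
    have : P.comap f = span {(q : R)} := by
      refine prime_max L.qp (span_ne.2 fun h => a.hq.ne_zero (L.ninj _ h)) (comap_ne_top hP) ?_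
      rw [Ideal.span_singleton_le_iff_mem, Ideal.mem_comap, map_natCast]; exact h3
    rw [this, map_f_span, map_natCast]

end Cases
end TCG
end Part5

section Part6
open Ideal

namespace TCG

section Split
variable {S : Type*} [CommRing S] [IsDedekindDomain S]

/-- ideal `(π, ω)` -/
def gen (l ω : S) : Ideal S := span {l} ⊔ span {ω}

theorem gen_map {T : Type*} [CommRing T] (f : S →+* T) (l ω : S) :
    (gen l ω).map f = gen (f l) (f ω) := by
  unfold gen; rw [Ideal.map_sup, Ideal.map_span, Ideal.map_span, Set.image_singleton,
    Set.image_singleton]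

theorem gen_map_e {T : Type*} [CommRing T] (f : S ≃+* T) (l ω : S) :
    (gen l ω).map f = gen (f l) (f ω) := gen_map (f : S →+* T) l ω

theorem gen_left (l ω : S) : l ∈ gen l ω :=
  Ideal.mem_sup_left (Ideal.mem_span_singleton_self _)

theorem gen_right (l ω : S) : ω ∈ gen l ω :=
  Ideal.mem_sup_right (Ideal.mem_span_singleton_self _)

theorem gen_le {l ω : S} {I : Ideal S} (h1 : l ∈ I) (h2 : ω ∈ I) : gen l ω ≤ I := by
  unfold gen
  rw [sup_le_iff, Ideal.span_singleton_le_iff_mem, Ideal.span_singleton_le_iff_mem]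
  exact ⟨h1, h2⟩

theorem gen_mul_le {l ω l' ω' : S} {I : Ideal S} (h1 : l * l' ∈ I) (h2 : l * ω' ∈ I)
    (h3 : ω * l' ∈ I) (h4 : ω * ω' ∈ I) : gen l ω * gen l' ω' ≤ I := by
  unfold gen
  rw [Ideal.sup_mul, Ideal.mul_sup, Ideal.mul_sup]
  simp only [Ideal.span_singleton_mul_span_singleton, sup_le_iff,
    Ideal.span_singleton_le_iff_mem]
  exact ⟨⟨h1, h2⟩, h3, h4⟩

theorem gen_mul {l a b : S} (hab : a + b = 1) (hl : l ∣ a * b) :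
    gen l a * gen l b = span {l} := by
  apply le_antisymm
  · apply gen_mul_le <;> rw [Ideal.mem_span_singleton]
    · exact dvd_mul_right _ _
    · exact dvd_mul_right _ _
    · exact dvd_mul_left _ _
    · exact hl
  · rw [Ideal.span_singleton_le_iff_mem]
    have := add_mem (Ideal.mul_mem_mul (gen_left l a) (gen_right l b))
      (Ideal.mul_mem_mul (gen_right l a) (gen_left l b))
    have e : l * b + a * l = l := by linear_combination l * hab
    rwa [e] at this

theorem gen_sq {l m u a b : S} (hab : a + b = 1) (hl : m ∣ a * b) (hu : IsUnit u)
    (hm : l ^ 2 = u * m) : gen l a ^ 2 = gen m a := by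
  rw [sq]
  have hm1 : l * l ∈ gen l a * gen l a := Ideal.mul_mem_mul (gen_left l a) (gen_left l a)
  have hm2 : m ∈ gen l a * gen l a := by
    rw [← sq l, hm] at hm1
    exact (Ideal.unit_mul_mem_iff_mem _ hu).1 hm1
  apply le_antisymm
  · apply gen_mul_le
    · rw [← sq, hm]; exact Ideal.mul_mem_left _ _ (gen_left _ _)
    · exact Ideal.mul_mem_left _ _ (gen_right _ _)
    · exact Ideal.mul_mem_right _ _ (gen_right _ _)
    · exact Ideal.mul_mem_right _ _ (gen_right _ _)
  · apply gen_le hm2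
    obtain ⟨t, ht⟩ := hl
    have := add_mem (Ideal.mul_mem_mul (gen_right l a) (gen_right l a))
      (Ideal.mul_mem_right t _ hm2)
    have e : a * a + m * t = a := by linear_combination a * hab - ht
    rwa [e] at this

theorem gen_ne {l a : S} (h : l ≠ 0) : gen l a ≠ ⊥ := by
  intro h'
  have := gen_left l a
  rw [h', Ideal.mem_bot] at this
  exact h this

end Split

section CaseC

variable {p q : ℕ} {R S : Type*} [CommRing R] [IsDedekindDomain R] [CommRing S] [IsDedekindDomain S]
variable {f : R →+* S} {s : S ≃+* S} {x : R} {ν : R →* ℤ} {N : ℕ} {g ω : S}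

structure FD (p q : ℕ) (f : R →+* S) (s : S ≃+* S) (g ω : S) : Prop where
  quad : Quad f s
  neg : s g = -g
  sqg : g ^ 2 = -((p : S) * q)
  om : 2 * ω = 1 + g

theorem Lev.two_neS (L : Lev p q x ν N) (qd : Quad f s) : (2 : S) ≠ 0 := by
  have := (qd.f_ne).2 L.two_ne
  rwa [map_ofNat] at this

theorem Lev.pi_two (L : Lev p q x ν N) : 2 - x ∣ 2 := by
  have := L.div (2 - x)
  rw [L.nu2] at this
  exact_mod_cast this

theorem FD.sum (F : FD p q f s g ω) (L : Lev p q x ν N) : ω + s ω = 1 := by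
  apply mul_left_cancel₀ (L.two_neS F.quad)
  have h := congrArg s F.om
  rw [map_mul, map_add, map_ofNat, map_one, F.neg] at h
  linear_combination F.om + h

theorem FD.diff (F : FD p q f s g ω) (L : Lev p q x ν N) : ω - s ω = g := by
  apply mul_left_cancel₀ (L.two_neS F.quad)
  have h := congrArg s F.om
  rw [map_mul, map_add, map_ofNat, map_one, F.neg] at h
  linear_combination F.om - h

theorem FD.prod (F : FD p q f s g ω) (L : Lev p q x ν N) (a : Ari p q) : (2 : S) ∣ ω * s ω := by
  have h8 : ∃ e, 1 + p * q = 8 * e := by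
    have : (1 + p * q) % 8 = 0 := by
      rw [Nat.add_mod, Nat.mul_mod, a.hp8, a.hq8]
    exact ⟨(1 + p * q) / 8, by omega⟩
  obtain ⟨e, he⟩ := h8
  have he2 := congrArg (Nat.cast : ℕ → S) he
  push_cast at he2
  refine ⟨e, ?_⟩
  have h2 := L.two_neS F.quad
  apply mul_left_cancel₀ h2
  apply mul_left_cancel₀ h2
  have h := congrArg s F.om
  rw [map_mul, map_add, map_ofNat, map_one, F.neg] at h
  linear_combination (2 * s ω) * F.om + (1 + g) * h + he2 - F.sqg

theorem FD.dvd (F : FD p q f s g ω) (L : Lev p q x ν N) (a : Ari p q) :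
    f (2 - x) ∣ ω * s ω := by
  refine dvd_trans ?_ (F.prod L a)
  have := map_dvd f L.pi_two
  rwa [map_ofNat] at this

theorem FD.P1_s (F : FD p q f s g ω) : (gen (f (2 - x)) ω).map s = gen (f (2 - x)) (s ω) := by
  rw [gen_map_e, F.quad.fix]

theorem FD.P1_mul (F : FD p q f s g ω) (L : Lev p q x ν N) (a : Ari p q) :
    gen (f (2 - x)) ω * (gen (f (2 - x)) ω).map s = span {f (2 - x)} := by
  rw [F.P1_s]; exact gen_mul (F.sum L) (F.dvd L a)

theorem FD.pi_ne (F : FD p q f s g ω) (L : Lev p q x ν N) : f (2 - x) ≠ 0 :=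
  F.quad.f_ne.2 L.pi_ne

theorem FD.noSq (F : FD p q f s g ω) (L : Lev p q x ν N) (a : Ari p q) {J : Ideal S}
    (hJ : J ≠ ⊥) : ¬ Pr (gen (f (2 - x)) ω * J ^ 2) := by
  refine L.noSq a F.quad (D := -(p * q)) (Or.inr rfl) F.neg ?_ (F.P1_mul L a) hJ
  rw [F.sqg]; push_cast; ring

theorem FD.cop (F : FD p q f s g ω) (L : Lev p q x ν N) {P : Ideal S}
    (hP : P ≠ ⊤) (h : gen (f (2 - x)) ω ≤ P) : P.map s ≠ P := by
  intro e
  apply hP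
  rw [Ideal.eq_top_iff_one, ← F.sum L]
  refine add_mem (h (gen_right _ _)) ?_
  rw [← F.quad.mem_s, e]
  exact h (gen_right _ _)

theorem FD.prime (F : FD p q f s g ω) (L : Lev p q x ν N) (a : Ari p q) :
    (gen (f (2 - x)) ω).IsPrime := by
  have hne : gen (f (2 - x)) ω ≠ ⊤ := by
    intro h
    apply F.noSq L a (J := 1) one_ne_zero
    rw [h, one_pow, ← Ideal.one_eq_top, mul_one]; exact Pr.one
  obtain ⟨P, hPm, hle⟩ := Ideal.exists_le_maximal _ hne
  have hP := hPm.isPrime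
  have hpi : P.comap f = span {2 - x} := by
    refine prime_max L.pip (span_ne.2 L.pi_ne) (comap_ne_top hP) ?_
    rw [Ideal.span_singleton_le_iff_mem, Ideal.mem_comap]
    exact hle (gen_left _ _)
  have hP0 : P ≠ ⊥ := by
    rintro rfl
    exact gen_ne (F.pi_ne L) (le_bot_iff.1 hle)
  have hs := F.cop L hP.ne_top hle
  rcases F.quad.prime_cases hP hP0 with ⟨_, h⟩ | ⟨h, _⟩ | ⟨h, _⟩
  · obtain ⟨C, hC⟩ := Ideal.dvd_iff_le.2 hle
    rw [hpi, map_f_span, ← F.P1_mul L a, hC, Ideal.map_mul] at h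
    have h2 : (P * P.map s) * (C * C.map s) = (P * P.map s) * 1 := by
      rw [mul_one]; refine Eq.trans ?_ h; ring
    have h3 := mul_left_cancel₀ (mul_ne_zero hP0 (map_s_ne_bot s hP0)) h2
    have hC1 : C = 1 := by
      have := (IsUnit.of_mul_eq_one _ h3)
      exact Ideal.isUnit_iff.1 this |>.trans Ideal.one_eq_top.symm
    rw [hC, hC1, mul_one]; exact hP
  · exact absurd h hs
  · exact absurd h hs

theorem FD.cyc (F : FD p q f s g ω) (L : Lev p q x ν N) (a : Ari p q) [Finite (ClassGroup S)] :
    (∀ I : Ideal S, I ≠ ⊥ → Pr (I ^ 2) → Pr I ∨ Pr (I * idl q g)) ∧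
    ∃ m : ℕ, Odd m ∧ ∀ I : Ideal S, I ≠ ⊥ → ∃ k : ℕ, Pr (I ^ m * gen (f (2 - x)) ω ^ k) := by
  have hcop : p.Coprime q := (Nat.coprime_primes a.hp a.hq).2 a.pq
  have hu : IsUnit (-1 : S) := isUnit_one.neg
  have hg : g ^ 2 = -1 * ((p : S) * q) := by rw [F.sqg]; ring
  have hg' : g ^ 2 = -1 * ((q : S) * p) := by rw [F.sqg]; ring
  have hqS : (q : S) ≠ 0 := by
    have : (q : R) ≠ 0 := fun h => a.hq.ne_zero (L.ninj _ h)
    have := F.quad.f_ne.2 this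
    rwa [map_natCast] at this
  have hQ0 : idl q g ≠ ⊥ := by
    intro h
    have := idl_sq hcop.symm hu hg'
    rw [h, Ideal.bot_pow two_ne_zero] at this
    exact span_ne.2 hqS this.symm
  have hQ2 : Pr (idl q g ^ 2) := ⟨_, idl_sq hcop.symm hu hg'⟩
  have hpq : p * q ≠ 0 := mul_ne_zero a.hp.ne_zero a.hq.ne_zero
  have U := L.normU_imag F.quad hpq F.neg (by rw [F.sqg]; push_cast; rfl)
  have H := amb_two F.quad L.odd U hQ0 hQ2 (by
    intro P hP hP0 hP2 hx
    have hgP : g ∈ P := by rw [← F.diff L]; exact hx ω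
    rcases ram_pq F.quad L a hu hg hP hP2 hgP with h | h
    · exact ⟨1, by rw [h, pow_one]; exact ⟨_, idl_mul hcop hu hg⟩⟩
    · exact ⟨1, by rw [h, pow_one, ← sq]; exact hQ2⟩)
  exact ⟨H, cyc_of hQ0 (gen_ne (F.pi_ne L)) H (fun J hJ => F.noSq L a hJ)⟩

end CaseC
end TCG
end Part6

section Part7
open Ideal

namespace TCG

section CaseD

variable {p q : ℕ} {R S : Type*} [CommRing R] [IsDedekindDomain R] [CommRing S] [IsDedekindDomain S]
variable {f : R →+* S} {s : S ≃+* S} {x : R} {ν : R →* ℤ} {N : ℕ} {g : S} {l : Ideal S}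

structure MD (p q : ℕ) (f : R →+* S) (s : S ≃+* S) (x : R) (g : S) (l : Ideal S) : Prop where
  quad : Quad f s
  neg : s g = -g
  sqg : g ^ 2 = (p : S) * q
  lsq : l ^ 2 = span {f (2 - x)}
  ls : l.map s = l

theorem MD.l_ne (M : MD p q f s x g l) (L : Lev p q x ν N) : l ≠ ⊥ := by
  rintro rfl
  have := M.lsq
  rw [Ideal.bot_pow two_ne_zero] at this
  exact span_ne.2 (M.quad.f_ne.2 L.pi_ne) this.symm

theorem MD.noSq (M : MD p q f s x g l) (L : Lev p q x ν N) (a : Ari p q) {J : Ideal S}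
    (hJ : J ≠ ⊥) : ¬ Pr (l * J ^ 2) := by
  refine L.noSq a M.quad (D := p * q) (Or.inl rfl) M.neg ?_ (by rw [M.ls, ← sq, M.lsq]) hJ
  rw [M.sqg]; push_cast; ring

theorem MD.nopr (M : MD p q f s x g l) (L : Lev p q x ν N) (a : Ari p q) : ¬ Pr l := by
  have := M.noSq L a (J := 1) one_ne_zero
  rwa [one_pow, mul_one] at this

theorem MD.nu_one (M : MD p q f s x g l) (L : Lev p q x ν N) (a : Ari p q) {u β : R} {α : S}
    (hu : IsUnit u) (hβ : β ≠ 0) (h : f u * f β ^ 2 = α * s α) : ν u = 1 := by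
  refine (L.nu_unit hu).resolve_right fun hneg => ?_
  obtain ⟨A, hA⟩ := M.quad.tr α
  obtain ⟨B, hB⟩ := M.quad.mem ((α - s α) * g) (by
    rw [map_mul, map_sub, M.quad.invol, M.neg]; ring)
  have hpR : (p : R) ≠ 0 := fun h => a.hp.ne_zero (L.ninj _ h)
  have hqR : (q : R) ≠ 0 := fun h => a.hq.ne_zero (L.ninj _ h)
  have key : (2 * (p * q) * β) ^ 2 * u = (p * q * A) ^ 2 - ((p * q : ℤ) : R) * B ^ 2 := by
    apply M.quad.inj
    push_cast
    simp only [map_mul, map_sub, map_pow, map_natCast, map_ofNat, hA, hB]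
    linear_combination 4 * ((p : S) * q) ^ 2 * h + (p * q) * (α - s α) ^ 2 * M.sqg
  have ht : 2 * ((p : R) * q) * β ≠ 0 :=
    mul_ne_zero (mul_ne_zero L.two_ne (mul_ne_zero hpR hqR)) hβ
  obtain ⟨T, A', B', hT, hh⟩ := L.rep _ _ _ _ _ ht key
  rw [hneg] at hh
  exact a.ntq hT hh

def KK (f : R →+* S) (s : S ≃+* S) (p : ℕ) (g : S) (l : Ideal S) (h i j : ℕ) (ε : S) : Prop :=
  ∃ (v : R) (W a : S), IsUnit v ∧ W ≠ 0 ∧ a ≠ 0 ∧ (s a = a ∨ s a = -a) ∧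
    ε ^ h * s W = W * f v ∧ span {W} = span {a} * (l ^ i * idl p g ^ j)

theorem sgn_mul {s : S ≃+* S} {a b : S} (h : s a = a ∨ s a = -a) (h' : s b = b ∨ s b = -b) :
    s (a * b) = a * b ∨ s (a * b) = -(a * b) := by
  rw [map_mul]
  rcases h with h | h <;> rcases h' with h' | h' <;> rw [h, h'] <;> simp

theorem KK.mul {h i j i' j' : ℕ} {ε ε' : S} (k : KK f s p g l h i j ε)
    (k' : KK f s p g l h i' j' ε') : KK f s p g l h (i + i') (j + j') (ε * ε') := by
  obtain ⟨v, W, a, hv, hW, ha, hs, h1, h2⟩ := k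
  obtain ⟨v', W', a', hv', hW', ha', hs', h1', h2'⟩ := k'
  refine ⟨v * v', W * W', a * a', hv.mul hv', mul_ne_zero hW hW', mul_ne_zero ha ha',
    sgn_mul hs hs', ?_, ?_⟩
  · rw [map_mul, map_mul, mul_pow]
    linear_combination (ε' ^ h * s W') * h1 + (W * f v) * h1'
  · rw [← Ideal.span_singleton_mul_span_singleton, h2, h2',
      ← Ideal.span_singleton_mul_span_singleton]; ring

theorem KK.red1 (M : MD p q f s x g l) (L : Lev p q x ν N) {h i j : ℕ} {ε : S}
    (k : KK f s p g l h (i + 2) j ε) : KK f s p g l h i j ε := by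
  obtain ⟨v, W, a, hv, hW, ha, hs, h1, h2⟩ := k
  refine ⟨v, W, a * f (2 - x), hv, hW, mul_ne_zero ha (M.quad.f_ne.2 L.pi_ne),
    sgn_mul hs (Or.inl (M.quad.fix _)), h1, ?_⟩
  rw [h2, ← Ideal.span_singleton_mul_span_singleton, ← M.lsq]; ring

theorem MD.psq (M : MD p q f s x g l) (a : Ari p q) : idl p g ^ 2 = span {(p : S)} :=
  idl_sq ((Nat.coprime_primes a.hp a.hq).2 a.pq) isUnit_one (by rw [M.sqg, one_mul])

theorem MD.pmul (M : MD p q f s x g l) (a : Ari p q) : idl p g * idl q g = span {g} :=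
  idl_mul ((Nat.coprime_primes a.hp a.hq).2 a.pq) isUnit_one (by rw [M.sqg, one_mul])

theorem MD.p_ne (M : MD p q f s x g l) (L : Lev p q x ν N) (a : Ari p q) : (p : S) ≠ 0 := by
  have : (p : R) ≠ 0 := fun h => a.hp.ne_zero (L.ninj _ h)
  have := M.quad.f_ne.2 this
  rwa [map_natCast] at this

theorem MD.g_ne (M : MD p q f s x g l) (L : Lev p q x ν N) (a : Ari p q) : g ≠ 0 := by
  have : (q : R) ≠ 0 := fun h => a.hq.ne_zero (L.ninj _ h)
  have := M.quad.f_ne.2 this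
  rw [map_natCast] at this
  have h2 := M.sqg
  rintro rfl
  rw [zero_pow two_ne_zero] at h2
  exact mul_ne_zero (M.p_ne L a) this h2.symm

theorem KK.red2 (M : MD p q f s x g l) (L : Lev p q x ν N) (ar : Ari p q) {h i j : ℕ} {ε : S}
    (k : KK f s p g l h i (j + 2) ε) : KK f s p g l h i j ε := by
  obtain ⟨v, W, a, hv, hW, ha, hs, h1, h2⟩ := k
  refine ⟨v, W, a * p, hv, hW, mul_ne_zero ha (M.p_ne L ar),
    sgn_mul hs (Or.inl (map_natCast s p)), h1, ?_⟩
  rw [h2, ← Ideal.span_singleton_mul_span_singleton, ← M.psq ar]; ring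

theorem KK.red (M : MD p q f s x g l) (L : Lev p q x ν N) (ar : Ari p q) {h : ℕ} {ε : S} :
    ∀ {i j : ℕ}, KK f s p g l h i j ε → KK f s p g l h (i % 2) (j % 2) ε := by
  have r1 : ∀ (n i j : ℕ), KK f s p g l h (i + 2 * n) j ε → KK f s p g l h i j ε := by
    intro n
    induction n with
    | zero => intro i j h; exact h
    | succ n ih => intro i j h; exact ih _ _ (KK.red1 M L (by convert h using 1; ring))
  have r2 : ∀ (n i j : ℕ), KK f s p g l h i (j + 2 * n) ε → KK f s p g l h i j ε := by
    intro n
    induction n with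
    | zero => intro i j h; exact h
    | succ n ih => intro i j h; exact ih _ _ (KK.red2 M L ar (by convert h using 1; ring))
  intro i j k
  refine r2 (j / 2) _ _ (r1 (i / 2) _ _ ?_)
  rw [Nat.mod_add_div, Nat.mod_add_div]
  exact k

theorem KK.triv (M : MD p q f s x g l) {h : ℕ} (ho : Odd h) {ε : S} (hε : IsUnit ε)
    (k : KK f s p g l h 0 0 ε) : ∃ b e', IsUnit b ∧ IsUnit e' ∧ ε = f b * e' ^ 2 := by
  obtain ⟨v, W, a, hv, hW, ha, hs, h1, h2⟩ := k
  rw [pow_zero, pow_zero, mul_one, mul_one] at h2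
  obtain ⟨e, he, rfl⟩ := assoc_span h2
  rw [mul_comm e a] at h1
  exact M.quad.ker_end ho hε hv he ha hs h1

theorem KK.pr {h i j : ℕ} {ε : S} (k : KK f s p g l h i j ε) : Pr (l ^ i * idl p g ^ j) := by
  obtain ⟨v, W, a, hv, hW, ha, hs, h1, h2⟩ := k
  exact Pr.of_mul ⟨a, rfl⟩ (span_ne.2 ha) ⟨W, h2.symm⟩

theorem MD.ram (M : MD p q f s x g l) (L : Lev p q x ν N) (ar : Ari p q) {P : Ideal S}
    (hP : P.IsPrime) (hP2 : (P.comap f).map f = P ^ 2) (hx : ∀ x, x - s x ∈ P) :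
    P = l ∨ P = idl p g ∨ P = idl q g := by
  have h2 : 2 * g ∈ P := by
    have := hx g
    rw [M.neg] at this
    convert this using 1; ring
  rcases hP.mem_or_mem h2 with h | h
  · left
    apply ideal_sq_inj
    rw [M.lsq, ← hP2, L.comap_pi hP h, map_f_span]
  · right
    exact ram_pq M.quad L ar isUnit_one (by rw [M.sqg, one_mul]) hP hP2 h

theorem MD.kk (M : MD p q f s x g l) (L : Lev p q x ν N) (ar : Ari p q) {h : ℕ}
    (hR : ∀ I : Ideal R, ∃ a, I ^ h = span {a}) {ε : S} {v : R} (hε : IsUnit ε) (hv : IsUnit v)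
    (H : ε * s ε = f v ^ 2) : ∃ i j, KK f s p g l h i j ε := by
  obtain ⟨w, hw0, hw⟩ := M.quad.hil hv.ne_zero H
  have hinv := M.quad.unit_w hε hv hw
  let T : Submonoid (Ideal S) :=
    { carrier := {I | ∃ (c b : R) (k i j : ℕ), c ≠ 0 ∧ b ≠ 0 ∧
        I ^ h * span {f c} = span {f b} * span {g ^ k} * (l ^ i * idl p g ^ j)}
      mul_mem' := by
        rintro I I' ⟨c, b, k, i, j, hc, hb, e⟩ ⟨c', b', k', i', j', hc', hb', e'⟩
        refine ⟨c * c', b * b', k + k', i + i', j + j', mul_ne_zero hc hc', mul_ne_zero hb hb', ?_⟩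
        rw [map_mul, map_mul, pow_add g, ← Ideal.span_singleton_mul_span_singleton,
          ← Ideal.span_singleton_mul_span_singleton, ← Ideal.span_singleton_mul_span_singleton,
          mul_pow, mul_mul_mul_comm, e, e']
        ring
      one_mem' := ⟨1, 1, 0, 0, 0, one_ne_zero, one_ne_zero, by simp⟩ }
  have hT : span {w} ∈ T := by
    refine M.quad.invariant_mem T ?_ ?_ _ (span_ne.2 hw0) hinv
    · intro J hJ
      obtain ⟨b, hb⟩ := hR J
      refine ⟨1, b, 0, 0, 0, one_ne_zero, ?_, ?_⟩
      · rintro rfl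
        exact ne_pow hJ h (hb.trans (by simp))
      · rw [← Ideal.map_pow, hb, map_f_span]; simp
    · intro P hP hP0 _ hP2 hx
      rcases M.ram L ar hP hP2 hx with rfl | rfl | rfl
      · exact ⟨1, 1, 0, h, 0, one_ne_zero, one_ne_zero, by simp⟩
      · exact ⟨1, 1, 0, 0, h, one_ne_zero, one_ne_zero, by simp⟩
      · refine ⟨(p : R) ^ h, 1, h, 0, h, pow_ne_zero _ fun h => ar.hp.ne_zero (L.ninj _ h),
          one_ne_zero, ?_⟩
        rw [map_pow, map_natCast, ← Ideal.span_singleton_pow, ← Ideal.span_singleton_pow,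
          ← M.psq ar, ← M.pmul ar, map_one, Ideal.span_singleton_one, ← Ideal.one_eq_top]
        ring
  obtain ⟨c, b, k, i, j, hc, hb, e⟩ := hT
  refine ⟨i, j, v ^ h, w ^ h * f c, f b * g ^ k, hv.pow h,
    mul_ne_zero (pow_ne_zero _ hw0) (M.quad.f_ne.2 hc),
    mul_ne_zero (M.quad.f_ne.2 hb) (pow_ne_zero _ (M.g_ne L ar)),
    sgn_mul (Or.inl (M.quad.fix _)) (skew_pow M.neg k), ?_, ?_⟩
  · rw [map_mul, map_pow, map_pow, M.quad.fix]
    have := congrArg (· ^ h) hw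
    simp only [mul_pow] at this
    linear_combination f c * this
  · rw [← Ideal.span_singleton_mul_span_singleton, ← Ideal.span_singleton_mul_span_singleton,
      ← Ideal.span_singleton_pow, e]

theorem MD.cyc (M : MD p q f s x g l) (L : Lev p q x ν N) (ar : Ari p q) [Finite (ClassGroup S)]
    (hS : (sqS Sˣ).index = 2 ^ (2 * N)) :
    ∃ m : ℕ, Odd m ∧ ∀ I : Ideal S, I ≠ ⊥ → ∃ k : ℕ, Pr (I ^ m * l ^ k) := by
  obtain ⟨h, ho, hR⟩ := L.odd
  have Keven : ∀ (ε : S) (v : R), IsUnit ε → IsUnit v → ε * s ε = f v ^ 2 →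
      (¬ ∃ b e', IsUnit b ∧ IsUnit e' ∧ ε = f b * e' ^ 2) →
      KK f s p g l h 0 1 ε ∨ KK f s p g l h 1 1 ε := by
    intro ε v hε hv H hn
    obtain ⟨i, j, k⟩ := M.kk L ar hR hε hv H
    have k := k.red M L ar
    rcases Nat.mod_two_eq_zero_or_one i with hi | hi <;>
    rcases Nat.mod_two_eq_zero_or_one j with hj | hj <;> rw [hi, hj] at k
    · exact absurd (k.triv M ho hε) hn
    · exact Or.inl k
    · have := k.pr
      rw [pow_one, pow_zero, mul_one] at this
      exact absurd this (M.nopr L ar)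
    · exact Or.inr k
  let H1 : Subgroup Rˣ := (Units.map ν).ker
  have hmem : ∀ u : Rˣ, u ∈ H1 ↔ ν u = 1 := by
    intro u
    change Units.map ν u = 1 ↔ _
    rw [Units.ext_iff]; simp
  have hH1 : H1.index = 2 := by
    rw [Subgroup.index_ker]
    have : (Units.map ν).range = ⊤ := by
      rw [eq_top_iff]
      intro z _
      rcases Int.units_eq_one_or z with rfl | rfl
      · exact one_mem _
      · obtain ⟨u, hu, h⟩ := L.neg
        refine ⟨hu.unit, ?_⟩
        rw [Units.ext_iff]; simpa using h
    rw [this, Subgroup.card_top]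
    simp
  obtain ⟨c1, ε, v, hεv, hεn⟩ := count_two (Units.map (f : R →* S)) M.quad.Nu M.quad.Nu_F (a := 2 ^ N)
    (by positivity) L.card (by rw [hS, ← pow_mul, mul_comm]) (by
      intro ε v ε' v' h1 h2 n1 n2
      have t : ∀ (ε : Sˣ) (v : Rˣ), M.quad.Nu ε = v ^ 2 → (ε : S) * s ε = f v ^ 2 := by
        intro ε v h
        rw [← M.quad.Nu_spec, h]; simp
      have t2 : ∀ ε : Sˣ, (¬ ∃ b e, ε = Units.map (f : R →* S) b * e ^ 2) →
          (¬ ∃ b e', IsUnit b ∧ IsUnit e' ∧ (ε : S) = f b * e' ^ 2) := by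
        rintro ε hn ⟨b, e, hb, he, h⟩
        apply hn
        refine ⟨hb.unit, he.unit, ?_⟩
        ext; simpa using h
      have kε := Keven ε v ε.isUnit v.isUnit (t _ _ h1) (t2 _ n1)
      have kε' := Keven ε' v' ε'.isUnit v'.isUnit (t _ _ h2) (t2 _ n2)
      have fin : KK f s p g l h 0 0 ((ε : S) * ε') →
          ∃ b e, ε * ε' = Units.map (f : R →* S) b * e ^ 2 := by
        intro k
        obtain ⟨b, e, hb, he, h⟩ := k.triv M ho (ε.isUnit.mul ε'.isUnit)
        refine ⟨hb.unit, he.unit, ?_⟩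
        ext; simpa using h
      have bad : ¬ KK f s p g l h 1 0 ((ε : S) * ε') := by
        intro k
        have := k.pr
        rw [pow_one, pow_zero, mul_one] at this
        exact M.nopr L ar this
      rcases kε with k | k <;> rcases kε' with k' | k'
      · exact fin ((k.mul k').red M L ar)
      · exact absurd ((k.mul k').red M L ar) bad
      · exact absurd ((k.mul k').red M L ar) bad
      · exact fin ((k.mul k').red M L ar)) H1 hH1 (by
      rintro u ⟨e, rfl⟩
      rw [hmem]
      exact M.nu_one L ar (Units.isUnit _) (one_ne_zero) (α := (e : S)) (by
        rw [map_one, one_pow, mul_one, M.quad.Nu_spec]))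
  have U : NormU f s := by
    intro u α β hu hα hβ h
    have := M.nu_one L ar hu hβ h
    obtain ⟨e, he⟩ := c1 hu.unit ((hmem _).2 this)
    refine ⟨e, e.isUnit, ?_⟩
    rw [← M.quad.Nu_spec, he]; rfl
  have hP : ∃ i : ℕ, Pr (idl p g * l ^ i) := by
    have : (¬ ∃ b e', IsUnit b ∧ IsUnit e' ∧ (ε : S) = f b * e' ^ 2) := by
      rintro ⟨b, e, hb, he, h⟩
      apply hεn
      refine ⟨hb.unit, he.unit, ?_⟩
      ext; simpa using h
    rcases Keven ε v ε.isUnit v.isUnit (by rw [← M.quad.Nu_spec, hεv]; simp) this with k | k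
    · exact ⟨0, by have := k.pr; rwa [mul_comm, pow_one] at this⟩
    · exact ⟨1, by have := k.pr; rwa [mul_comm, pow_one (idl p g)] at this⟩
  have H := amb_two M.quad L.odd U (M.l_ne L) ⟨_, M.lsq⟩ (by
    intro P hPp hP0 hP2 hx
    rcases M.ram L ar hPp hP2 hx with h | h | h
    · rw [h]; exact ⟨1, by rw [pow_one, ← sq]; exact ⟨_, M.lsq⟩⟩
    · rw [h]; exact hP
    · rw [h]
      obtain ⟨i, hi⟩ := hP
      refine ⟨i, ?_⟩
      have e : idl q g * l ^ i * idl p g ^ 2 = span {g} * (idl p g * l ^ i) := by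
        rw [← M.pmul ar]; ring
      have : Pr (idl q g * l ^ i * idl p g ^ 2) := by
        rw [e]; exact Pr.mul ⟨g, rfl⟩ hi
      refine Pr.of_mul_right ⟨_, M.psq ar⟩ ?_ this
      rw [M.psq ar]; exact span_ne.2 (M.p_ne L ar))
  exact cyc_of (M.l_ne L) (M.l_ne L) H (fun J hJ => M.noSq L ar hJ)

end CaseD
end TCG
end Part7

section Part8
open Ideal

namespace TCG

section Conj

variable {p q : ℕ} {R S : Type*} [CommRing R] [IsDedekindDomain R] [CommRing S] [IsDedekindDomain S]
variable {f : R →+* S} {s : S ≃+* S} {x : R} {ν : R →* ℤ} {N : ℕ} {g ω : S}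

theorem FD.conj (F : FD p q f s g ω) (L : Lev p q x ν N) (ar : Ari p q) (φ : S →+* ℂ) (y : S) :
    φ (s y) = (starRingEnd ℂ) (φ y) := by
  obtain ⟨a, ha⟩ := F.quad.tr y
  obtain ⟨b, hb⟩ := F.quad.mem ((y - s y) * g) (by
    rw [map_mul, map_sub, F.quad.invol, F.neg]; ring)
  obtain ⟨ta, ea⟩ := L.real (φ.comp f) a
  obtain ⟨tb, eb⟩ := L.real (φ.comp f) b
  rw [RingHom.comp_apply, ha, map_add] at ea
  rw [RingHom.comp_apply, hb, map_mul, map_sub] at eb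
  have hG : φ g ^ 2 = -((p * q : ℝ) : ℂ) := by
    rw [← map_pow, F.sqg]; push_cast; simp
  have hpq : (0 : ℝ) < p * q := by
    have := Nat.pos_of_ne_zero ar.hp.ne_zero
    have := Nat.pos_of_ne_zero ar.hq.ne_zero
    positivity
  have hG0 : φ g ≠ 0 := by
    intro h
    rw [h, zero_pow two_ne_zero, eq_comm, neg_eq_zero] at hG
    exact hpq.ne' (by exact_mod_cast hG)
  have hGc : (starRingEnd ℂ) (φ g) = -φ g := by
    have h1 := congrArg Complex.re hG
    have h2 := congrArg Complex.im hG
    rw [sq, Complex.mul_re, Complex.neg_re, Complex.ofReal_re] at h1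
    rw [sq, Complex.mul_im, Complex.neg_im, Complex.ofReal_im] at h2
    have h3 : (φ g).re = 0 := by
      by_contra hne
      have : (φ g).im = 0 := by
        apply mul_left_cancel₀ hne; linarith
      rw [this] at h1
      nlinarith [mul_self_nonneg (φ g).re]
    apply Complex.ext <;> simp [h3]
  have e1 := congrArg (starRingEnd ℂ) ea
  have e2 := congrArg (starRingEnd ℂ) eb
  rw [map_add, Complex.conj_ofReal] at e1
  rw [map_mul, map_sub, Complex.conj_ofReal, hGc] at e2
  have h2 : (2 : ℂ) * φ g ≠ 0 := mul_ne_zero two_ne_zero hG0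
  apply mul_left_cancel₀ h2
  linear_combination (φ g) * ea - (φ g) * e1 - eb + e2

theorem FD.norm_one (F : FD p q f s g ω) (L : Lev p q x ν N) (ar : Ari p q) (φ : S →+* ℂ) {y : S}
    (h : y * s y = 1) : ‖φ y‖ = 1 := by
  have h1 := congrArg φ h
  rw [map_mul, F.conj L ar, Complex.mul_conj, map_one] at h1
  have h2 : Complex.normSq (φ y) = 1 := by exact_mod_cast h1
  rw [Complex.normSq_eq_norm_sq] at h2
  nlinarith [norm_nonneg (φ y)]

theorem Lev.not_sq (L : Lev p q x ν N) (ar : Ari p q) (r : R) : r ^ 2 ≠ (p : R) * q := by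
  intro h
  have hp : (p : R) ≠ 0 := fun h => ar.hp.ne_zero (L.ninj _ h)
  have h1 : r ^ 2 ∈ span {(p : R)} := by
    rw [h]; exact Ideal.mul_mem_right _ _ (Ideal.mem_span_singleton_self _)
  have h2 := L.pp.mem_of_pow_mem _ h1
  rw [Ideal.mem_span_singleton] at h2
  obtain ⟨t, rfl⟩ := h2
  have h3 : (p : R) * t ^ 2 = q := by
    apply mul_left_cancel₀ hp
    rw [← h]; ring
  have hcop : p.Coprime q := (Nat.coprime_primes ar.hp ar.hq).2 ar.pq
  have hb := congrArg (Int.cast : ℤ → R) (Nat.gcd_eq_gcd_ab p q)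
  rw [Nat.Coprime.gcd_eq_one hcop] at hb
  push_cast at hb
  apply L.pp.ne_top
  rw [Ideal.eq_top_iff_one, Ideal.mem_span_singleton]
  rw [hb, ← h3]
  exact dvd_add (dvd_mul_right _ _) (dvd_mul_of_dvd_left (dvd_mul_right _ _) _)

theorem Lev.not_neg_one (L : Lev p q x ν N) (φ : R →+* ℂ) (r : R) : r ^ 2 ≠ -1 := by
  intro h
  obtain ⟨t, ht⟩ := L.real φ r
  have := congrArg φ h
  rw [map_pow, ht, map_neg, map_one] at this
  have h2 : t ^ 2 = -1 := by exact_mod_cast this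
  nlinarith [sq_nonneg t]

theorem FD.no_i (F : FD p q f s g ω) (L : Lev p q x ν N) (ar : Ari p q) (φ : S →+* ℂ) (y : S) :
    y ^ 2 ≠ -1 := by
  intro h
  have h1 : s y ^ 2 = y ^ 2 := by rw [h, ← map_pow, h, map_neg, map_one]
  rcases sq_eq_sq_iff_eq_or_eq_neg.1 h1 with h2 | h2
  · obtain ⟨r, rfl⟩ := F.quad.mem y h2
    refine L.not_neg_one (φ.comp f) r (F.quad.inj ?_)
    rw [map_pow, h, map_neg, map_one]
  · obtain ⟨r, hr⟩ := F.quad.mem (y * g) (by rw [map_mul, h2, F.neg]; ring)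
    apply L.not_sq ar r
    apply F.quad.inj
    rw [map_pow, hr, mul_pow, h, F.sqg, map_mul, map_natCast, map_natCast]; ring

theorem odd_root {ε : S} (hi : ∀ y : S, y ^ 2 ≠ -1) {n : ℕ} (hn : 0 < n) (h : ε ^ n = 1) :
    ∃ m, Odd m ∧ (ε ^ m = 1 ∨ ε ^ m = -1) := by
  obtain ⟨a, m, hm, rfl⟩ := Nat.exists_eq_two_pow_mul_odd hn.ne'
  refine ⟨m, hm, ?_⟩
  have : ∀ (a : ℕ) (z : S), z ^ 2 ^ a = 1 → z = 1 ∨ z = -1 := by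
    intro a
    induction a with
    | zero => intro z hz; left; simpa using hz
    | succ a ih =>
      intro z hz
      have hz2 : (z ^ 2) ^ 2 ^ a = 1 := by rw [← pow_mul, ← pow_succ']; exact hz
      rcases ih _ hz2 with h | h
      · exact sq_eq_sq_iff_eq_or_eq_neg.1 (by rw [h, one_pow])
      · exact absurd h (hi z)
  apply this a
  rw [← pow_mul, mul_comm]; exact h

end Conj

section Tower

variable {p q : ℕ} {R S R' S' : Type*} [CommRing R] [IsDedekindDomain R] [CommRing S]
  [IsDedekindDomain S] [CommRing R'] [IsDedekindDomain R'] [CommRing S'] [IsDedekindDomain S']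
variable {f : R →+* S} {s : S ≃+* S} {x : R} {ν : R →* ℤ} {N : ℕ} {g ω : S}
variable {f' : R' →+* S'} {s' : S' ≃+* S'} {X : R'} {ν' : R' →* ℤ} {N' : ℕ} {g' ω' : S'}
variable {k : R →+* R'} {t : R' ≃+* R'} {l : S →+* S'} {τ : S' ≃+* S'}

structure Tw (f : R →+* S) (s : S ≃+* S) (f' : R' →+* S') (s' : S' ≃+* S')
    (k : R →+* R') (t : R' ≃+* R') (l : S →+* S') (τ : S' ≃+* S') (ω : S) (ω' : S') : Prop where
  quad : Quad l τ
  c1 : ∀ r, l (f r) = f' (k r)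
  c2 : ∀ r, τ (f' r) = f' (t r)
  c3 : ∀ y, s' (l y) = l (s y)
  c4 : ∀ y, τ (s' y) = s' (τ y)
  om : l ω = ω'

theorem Tw.P1_sq (T : Tw f s f' s' k t l τ ω ω') (F : FD p q f s g ω) (F' : FD p q f' s' g' ω')
    (L : Lev p q x ν N) (L' : Lev p q X ν' N') (st : Step k t x X) (ar : Ari p q) :
    gen (f' (2 - X)) ω' ^ 2 = (gen (f (2 - x)) ω).map l := by
  rw [gen_map, T.om]
  obtain ⟨v, hv, e⟩ := st.assocX L
  obtain ⟨v', hv', e'⟩ := L.pi_assoc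
  refine gen_sq (u := f' (v ^ 2 * k v')) (F'.sum L') ?_
    (((hv.pow 2).mul (hv'.map k)).map f') ?_
  · have := map_dvd l (F.dvd L ar)
    rwa [map_mul, T.om, ← T.c3, T.om] at this
  · rw [T.c1, ← map_pow, ← map_mul]
    congr 1
    rw [e, mul_pow, st.sqX, e', map_mul]; ring

theorem Tw.order (T : Tw f s f' s' k t l τ ω ω') (F : FD p q f s g ω) (F' : FD p q f' s' g' ω')
    (L : Lev p q x ν N) (L' : Lev p q X ν' N') (st : Step k t x X) (ar : Ari p q)
    (φ₀ : S' →+* ℂ)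
    (kron : ∀ ε : S', (∀ φ : S' →+* ℂ, ‖φ ε‖ = 1) → ∃ n, 0 < n ∧ ε ^ n = 1)
    {n : ℕ} (hpr : Pr (gen (f' (2 - X)) ω' ^ (2 * n))) : Pr (gen (f (2 - x)) ω ^ n) := by
  have hsq := T.P1_sq F F' L L' st ar
  rw [pow_mul, hsq, ← Ideal.map_pow] at hpr
  obtain ⟨α, hα⟩ := hpr
  have hP0 : gen (f (2 - x)) ω ≠ ⊥ := gen_ne (F.pi_ne L)
  have hα0 : α ≠ 0 := by
    rw [← span_ne, ← hα]; exact T.quad.map_f_ne_bot (ne_pow hP0 n)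
  have hsα : span {s' α} = ((gen (f (2 - x)) ω).map s ^ n).map l := by
    rw [← map_s_span, ← hα, ← Ideal.map_pow]
    change Ideal.map (s' : S' →+* S') (Ideal.map l _) = Ideal.map l (Ideal.map (s : S →+* S) _)
    rw [Ideal.map_map, Ideal.map_map]
    congr 1
    ext y
    exact T.c3 y
  have hprod : span {α * s' α} = span {f' (k ((2 - x) ^ n))} := by
    rw [← Ideal.span_singleton_mul_span_singleton, ← hα, hsα, ← Ideal.map_mul, ← mul_pow,
      F.P1_mul L ar, Ideal.span_singleton_pow, map_f_span, ← map_pow, T.c1]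
  obtain ⟨r, hr⟩ := F'.quad.nm α
  rw [← hr] at hprod
  obtain ⟨η, hη, e1⟩ := F'.quad.assoc hprod
  have hpq : p * q ≠ 0 := mul_ne_zero ar.hp.ne_zero ar.hq.ne_zero
  have hrp : TPos r := L'.pos_norm F'.quad hpq F'.neg (by rw [F'.sqg]; push_cast; rfl) hα0 hr
  have hηp : TPos η := by
    intro φ
    obtain ⟨a, ha, ea⟩ := hrp φ
    obtain ⟨b, hb, eb⟩ := L.pos2 (φ.comp k)
    obtain ⟨c, ec⟩ := L'.real φ η
    refine ⟨c, ?_, ec⟩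
    rw [e1, map_mul, ec, map_pow, map_pow] at ea
    rw [RingHom.comp_apply] at eb
    rw [eb] at ea
    have : c * b ^ n = a := by exact_mod_cast ea
    have hbn : 0 < b ^ n := pow_pos hb n
    by_contra hneg
    push Not at hneg
    nlinarith [mul_nonneg (neg_nonneg.2 hneg) hbn.le]
  obtain ⟨e, he, rfl⟩ := L'.sqpos η hη hηp
  obtain ⟨e', hee⟩ := he.exists_right_inv
  -- normalise
  obtain ⟨α1, hα1⟩ : ∃ a, a = α * f' e' := ⟨_, rfl⟩
  have hu : IsUnit (f' e') := (IsUnit.of_mul_eq_one e (by rw [mul_comm]; exact hee)).map f'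
  have hα1s : span {α1} = (gen (f (2 - x)) ω ^ n).map l := by
    rw [hα1, mul_comm, span_unit_mul hu, hα]
  have hα10 : α1 ≠ 0 := by rw [hα1]; exact mul_ne_zero hα0 hu.ne_zero
  have hn1 : α1 * s' α1 = l (f ((2 - x) ^ n)) := by
    rw [T.c1, hα1, map_mul, F'.quad.fix]
    have h1 : f' e * f' e' = 1 := by rw [← map_mul, hee, map_one]
    have h2 : α * s' α = f' e ^ 2 * f' (k ((2 - x) ^ n)) := by
      rw [← hr, e1, map_mul, map_pow]
    linear_combination (f' e') ^ 2 * h2 + (f' (k ((2 - x) ^ n)) * (f' e * f' e' + 1)) * h1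
  have hτ : span {τ α1} = span {α1} := by
    rw [← map_s_span, hα1s, T.quad.map_map_f]
  obtain ⟨ε, hε, e2⟩ := assoc_span hτ
  have hεs : ε * s' ε = 1 := by
    have h1 := congrArg τ hn1
    rw [T.quad.fix, map_mul, T.c4, e2, map_mul, ← hn1] at h1
    apply mul_right_cancel₀ (mul_ne_zero hα10 (show s' α1 ≠ 0 by simpa using hα10))
    linear_combination h1
  have hετ : ε * τ ε = 1 := by
    have h1 := congrArg τ e2
    rw [T.quad.invol, map_mul, e2] at h1
    apply mul_right_cancel₀ hα10
    linear_combination -h1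
  obtain ⟨N, hN, hεN⟩ := kron ε (fun φ => F'.norm_one L' ar φ hεs)
  obtain ⟨m, hm, hεm⟩ := odd_root (F'.no_i L' ar φ₀) hN hεN
  obtain ⟨j, hj⟩ := hm
  obtain ⟨θ, hθ⟩ : ∃ a, a = ε ^ (j + 1) := ⟨_, rfl⟩
  have hθu : IsUnit θ := by rw [hθ]; exact hε.pow _
  have hθτ : θ * τ θ = 1 := by rw [hθ, map_pow, ← mul_pow, hετ, one_pow]
  have hθ2 : θ ^ 2 = ε ∨ θ ^ 2 = -ε := by
    have : θ ^ 2 = ε ^ m * ε := by rw [hθ, hj]; ring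
    rcases hεm with h | h <;> rw [this, h] <;> simp
  obtain ⟨α2, hα2⟩ : ∃ a, a = α1 * θ := ⟨_, rfl⟩
  have hα2s : span {α2} = (gen (f (2 - x)) ω ^ n).map l := by
    rw [hα2, mul_comm, span_unit_mul hθu, hα1s]
  have hτ2 : τ α2 = α2 ∨ τ α2 = -α2 := by
    have h1 : τ α2 = α1 * ε * τ θ := by rw [hα2, map_mul, e2]; ring
    rcases hθ2 with h | h
    · left
      rw [h1, hα2, ← h]
      linear_combination α1 * θ * hθτ
    · right
      have : ε = -θ ^ 2 := by rw [h, neg_neg]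
      rw [h1, hα2, this]
      linear_combination -α1 * θ * hθτ
  rcases hτ2 with h | h
  · obtain ⟨β, rfl⟩ := T.quad.mem α2 h
    refine ⟨β, T.quad.map_inj ?_⟩
    rw [← hα2s, map_f_span]
  · exfalso
    obtain ⟨a, ha⟩ := T.quad.mem (α2 * f' X) (by rw [map_mul, h, T.c2, st.neg, map_neg]; ring)
    obtain ⟨P, hP⟩ : ∃ P, P = gen (f (2 - x)) ω := ⟨_, rfl⟩
    rw [← hP] at hP0 hα2s
    have hPp : P.IsPrime := by rw [hP]; exact F.prime L ar
    have key : span {a} ^ 2 = (P ^ n) ^ 2 * (P * P.map s) := by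
      apply T.quad.map_inj
      rw [Ideal.map_pow, map_f_span, ha, ← Ideal.span_singleton_mul_span_singleton, mul_pow, hα2s,
        Ideal.map_mul, Ideal.map_pow l (P ^ n) 2]
      congr 1
      rw [hP, F.P1_mul L ar, map_f_span, T.c1, ← map_f_span f' X, ← Ideal.map_pow, ← st.span_sq L,
        map_f_span, map_f_span]
    have hdvd : P ^ n ∣ span {a} :=
      (UniqueFactorizationMonoid.pow_dvd_pow_iff_dvd two_ne_zero).1 ⟨_, key⟩
    obtain ⟨J, hJ⟩ := hdvd
    rw [hJ, mul_pow] at key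
    have key2 := mul_left_cancel₀ (ne_pow (ne_pow hP0 n) 2) key
    have hPJ : P ∣ J := by
      have hpr : Prime P := Ideal.prime_of_isPrime hP0 hPp
      exact hpr.dvd_of_dvd_pow ⟨_, key2⟩
    obtain ⟨J', rfl⟩ := hPJ
    have key3 : P * (P * J' ^ 2) = P * P.map s := by rw [← key2]; ring
    have key4 := mul_left_cancel₀ hP0 key3
    have hle : P.map s ≤ P := by rw [← key4]; exact Ideal.mul_le_left
    apply hPp.ne_top
    rw [Ideal.eq_top_iff_one, ← F.sum L]
    have hω : ω ∈ P := by rw [hP]; exact gen_right _ _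
    exact add_mem hω (hle (mem_map_s.2 hω))

/-- order of the class of `P1` is `2^e` up to odd factors -/
def Ord (P : Ideal S) (e : ℕ) : Prop :=
  (∀ k, Pr (P ^ k) → 2 ^ e ∣ k) ∧ ∃ m, Odd m ∧ Pr (P ^ (2 ^ e * m))

theorem Tw.ord (T : Tw f s f' s' k t l τ ω ω') (F : FD p q f s g ω) (F' : FD p q f' s' g' ω')
    (L : Lev p q x ν N) (L' : Lev p q X ν' N') (st : Step k t x X) (ar : Ari p q)
    (φ₀ : S' →+* ℂ)
    (kron : ∀ ε : S', (∀ φ : S' →+* ℂ, ‖φ ε‖ = 1) → ∃ n, 0 < n ∧ ε ^ n = 1)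
    {e : ℕ} (h : Ord (gen (f (2 - x)) ω) e) : Ord (gen (f' (2 - X)) ω') (e + 1) := by
  obtain ⟨h1, m, hm, h2⟩ := h
  constructor
  · intro n hn
    rcases Nat.even_or_odd' n with ⟨j, rfl | rfl⟩
    · have := h1 _ (T.order F F' L L' st ar φ₀ kron hn)
      rw [pow_succ']
      exact mul_dvd_mul_left 2 this
    · exfalso
      apply F'.noSq L' ar (J := gen (f' (2 - X)) ω' ^ j) (ne_pow (gen_ne (F'.pi_ne L')) j)
      rw [← pow_mul, ← pow_succ', mul_comm j 2]; exact hn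
  · refine ⟨m, hm, ?_⟩
    rw [pow_succ', mul_assoc, pow_mul, T.P1_sq F F' L L' st ar, ← Ideal.map_pow]
    exact h2.map l

end Tower
end TCG
end Part8

section Part9
open Ideal

namespace TCG

section NTB
variable {p q : ℕ}

theorem Ari.ntB (a : Ari p q) {s : ℕ} {X Y : ℤ} (hX : Odd X)
    (h : 4 * 16 ^ s = q * X ^ 2 + p * Y ^ 2) : False := by
  have : Fact p.Prime := ⟨a.hp⟩
  have hn : Odd X.natAbs := Int.natAbs_odd.2 hX
  have hn0 : X.natAbs ≠ 0 := fun h => by rw [h] at hn; exact absurd hn (by decide)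
  have hgn : ∀ b : ℤ, Int.gcd b X.natAbs = Int.gcd b X := by
    intro b; rfl
  have h2s : (2 * 4 ^ s : ℤ) ^ 2 = 4 * 16 ^ s := by
    rw [mul_pow, ← pow_mul, mul_comm s 2, pow_mul]; norm_num
  have hg2 : Int.gcd (2 * 4 ^ s) X.natAbs = 1 := by
    have : IsCoprime (2 * 4 ^ s : ℤ) X := by
      have h2 : IsCoprime (2 : ℤ) X := Int.isCoprime_iff_gcd_eq_one.2 (by
        rw [Int.gcd_comm]
        exact (Int.isCoprime_iff_gcd_eq_one.1 (Int.isCoprime_two_right.2 hX)))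
      have h4 : IsCoprime (4 : ℤ) X := by
        have := h2.mul_left h2
        norm_num at this; exact this
      exact h2.mul_left (h4.pow_left)
    rw [hgn]
    exact Int.isCoprime_iff_gcd_eq_one.1 this
  have hgY : Int.gcd Y X.natAbs = 1 := by
    rw [hgn, ← Int.isCoprime_iff_gcd_eq_one]
    have : IsCoprime (2 * 4 ^ s : ℤ) X := by
      rw [hgn] at hg2
      exact Int.isCoprime_iff_gcd_eq_one.2 hg2
    have h3 : IsCoprime ((2 * 4 ^ s : ℤ) ^ 2) X := this.pow_left
    rw [h2s, h] at h3
    obtain ⟨u, v, huv⟩ := h3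
    exact ⟨u * p * Y, v + u * q * X, by linear_combination huv⟩
  have hJ : jacobiSym (p : ℤ) X.natAbs = 1 := by
    have h1 : jacobiSym ((p : ℤ) * Y ^ 2) X.natAbs = jacobiSym ((2 * 4 ^ s : ℤ) ^ 2) X.natAbs := by
      rw [jacobiSym.mod_left, jacobiSym.mod_left ((2 * 4 ^ s : ℤ) ^ 2)]
      congr 1
      rw [h2s, h]
      apply Int.ModEq.symm
      rw [Int.modEq_iff_dvd]
      have : (X.natAbs : ℤ) ∣ X := Int.natAbs_dvd.2 dvd_rfl
      refine dvd_trans this ⟨-(q * X), by ring⟩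
    rw [jacobiSym.mul_left, jacobiSym.sq_one' hgY, jacobiSym.sq_one' hg2, mul_one] at h1
    exact h1
  rw [jacobiSym.quadratic_reciprocity_one_mod_four (by have := a.hp8; omega) hn,
    ← jacobiSym.legendreSym.to_jacobiSym] at hJ
  have hXne : ((X.natAbs : ℤ) : ZMod p) ≠ 0 := by
    intro h0
    have := (legendreSym.eq_zero_iff p (X.natAbs : ℤ)).2 h0
    rw [this] at hJ; exact absurd hJ (by decide)
  obtain ⟨y, hy⟩ := (legendreSym.eq_one_iff p hXne).1 hJ
  obtain ⟨z, hz⟩ := a.h4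
  have hmod := congrArg (Int.cast : ℤ → ZMod p) h
  push_cast at hmod
  rw [CharP.cast_eq_zero (ZMod p) p, zero_mul, add_zero, ← hz] at hmod
  have hX2 : (X : ZMod p) ^ 2 = (y * y) ^ 2 := by
    rw [← hy]
    have : ((X.natAbs : ℤ)) ^ 2 = X ^ 2 := Int.natAbs_sq X
    have := congrArg (Int.cast : ℤ → ZMod p) this
    push_cast at this ⊢
    exact this.symm
  have h2s' : (2 * 4 ^ s : ZMod p) ^ 2 = 4 * 16 ^ s := by
    have := congrArg (Int.cast : ℤ → ZMod p) h2s
    push_cast at this; exact this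
  have hfin : (2 * 4 ^ s : ZMod p) ^ 2 = ((z * y) ^ 2) ^ 2 := by
    rw [h2s', hmod, hX2]; ring
  have h2ne : (2 : ZMod p) ≠ 0 := by
    intro h0
    exact a.p_two (by rw [h0]; exact IsSquare.zero)
  have h4s : (4 ^ s : ZMod p) = (2 ^ s) ^ 2 := by
    rw [← pow_mul, mul_comm s 2, pow_mul]; norm_num
  have h2s0 : (2 ^ s : ZMod p) ≠ 0 := pow_ne_zero _ h2ne
  rcases sq_eq_sq_iff_eq_or_eq_neg.1 hfin with h5 | h5
  · apply a.p_two
    refine ⟨z * y / 2 ^ s, ?_⟩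
    field_simp
    rw [← h4s, h5]; ring
  · apply a.p_negtwo
    refine ⟨z * y / 2 ^ s, ?_⟩
    field_simp
    rw [← h4s]
    linear_combination -h5
end NTB

section BaseOrd
variable {p q : ℕ} {R S : Type*} [CommRing R] [IsDedekindDomain R] [CommRing S] [IsDedekindDomain S]
variable {f : R →+* S} {s : S ≃+* S} {g ω : S} {ν : R →* ℤ}

theorem idl_s {l : ℕ} (hg : s g = -g) : (idl l g).map s = idl l g := by
  change Ideal.map (s : S →+* S) (span {(l : S)} ⊔ span {g}) = _
  rw [Ideal.map_sup, map_f_span, map_f_span, map_natCast]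
  change span {(l : S)} ⊔ span {s g} = _
  rw [hg, Ideal.span_singleton_neg]; rfl

theorem FD.coord (F : FD p q f s g ω) (L : Lev p q (0 : R) ν 1) (ar : Ari p q) (e : R ≃+* ℤ)
    (y : S) {n : ℤ} (hn : y * s y = n) :
    ∃ A Y : ℤ, 2 * y = A - g * Y ∧ 4 * n = A ^ 2 + p * q * Y ^ 2 := by
  obtain ⟨a, ha⟩ := F.quad.tr y
  obtain ⟨b, hb⟩ := F.quad.mem ((y - s y) * g) (by
    rw [map_mul, map_sub, F.quad.invol, F.neg]; ring)
  have hR : ∀ r : R, r = ((e r : ℤ) : R) := fun r => e.injective (by simp)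
  have hfI : ∀ m : ℤ, f (m : R) = (m : S) := fun m => map_intCast f m
  have hinj : ∀ m m' : ℤ, (m : S) = m' → m = m' := by
    intro m m' h
    have : f ((m - m' : ℤ) : R) = 0 := by rw [hfI]; push_cast; rw [h, sub_self]
    have h2 := L.inj _ ((map_eq_zero_iff f F.quad.inj).1 this)
    linarith
  rw [hR a, hfI] at ha
  rw [hR b, hfI] at hb
  obtain ⟨A, hA⟩ : ∃ A, A = e a := ⟨_, rfl⟩
  obtain ⟨B, hB⟩ : ∃ B, B = e b := ⟨_, rfl⟩
  rw [← hA] at ha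
  rw [← hB] at hb
  have h1 : B ^ 2 = p * q * (4 * n - A ^ 2) := by
    apply hinj
    push_cast
    rw [ha, hb, ← hn, mul_pow, F.sqg]; ring
  have hpp : Prime (p : ℤ) := Nat.prime_iff_prime_int.1 ar.hp
  have hqp : Prime (q : ℤ) := Nat.prime_iff_prime_int.1 ar.hq
  have hdp : (p : ℤ) ∣ B := hpp.dvd_of_dvd_pow (n := 2) ⟨q * (4 * n - A ^ 2), by rw [h1]; ring⟩
  have hdq : (q : ℤ) ∣ B := hqp.dvd_of_dvd_pow (n := 2) ⟨p * (4 * n - A ^ 2), by rw [h1]; ring⟩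
  have hcop : IsCoprime (p : ℤ) q := by
    rw [Nat.isCoprime_iff_coprime]; exact (Nat.coprime_primes ar.hp ar.hq).2 ar.pq
  obtain ⟨Y, hY⟩ := hcop.mul_dvd hdp hdq
  have hpq0 : (p : ℤ) * q ≠ 0 := mul_ne_zero hpp.ne_zero hqp.ne_zero
  refine ⟨A, Y, ?_, ?_⟩
  · have hg0 : g ≠ 0 := by
      rintro rfl
      have := F.sqg
      rw [zero_pow two_ne_zero, eq_comm, neg_eq_zero] at this
      have h3 : ((p * q : ℤ) : S) = (0 : ℤ) := by push_cast; exact this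
      exact hpq0 (hinj _ _ h3)
    have h4 : (y - s y) = - g * Y := by
      apply mul_right_cancel₀ hg0
      rw [← hb, hY]; push_cast
      linear_combination (Y : S) * F.sqg
    linear_combination -ha + h4
  · apply mul_left_cancel₀ hpq0
    rw [hY] at h1
    linear_combination -h1

theorem FD.alpha (F : FD p q f s g ω) (L : Lev p q (0 : R) ν 1) (ar : Ari p q) (e : R ≃+* ℤ)
    {k : ℕ} {α : S} (hα : gen (f (2 - 0)) ω ^ k * idl q g = span {α}) :
    α * s α = ((q * 2 ^ k : ℤ) : S) := by
  have hcop : p.Coprime q := (Nat.coprime_primes ar.hp ar.hq).2 ar.pq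
  have hu : IsUnit (-1 : S) := isUnit_one.neg
  have hg' : g ^ 2 = -1 * ((q : S) * p) := by rw [F.sqg]; ring
  have hsα := congrArg (Ideal.map s) hα
  rw [map_s_span, Ideal.map_mul, Ideal.map_pow, idl_s F.neg] at hsα
  have hprod : span {α * s α} = span {f (2 ^ k * q)} := by
    rw [← Ideal.span_singleton_mul_span_singleton, ← hα, ← hsα]
    have : gen (f (2 - 0)) ω ^ k * idl q g * ((gen (f (2 - 0)) ω).map s ^ k * idl q g)
      = (gen (f (2 - 0)) ω * (gen (f (2 - 0)) ω).map s) ^ k * idl q g ^ 2 := by ring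
    rw [this, F.P1_mul L ar, idl_sq hcop.symm hu hg', Ideal.span_singleton_pow,
      Ideal.span_singleton_mul_span_singleton, map_mul, map_pow, map_natCast, sub_zero]
  obtain ⟨r, hr⟩ := F.quad.nm α
  rw [← hr] at hprod
  obtain ⟨u, hu, e1⟩ := F.quad.assoc hprod
  have hR : ∀ r : R, r = ((e r : ℤ) : R) := fun r => e.injective (by simp)
  have hfI : ∀ m : ℤ, f (m : R) = (m : S) := fun m => map_intCast f m
  have hqpos : (0 : ℤ) < q * 2 ^ k := by
    have : (0 : ℤ) < q := by exact_mod_cast ar.hq.pos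
    positivity
  have hr2 : α * s α = ((e u * (q * 2 ^ k) : ℤ) : S) := by
    rw [← hr, e1, ← hfI]
    congr 1
    push_cast
    rw [← hR u]; ring
  have hpos : 0 ≤ e u * (q * 2 ^ k) := by
    obtain ⟨A, Y, _, h4⟩ := F.coord L ar e α hr2
    have : 0 ≤ A ^ 2 + p * q * Y ^ 2 := by positivity
    omega
  have heu : e u = 1 := by
    rcases Int.isUnit_iff.1 (hu.map e) with h | h
    · exact h
    · rw [h] at hpos; omega
  rw [heu, one_mul] at hr2
  exact hr2

theorem FD.noA (F : FD p q f s g ω) (L : Lev p q (0 : R) ν 1) (ar : Ari p q) (e : R ≃+* ℤ)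
    {k : ℕ} (hk : Odd k) : ¬ Pr (gen (f (2 - 0)) ω ^ k * idl q g) := by
  rintro ⟨α, hα⟩
  obtain ⟨A, Y, _, h4⟩ := F.coord L ar e α (F.alpha L ar e hα)
  obtain ⟨i, rfl⟩ := hk
  refine ar.ntp (D := -(p * q)) (T := 2 * 2 ^ i) (A := A) (B := Y) (Or.inr rfl)
    (Or.inr (Or.inr rfl)) (by positivity) ?_
  linear_combination h4

theorem FD.noB (F : FD p q f s g ω) (L : Lev p q (0 : R) ν 1) (ar : Ari p q) (e : R ≃+* ℤ)
    {k : ℕ} (hk : 0 < k) : ¬ Pr (gen (f (2 - 0)) ω ^ (4 * k) * idl q g) := by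
  rintro ⟨α, hα⟩
  have hcop : p.Coprime q := (Nat.coprime_primes ar.hp ar.hq).2 ar.pq
  have hu : IsUnit (-1 : S) := isUnit_one.neg
  have hg' : g ^ 2 = -1 * ((q : S) * p) := by rw [F.sqg]; ring
  obtain ⟨A, Y, hAY, h4⟩ := F.coord L ar e α (F.alpha L ar e hα)
  have hpp : Prime (p : ℤ) := Nat.prime_iff_prime_int.1 ar.hp
  have hqp : Prime (q : ℤ) := Nat.prime_iff_prime_int.1 ar.hq
  have hpo : (p : ℤ) % 2 = 1 := by have := ar.hp8; omega
  have hqo : (q : ℤ) % 2 = 1 := by have := ar.hq8; omega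
  have h16 : (2 : ℤ) ^ (4 * k) = 16 ^ k := by rw [pow_mul]; norm_num
  rw [h16] at h4
  -- `α` is not divisible by two
  have hnd : ¬ (2 : S) ∣ α := by
    rintro ⟨β, rfl⟩
    obtain ⟨P, hP⟩ : ∃ P, P = gen (f (2 - 0)) ω := ⟨_, rfl⟩
    have hmul := F.P1_mul L ar
    rw [← hP, sub_zero, map_ofNat] at hmul
    have hPp : P.IsPrime := by rw [hP]; exact F.prime L ar
    have hsP : (P.map s).IsPrime := map_s_isPrime s hPp
    have hω : ω ∈ P := by rw [hP]; exact gen_right _ _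
    have h2P : (2 : S) ∈ P := by
      have := gen_left (f (2 - 0)) ω
      rwa [← hP, sub_zero, map_ofNat] at this
    have h2sP : (2 : S) ∈ P.map s := by
      have := (mem_map_s (s := s)).2 h2P
      rwa [map_ofNat] at this
    have hle : P ^ (4 * k) * idl q g ≤ P.map s := by
      rw [hP, hα, ← hP, Ideal.span_singleton_le_iff_mem]
      exact Ideal.mul_mem_right _ _ h2sP
    rcases hsP.mul_le.1 hle with h | h
    · have h := hsP.le_of_pow_le h
      apply hsP.ne_top
      rw [Ideal.eq_top_iff_one, ← F.sum L]
      exact add_mem (h hω) (mem_map_s.2 hω)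
    · have hq : (q : S) ∈ P.map s := h (Ideal.mem_sup_left (Ideal.mem_span_singleton_self _))
      apply hsP.ne_top
      rw [Ideal.eq_top_iff_one]
      obtain ⟨j, hj⟩ : ∃ j : ℕ, q = 2 * j + 1 := ⟨q / 2, by have := ar.hq8; omega⟩
      have : (1 : S) = q - 2 * j := by rw [hj]; push_cast; ring
      rw [this]
      exact sub_mem hq (Ideal.mul_mem_right _ _ h2sP)
  have hdA : (q : ℤ) ∣ A := hqp.dvd_of_dvd_pow (n := 2)
    ⟨4 * 16 ^ k - p * Y ^ 2, by linear_combination -h4⟩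
  obtain ⟨X, rfl⟩ := hdA
  have h5 : 4 * 16 ^ k = q * X ^ 2 + p * Y ^ 2 := by
    apply mul_left_cancel₀ hqp.ne_zero
    linear_combination h4
  rcases Int.even_or_odd X with hX | hX
  · -- both even
    have hY : Even Y := by
      by_contra hY
      rw [Int.not_even_iff_odd] at hY
      obtain ⟨i, rfl⟩ := hX
      obtain ⟨j, rfl⟩ := hY
      obtain ⟨p', hp'⟩ : ∃ p' : ℤ, (p : ℤ) = 2 * p' + 1 := ⟨p / 2, by omega⟩
      rw [hp'] at h5
      have : 2 * (2 * 16 ^ k - q * 2 * i ^ 2 - p' * (2 * j + 1) ^ 2 - 2 * j ^ 2 - 2 * j) = 1 := by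
        linear_combination h5
      omega
    obtain ⟨i, rfl⟩ := hX
    obtain ⟨j, rfl⟩ := hY
    have h6 : 16 ^ k = q * i ^ 2 + p * j ^ 2 := by
      apply mul_left_cancel₀ (show (4 : ℤ) ≠ 0 by norm_num)
      linear_combination h5
    have h7 : α = q * i - g * j := by
      apply mul_left_cancel₀ (L.two_neS F.quad)
      rw [hAY]; push_cast; ring
    obtain ⟨p', hp'⟩ : ∃ p' : ℤ, (p : ℤ) = 2 * p' + 1 := ⟨p / 2, by omega⟩
    obtain ⟨q', hq'⟩ : ∃ q' : ℤ, (q : ℤ) = 2 * q' + 1 := ⟨q / 2, by omega⟩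
    obtain ⟨k', rfl⟩ : ∃ k', k = k' + 1 := ⟨k - 1, by omega⟩
    have hpar : (i + j) % 2 = 0 := by
      have h8 : (i ^ 2 + j ^ 2) = 2 * (8 * 16 ^ k' - q' * i ^ 2 - p' * j ^ 2) := by
        rw [hp', hq', pow_succ] at h6
        linear_combination -h6
      have h9 : (i + j) ^ 2 = 2 * (8 * 16 ^ k' - q' * i ^ 2 - p' * j ^ 2 + i * j) := by
        linear_combination h8
      have h10 : (2 : ℤ) ∣ (i + j) := Int.prime_two.dvd_of_dvd_pow ⟨_, h9⟩
      omega
    obtain ⟨m, hm⟩ : ∃ m, i + j = 2 * m := ⟨(i + j) / 2, by omega⟩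
    apply hnd
    refine ⟨q' * i + m - ω * j, ?_⟩
    have hq2 := congrArg (Int.cast : ℤ → S) hq'
    have hm2 := congrArg (Int.cast : ℤ → S) hm
    push_cast at hq2 hm2
    rw [h7]
    linear_combination (j : S) * F.om + hm2 + (i : S) * hq2
  · exact ar.ntB hX h5

theorem FD.base (F : FD p q f s g ω) (L : Lev p q (0 : R) ν 1) (ar : Ari p q) (e : R ≃+* ℤ)
    [Finite (ClassGroup S)] : Ord (gen (f (2 - 0)) ω) 2 := by
  obtain ⟨H, -⟩ := F.cyc L ar
  have hP0 : gen (f (2 - 0)) ω ≠ ⊥ := gen_ne (F.pi_ne L)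
  have hodd : ∀ k, Odd k → ¬ Pr (gen (f (2 - 0)) ω ^ k) := by
    rintro k ⟨j, rfl⟩ hn
    apply F.noSq L ar (J := gen (f (2 - 0)) ω ^ j) (ne_pow hP0 j)
    rw [← pow_mul, ← pow_succ', mul_comm j 2]; exact hn
  constructor
  · intro k hk
    rcases Nat.even_or_odd' k with ⟨j, rfl | rfl⟩
    · rcases Nat.even_or_odd' j with ⟨i, rfl | rfl⟩
      · exact ⟨i, by ring⟩
      · exfalso
        rw [mul_comm, pow_mul] at hk
        rcases H _ (ne_pow hP0 _) hk with h | h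
        · exact hodd _ ⟨i, rfl⟩ h
        · exact F.noA L ar e ⟨i, rfl⟩ h
    · exact absurd hk (hodd _ ⟨j, rfl⟩)
  · obtain ⟨a, m, hm, hpr⟩ := pr_card hP0
    refine ⟨m, hm, ?_⟩
    have : ∀ b, Pr (gen (f (2 - 0)) ω ^ (2 ^ (b + 2) * m)) → Pr (gen (f (2 - 0)) ω ^ (2 ^ 2 * m)) := by
      intro b
      induction b with
      | zero => intro h; exact h
      | succ b ih =>
        intro h
        apply ih
        have e1 : 2 ^ (b + 1 + 2) * m = 2 ^ (b + 2) * m * 2 := by ring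
        rw [e1, pow_mul] at h
        rcases H _ (ne_pow hP0 _) h with h | h
        · exact h
        · exfalso
          have e2 : 2 ^ (b + 2) * m = 4 * (2 ^ b * m) := by ring
          rw [e2] at h
          exact F.noB L ar e (Nat.mul_pos (by positivity) hm.pos) h
    apply this a
    rw [pow_add, mul_right_comm, pow_mul]
    exact hpr.pow _

end BaseOrd
end TCG
end Part9

section Part10
open Ideal
namespace TCG

section Dia

/-- the biquadratic diamond -/
structure Dia (p q : ℕ) {R SF SK SM SL : Type*} [CommRing R] [CommRing SF] [CommRing SK]
    [CommRing SM] [CommRing SL] (x : R)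
    (fF : R →+* SF) (sF : SF ≃+* SF) (g ω : SF) (fK : R →+* SK) (sK : SK ≃+* SK) (j z : SK)
    (fM : R →+* SM) (sM : SM ≃+* SM) (gm : SM)
    (eF : SF →+* SL) (eK : SK →+* SL) (eM : SM →+* SL) (ρ σ c : SL ≃+* SL) : Prop where
  F : FD p q fF sF g ω
  K : Quad fK sK
  hj : sK j = -j
  hj2 : j ^ 2 = -1
  hz : z * sK z = 1
  hzx : z + sK z = fK x
  M : Quad fM sM
  hm : sM gm = -gm
  hm2 : gm ^ 2 = (p : SM) * q
  qF : Quad eF ρ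
  qK : Quad eK σ
  qM : Quad eM c
  cFK : ∀ r, eF (fF r) = eK (fK r)
  cFM : ∀ r, eF (fF r) = eM (fM r)
  rho : ∀ y, ρ y = c (σ y)
  comm : ∀ y, σ (c y) = c (σ y)
  F1 : ∀ y, c (eF y) = eF (sF y)
  K1 : ∀ y, c (eK y) = eK (sK y)
  M1 : ∀ y, σ (eM y) = eM (sM y)

variable {p q : ℕ} {R SF SK SM SL : Type*} [CommRing R] [CommRing SF] [CommRing SK]
    [CommRing SM] [CommRing SL] [IsDedekindDomain R] [IsDedekindDomain SF] [IsDedekindDomain SK]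
    [IsDedekindDomain SM] [IsDedekindDomain SL] {x : R}
    {fF : R →+* SF} {sF : SF ≃+* SF} {g ω : SF} {fK : R →+* SK} {sK : SK ≃+* SK} {j z : SK}
    {fM : R →+* SM} {sM : SM ≃+* SM} {gm : SM}
    {eF : SF →+* SL} {eK : SK →+* SL} {eM : SM →+* SL} {ρ σ c : SL ≃+* SL}
    {ν : R →* ℤ} {N : ℕ}

theorem map_s_comp {S : Type*} [CommRing S] (a b d : S ≃+* S) (h : ∀ y, d y = a (b y))
    (I : Ideal S) : I.map d = (I.map b).map a := by
  have : (d : S →+* S) = (a : S →+* S).comp (b : S →+* S) := by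
    ext y; exact h y
  change I.map (d : S →+* S) = (I.map (b : S →+* S)).map (a : S →+* S)
  rw [this, Ideal.map_map]

theorem map_fs_comp {S T : Type*} [CommRing S] [CommRing T] (a : T ≃+* T) (b : S ≃+* S)
    (e : S →+* T) (h : ∀ y, a (e y) = e (b y))
    (I : Ideal S) : (I.map e).map a = (I.map b).map e := by
  have : (a : T →+* T).comp e = e.comp (b : S →+* S) := by
    ext y; exact h y
  change (I.map e).map (a : T →+* T) = (I.map (b : S →+* S)).map e
  rw [Ideal.map_map, Ideal.map_map, this]

theorem gen_unit {S : Type*} [CommRing S] {u l ω : S} (hu : IsUnit u) :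
    gen (u * l) ω = gen l ω := by
  unfold gen
  rw [Ideal.span_singleton_mul_left_unit hu]

theorem Dia.csr (D : Dia p q x fF sF g ω fK sK j z fM sM gm eF eK eM ρ σ c) (y : SL) :
    σ y = c (ρ y) := by
  rw [D.rho, D.qM.invol]

theorem Dia.t1 (D : Dia p q x fF sF g ω fK sK j z fM sM gm eF eK eM ρ σ c)
    (L : Lev p q x ν N) (ar : Ari p q) [Finite (ClassGroup SK)] {m : ℕ}
    (hm : ∀ J : Ideal SM, J ≠ ⊥ → Pr (J.map eM ^ m)) :
    ∃ h : ℕ, Odd h ∧ ∀ (I : Ideal SL) (J : Ideal SF), I ≠ ⊥ → J.map eF = I * I.map ρ → Pr J →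
      Pr (I ^ (h * m)) := by
  obtain ⟨h, ho, hK⟩ := L.caseB D.K D.hj D.hj2 D.hz D.hzx
  refine ⟨h, ho, ?_⟩
  rintro I J hI hJ ⟨β0, rfl⟩
  obtain ⟨JK, hJK0, hJK⟩ := D.qK.exists_norm hI
  obtain ⟨δ, hδ⟩ := hK JK
  set I' := I ^ h with hI'
  have hI'0 : I' ≠ ⊥ := ne_pow hI h
  have eb : I' * I'.map ρ = span {eF (β0 ^ h)} := by
    rw [hI', Ideal.map_pow, ← mul_pow, ← hJ, map_f_span, Ideal.span_singleton_pow, map_pow]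
  have ee : I' * I'.map σ = span {eK δ} := by
    rw [hI', Ideal.map_pow, ← mul_pow, ← hJK, ← Ideal.map_pow, hδ, map_f_span]
  set β := β0 ^ h with hβ
  have hb0 : eF β ≠ 0 := by
    rw [← span_ne, ← eb]; exact ne_mul hI'0 (map_s_ne_bot ρ hI'0)
  have he0 : eK δ ≠ 0 := by
    rw [← span_ne, ← ee]; exact ne_mul hI'0 (map_s_ne_bot σ hI'0)
  have hβ0 : β ≠ 0 := D.qF.f_ne.1 hb0
  have hδ0 : δ ≠ 0 := D.qK.f_ne.1 he0
  obtain ⟨r, hr⟩ := D.F.quad.nm β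
  obtain ⟨r', hr'⟩ := D.K.nm δ
  have k1 : (I'.map ρ).map c = I'.map σ := (map_s_comp c ρ σ D.csr I').symm
  have k2 : (I'.map σ).map c = I'.map ρ := (map_s_comp c σ ρ D.rho I').symm
  have s1 : span {eF (fF r)} = (I' * I'.map ρ) * (I'.map c * I'.map σ) := by
    rw [hr, map_mul, ← D.F1, ← Ideal.span_singleton_mul_span_singleton, ← map_s_span, ← eb,
      Ideal.map_mul, k1]
  have s2 : span {eK (fK r')} = (I' * I'.map σ) * (I'.map c * I'.map ρ) := by
    rw [hr', map_mul, ← D.K1, ← Ideal.span_singleton_mul_span_singleton, ← map_s_span, ← ee,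
      Ideal.map_mul, k2]
  have s3 : span {eF (fF r)} = span {eF (fF r')} := by
    rw [s1, D.cFK r', s2]; ring
  obtain ⟨u1, hu1, e1⟩ := D.qF.assoc s3
  obtain ⟨u, hu, hur⟩ := D.F.quad.assoc (show span {fF r} = span {fF r'} by
    rw [e1, span_unit_mul hu1])
  have hpq : p * q ≠ 0 := mul_ne_zero ar.hp.ne_zero ar.hq.ne_zero
  have P1 : TPos r := L.pos_norm D.F.quad hpq D.F.neg (by rw [D.F.sqg]; push_cast; rfl) hβ0 hr
  have P2 : TPos r' := L.pos_norm D.K one_ne_zero D.hj (by simpa using D.hj2) hδ0 hr'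
  have P3 : TPos u := by
    intro φ
    obtain ⟨t, ht, e⟩ := P1 φ
    obtain ⟨t', ht', e'⟩ := P2 φ
    refine ⟨t / t', div_pos ht ht', ?_⟩
    rw [hur, map_mul, e'] at e
    have : (t' : ℂ) ≠ 0 := by exact_mod_cast ht'.ne'
    push_cast
    rw [eq_div_iff this, e]
  obtain ⟨v, hv, huv⟩ := L.sqpos u hu P3
  set e := eK (fK v * δ) with hedef
  set b := eF β with hbdef
  have ee' : I' * I'.map σ = span {e} := by
    rw [ee, hedef, map_mul, span_unit_mul]
    exact (hv.map fK).map eK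
  have key : b * c b = e * c e := by
    rw [hbdef, D.F1, ← map_mul, ← hr, D.cFK, hedef, D.K1, ← map_mul, map_mul sK, D.K.fix, hur, huv]
    congr 1
    rw [map_mul, hr', map_pow]; ring
  obtain ⟨B, hB⟩ := D.qM.nm b
  have hcb : c b ≠ 0 := by simpa using hb0
  have hB0 : B ≠ 0 := by
    apply D.qM.f_ne.1; rw [hB]; exact mul_ne_zero hb0 hcb
  obtain ⟨w, hw0, hw⟩ := D.qM.hil (α := e * c b) (β := B) hB0 (by
    rw [hB, map_mul, D.qM.invol]
    linear_combination (-(b * c b)) * key)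
  have hw' : e * c w = w * b := by
    apply mul_left_cancel₀ hcb
    rw [hB] at hw
    linear_combination hw
  set X := span {w} * I'.map ρ with hX
  have hX0 : X ≠ ⊥ := ne_mul (span_ne.2 hw0) (map_s_ne_bot ρ hI'0)
  have hXc : X.map c = X := by
    apply mul_left_cancel₀ hI'0
    rw [hX, Ideal.map_mul, map_s_span, k1]
    calc I' * (span {c w} * I'.map σ) = (I' * I'.map σ) * span {c w} := by ring
      _ = (I' * I'.map ρ) * span {w} := by
          rw [ee', eb, Ideal.span_singleton_mul_span_singleton,
            Ideal.span_singleton_mul_span_singleton, hw', mul_comm]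
      _ = _ := by ring
  let T : Submonoid (Ideal SL) :=
    { carrier := {Y | Pr (Y ^ m)}
      one_mem' := by simp only [Set.mem_ofPred_eq, one_pow]; exact Pr.one
      mul_mem' := by
        intro a b ha hb
        simp only [Set.mem_ofPred_eq, mul_pow] at *
        exact ha.mul hb }
  have hXT : X ∈ T := by
    apply D.qM.invariant_mem T hm ?_ X hX0 hXc
    intro P hP hP0 _ _ hx
    exfalso
    -- L/M is unramified
    have h1 := hx (eK j)
    rw [D.K1, D.hj, map_neg, sub_neg_eq_add, ← two_mul] at h1
    have hj2 : (eK j) ^ 2 = -1 := by rw [← map_pow, D.hj2]; simp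
    have h2 : (2 : SL) ∈ P := by
      have : (2 : SL) = -eK j * (2 * eK j) := by linear_combination 2 * hj2
      rw [this]; exact Ideal.mul_mem_left _ _ h1
    have h3 := hx (eF ω)
    rw [D.F1, ← map_sub, D.F.diff L] at h3
    have h4 : ((p * q : ℕ) : SL) ∈ P := by
      have : ((p * q : ℕ) : SL) = -eF g * eF g := by
        have := congrArg eF D.F.sqg
        simp only [map_pow, map_neg, map_mul, map_natCast] at this
        push_cast
        linear_combination this
      rw [this]; exact Ideal.mul_mem_left _ _ h3
    apply hP.ne_top
    rw [Ideal.eq_top_iff_one]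
    have hodd : Odd (p * q) := (ar.hp.odd_of_ne_two ar.p2).mul (ar.hq.odd_of_ne_two ar.q2)
    obtain ⟨k, hk⟩ := hodd
    have : (1 : SL) = ((p * q : ℕ) : SL) - k * 2 := by rw [hk]; push_cast; ring
    rw [this]
    exact Ideal.sub_mem _ h4 (Ideal.mul_mem_left _ _ h2)
  have hXm : Pr (X ^ m) := hXT
  rw [hX, mul_pow] at hXm
  have h5 : Pr ((I'.map ρ) ^ m) := Pr.of_mul (Pr.pow ⟨_, rfl⟩ m) (ne_pow (span_ne.2 hw0) m) hXm
  have h6 := h5.map_e ρ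
  rw [Ideal.map_pow, D.qF.map_map, hI', ← pow_mul] at h6
  exact h6

/-- final assembly -/
theorem Dia.final (D : Dia p q x fF sF g ω fK sK j z fM sM gm eF eK eM ρ σ c)
    (L : Lev p q x ν N) (ar : Ari p q) [Finite (ClassGroup SK)] [Finite (ClassGroup SF)]
    [Finite (ClassGroup SM)] [Finite (ClassGroup SL)]
    (hS : (sqS SMˣ).index = 2 ^ (2 * N)) {e : ℕ} (O : Ord (gen (fF (2 - x)) ω) e) :
    Nonempty (CommGroup.primaryComponent (ClassGroup SL) 2 ≃* Multiplicative (ZMod (2 ^ e))) := by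
  set lam := eK (1 - z) with hlam
  set G := gen lam (eF ω) with hG
  have hzu : IsUnit (sK z) := IsUnit.of_mul_eq_one z (by rw [mul_comm]; exact D.hz)
  have hzu' : IsUnit (-eK (sK z)) := (hzu.map eK).neg
  have lamc : c lam = -eK (sK z) * lam := by
    rw [hlam, D.K1, ← map_neg, ← map_mul]
    congr 1
    rw [map_sub, map_one]; linear_combination -D.hz
  have lams : σ lam = lam := D.qK.fix _
  have lamr : ρ lam = -eK (sK z) * lam := by rw [D.rho, lams, lamc]
  have lam2 : -eK (sK z) * lam ^ 2 = eF (fF (2 - x)) := by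
    rw [D.cFK, hlam, ← map_pow, ← map_neg, ← map_mul]
    congr 1
    rw [map_sub, map_ofNat, ← D.hzx]; linear_combination (2 - z) * D.hz
  have hpi0 : eF (fF (2 - x)) ≠ 0 := D.qF.f_ne.2 (D.F.pi_ne L)
  have lam0 : lam ≠ 0 := by
    intro h; rw [h] at lam2; apply hpi0; rw [← lam2]; ring
  have hG0 : G ≠ ⊥ := gen_ne lam0
  have hsum : eF ω + eF (sF ω) = 1 := by rw [← map_add, D.F.sum L, map_one]
  have hdvd : eF (fF (2 - x)) ∣ eF ω * eF (sF ω) := by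
    rw [← map_mul]; exact map_dvd eF (D.F.dvd L ar)
  have Gr : G.map ρ = G := by
    rw [hG, gen_map_e, lamr, gen_unit hzu', D.qF.fix]
  have Gc : G.map c = gen lam (eF (sF ω)) := by
    rw [hG, gen_map_e, lamc, gen_unit hzu', D.F1]
  have G2 : G * G.map ρ = (gen (fF (2 - x)) ω).map eF := by
    obtain ⟨u, hu⟩ := hzu'
    rw [Gr, ← sq, gen_map, hG]
    refine gen_sq (u := ((u⁻¹ : SLˣ) : SL)) hsum hdvd (Units.isUnit _) ?_
    rw [← lam2, ← hu, Units.inv_mul_cancel_left]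
  have GG : G * G.map c = span {lam} := by
    rw [Gc, hG]
    refine gen_mul hsum (dvd_trans ?_ hdvd)
    rw [← lam2]; exact ⟨-eK (sK z) * lam, by ring⟩
  obtain ⟨l, hl0, hl⟩ := D.qM.exists_norm hG0
  rw [GG] at hl
  have MM : MD p q fM sM x gm l := by
    refine ⟨D.M, D.hm, D.hm2, ?_, ?_⟩
    · apply D.qM.map_inj
      rw [Ideal.map_pow, hl, map_f_span, ← D.cFM, ← lam2, Ideal.span_singleton_pow,
        span_unit_mul hzu']
    · apply D.qM.map_inj
      rw [← map_fs_comp σ sM eM D.M1, hl, map_s_span, lams]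
  obtain ⟨m, hmo, hm⟩ := MM.cyc L ar hS
  obtain ⟨h, ho, T1⟩ := D.t1 L ar (m := m) (by
    intro J hJ
    obtain ⟨k, hk⟩ := hm J hJ
    have := hk.map eM
    rw [Ideal.map_mul, Ideal.map_pow, Ideal.map_pow, hl] at this
    exact Pr.of_mul_right (Pr.pow ⟨_, rfl⟩ k) (ne_pow (span_ne.2 lam0) k) this)
  obtain ⟨-, m', hmo', hm'⟩ := D.F.cyc L ar
  obtain ⟨O1, m'', hmo'', O2⟩ := O
  refine fin_of hG0 ?_ ?_ ?_
  · rintro k ⟨y, hy⟩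
    apply O1
    obtain ⟨r, hr⟩ := D.qF.nm y
    refine ⟨r, D.qF.map_inj ?_⟩
    rw [map_f_span, hr, Ideal.map_pow, ← G2, ← Ideal.span_singleton_mul_span_singleton,
      ← map_s_span, ← hy, mul_pow, Ideal.map_pow]
  · refine ⟨m'' * (h * m), hmo''.mul (ho.mul hmo), ?_⟩
    have := T1 (G ^ (2 ^ e * m'')) _ (ne_pow hG0 _)
      (by rw [Ideal.map_pow ρ, ← mul_pow, G2, Ideal.map_pow]) O2
    rwa [← pow_mul, mul_assoc] at this
  · refine ⟨m' * (h * m), hmo'.mul (ho.mul hmo), ?_⟩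
    intro I hI
    obtain ⟨J, hJ0, hJ⟩ := D.qF.exists_norm hI
    obtain ⟨k, hk⟩ := hm' J hJ0
    refine ⟨k * (h * m), ?_⟩
    have := T1 (I ^ m' * G ^ k) _ (ne_mul (ne_pow hI _) (ne_pow hG0 _)) (by
      rw [Ideal.map_mul, Ideal.map_pow, Ideal.map_pow, hJ, ← G2, Ideal.map_mul, Ideal.map_pow,
        Ideal.map_pow]
      ring) hk
    rwa [mul_pow, ← pow_mul, ← pow_mul] at this

end Dia
end TCG
end Part10

section Part11
open Ideal
namespace TCG

section UnitsIdx
open NumberField NumberField.Units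

theorem isReal_of {K : Type*} [Field K] [NumberField K] (h : TReal (𝓞 K)) (φ : K →+* ℂ) (y : K) :
    ∃ t : ℝ, φ y = t := by
  obtain ⟨a, b, hb, rfl⟩ := IsFractionRing.div_surjective (A := 𝓞 K) y
  obtain ⟨t, ht⟩ := h (φ.comp (algebraMap (𝓞 K) K)) a
  obtain ⟨t', ht'⟩ := h (φ.comp (algebraMap (𝓞 K) K)) b
  rw [RingHom.comp_apply] at ht ht'
  exact ⟨t / t', by rw [map_div₀, ht, ht']; push_cast; rfl⟩

theorem totReal_of {K : Type*} [Field K] [NumberField K] (h : TReal (𝓞 K)) : IsTotallyReal K := by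
  rw [isTotallyReal_iff]
  intro v
  rw [InfinitePlace.isReal_iff, ComplexEmbedding.isReal_iff]
  ext y
  obtain ⟨t, ht⟩ := isReal_of h v.embedding y
  rw [ComplexEmbedding.conjugate_coe_eq, ht, Complex.conj_ofReal]

theorem torsion_real {K : Type*} [Field K] [NumberField K] (h : TReal (𝓞 K)) {u : (𝓞 K)ˣ}
    (hu : u ∈ torsion K) : u = 1 ∨ u = -1 := by
  obtain ⟨φ⟩ : Nonempty (K →+* ℂ) := inferInstance
  obtain ⟨t, ht⟩ := isReal_of h φ (u : K)
  obtain ⟨n, hn, hun⟩ := isOfFinOrder_iff_pow_eq_one.1 ((CommGroup.mem_torsion _).1 hu)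
  have h1 : t ^ n = 1 := by
    have := congrArg (fun v : (𝓞 K)ˣ => φ (v : K)) hun
    simp only [coe_pow, map_pow, ht, coe_one, map_one] at this
    exact_mod_cast this
  have h2 : t = 1 ∨ t = -1 := by
    have : |t| = 1 := by
      have h3 : |t| ^ n = 1 := by rw [← abs_pow, h1, abs_one]
      exact (pow_eq_one_iff_of_nonneg (abs_nonneg t) hn.ne').1 h3
    exact eq_or_eq_neg_of_abs_eq this
  rcases h2 with rfl | rfl
  · left
    apply coe_injective
    apply φ.injective
    rw [ht]; simp
  · right
    apply coe_injective
    apply φ.injective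
    rw [ht]; simp

theorem not_sq_neg_one {K : Type*} [Field K] [NumberField K] (h : TReal (𝓞 K)) {u : (𝓞 K)ˣ}
    (hu : u ^ 2 = -1) : False := by
  obtain ⟨φ⟩ : Nonempty (K →+* ℂ) := inferInstance
  obtain ⟨t, ht⟩ := isReal_of h φ (u : K)
  have := congrArg (fun v : (𝓞 K)ˣ => φ (v : K)) hu
  simp only [coe_pow, map_pow, ht, coe_neg_one, map_one, map_neg] at this
  have h2 : t ^ 2 = -1 := by exact_mod_cast this
  nlinarith [sq_nonneg t]

theorem units_index {K : Type*} [Field K] [NumberField K] (h : TReal (𝓞 K)) :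
    (sqS (𝓞 K)ˣ).index = 2 ^ Module.finrank ℚ K := by
  haveI := totReal_of h
  have hQ : (sqS ((𝓞 K)ˣ ⧸ torsion K)).index = 2 ^ Units.rank K := by
    have := AddSubgroup.index_range_nsmul (Additive ((𝓞 K)ˣ ⧸ torsion K)) 2
    rw [finrank_modTorsion] at this
    rw [← this]
    rfl
  have hs : Function.Surjective (QuotientGroup.mk' (torsion K)) := QuotientGroup.mk'_surjective _
  have hc : (sqS ((𝓞 K)ˣ ⧸ torsion K)).comap (QuotientGroup.mk' (torsion K))
      = sqS (𝓞 K)ˣ ⊔ torsion K := by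
    have : sqS ((𝓞 K)ˣ ⧸ torsion K) = (sqS (𝓞 K)ˣ).map (QuotientGroup.mk' (torsion K)) := by
      ext y
      constructor
      · rintro ⟨z, rfl⟩
        obtain ⟨w, rfl⟩ := hs z
        exact ⟨w ^ 2, ⟨w, rfl⟩, by simp⟩
      · rintro ⟨_, ⟨w, rfl⟩, rfl⟩
        exact ⟨QuotientGroup.mk' (torsion K) w, by simp⟩
    rw [this, Subgroup.comap_map_eq, QuotientGroup.ker_mk']
  have h1 : (sqS (𝓞 K)ˣ ⊔ torsion K).index = 2 ^ Units.rank K := by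
    rw [← hc, Subgroup.index_comap_of_surjective _ hs, hQ]
  have h2 : (sqS (𝓞 K)ˣ).relIndex (sqS (𝓞 K)ˣ ⊔ torsion K) = 2 := by
    rw [sup_comm, Subgroup.relIndex_sup_right, Subgroup.relIndex, Subgroup.index_eq_two_iff]
    have hm : (-1 : (𝓞 K)ˣ) ∈ torsion K := by
      refine (CommGroup.mem_torsion _).2 ?_
      rw [isOfFinOrder_iff_pow_eq_one]; exact ⟨2, by norm_num, by simp⟩
    refine ⟨⟨-1, hm⟩, ?_⟩
    have e1 : (1 : (𝓞 K)ˣ) ∈ sqS (𝓞 K)ˣ := one_mem _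
    have e2 : (-1 : (𝓞 K)ˣ) ∉ sqS (𝓞 K)ˣ := by
      rintro ⟨u, hu⟩
      exact not_sq_neg_one h hu
    rintro ⟨b, hb⟩
    rw [Subgroup.mem_subgroupOf, Subgroup.mem_subgroupOf]
    rcases torsion_real h hb with rfl | rfl
    · right
      exact ⟨e1, by rw [Subgroup.coe_mul, one_mul]; exact e2⟩
    · left
      exact ⟨by rw [Subgroup.coe_mul]; simpa using e1, e2⟩
  have h3 := Subgroup.relIndex_mul_index (H := sqS (𝓞 K)ˣ) (K := sqS (𝓞 K)ˣ ⊔ torsion K) le_sup_left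
  rw [← h3, h1, h2, ← pow_succ', Units.rank]
  congr 1
  rw [IsTotallyReal.finrank K, Nat.sub_add_cancel Fintype.card_pos,
    InfinitePlace.card_eq_nrRealPlaces_add_nrComplexPlaces,
    IsTotallyReal.nrComplexPlaces_eq_zero, add_zero]
end UnitsIdx
end TCG
end Part11

section Part12
open Ideal
namespace TCG

section Flds
open NumberField

/-- `M = B(s0)` is a quadratic extension inside `ℂ` -/
structure Ext (B M : IntermediateField ℚ ℂ) (s0 : ℂ) : Prop where
  le : B ≤ M
  mem : s0 ∈ M
  sq : s0 ^ 2 ∈ B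
  nmem : s0 ∉ B
  int : IsIntegral ℤ s0
  rep : ∀ y ∈ M, ∃ a ∈ B, ∃ b ∈ B, y = a + b * s0

variable {B M : IntermediateField ℚ ℂ} {s0 : ℂ}

theorem Ext.uniq0 (E : Ext B M s0) {a b : ℂ} (ha : a ∈ B) (hb : b ∈ B) (h : a + b * s0 = 0) :
    a = 0 ∧ b = 0 := by
  have : b = 0 := by
    by_contra hb0
    apply E.nmem
    have : s0 = -a / b := by field_simp; linear_combination h
    rw [this]; exact div_mem (neg_mem ha) hb
  subst this
  simpa using h

theorem Ext.uniq (E : Ext B M s0) {a b a' b' : ℂ} (ha : a ∈ B) (hb : b ∈ B) (ha' : a' ∈ B)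
    (hb' : b' ∈ B) (h : a + b * s0 = a' + b' * s0) : a = a' ∧ b = b' := by
  obtain ⟨h1, h2⟩ := E.uniq0 (sub_mem ha ha') (sub_mem hb hb') (by linear_combination h)
  exact ⟨sub_eq_zero.1 h1, sub_eq_zero.1 h2⟩

theorem Ext.mk_mem (E : Ext B M s0) {a b : ℂ} (ha : a ∈ B) (hb : b ∈ B) : a + b * s0 ∈ M :=
  add_mem (E.le ha) (mul_mem (E.le hb) E.mem)

theorem Ext.exists_cj (E : Ext B M s0) (y : M) : ∃ w : M, ∀ a ∈ B, ∀ b ∈ B, (y : ℂ) = a + b * s0 →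
    (w : ℂ) = a - b * s0 := by
  obtain ⟨a, ha, b, hb, e⟩ := E.rep y y.2
  refine ⟨⟨a + (-b) * s0, E.mk_mem ha (neg_mem hb)⟩, ?_⟩
  intro a' ha' b' hb' e'
  obtain ⟨rfl, rfl⟩ := E.uniq ha hb ha' hb' (by rw [← e, e'])
  change a + (-b) * s0 = _
  ring

/-- conjugation -/
noncomputable def Ext.cjf (E : Ext B M s0) (y : M) : M := Classical.choose (E.exists_cj y)

theorem Ext.cjf_eq (E : Ext B M s0) {y : M} {a b : ℂ} (ha : a ∈ B) (hb : b ∈ B)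
    (h : (y : ℂ) = a + b * s0) : (E.cjf y : ℂ) = a - b * s0 :=
  Classical.choose_spec (E.exists_cj y) a ha b hb h

theorem Ext.cjf_invol (E : Ext B M s0) (y : M) : E.cjf (E.cjf y) = y := by
  obtain ⟨a, ha, b, hb, e⟩ := E.rep y y.2
  apply Subtype.ext
  rw [E.cjf_eq ha (neg_mem hb) (by rw [E.cjf_eq ha hb e]; ring), e]; ring

/-- conjugation as a ring automorphism -/
noncomputable def Ext.cj (E : Ext B M s0) : M ≃+* M where
  toFun := E.cjf
  invFun := E.cjf
  left_inv := E.cjf_invol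
  right_inv := E.cjf_invol
  map_mul' := by
    intro y y'
    obtain ⟨a, ha, b, hb, e⟩ := E.rep y y.2
    obtain ⟨a', ha', b', hb', e'⟩ := E.rep y' y'.2
    apply Subtype.ext
    rw [E.cjf_eq (a := a * a' + b * b' * s0 ^ 2) (b := a * b' + a' * b)
      (add_mem (mul_mem ha ha') (mul_mem (mul_mem hb hb') E.sq))
      (add_mem (mul_mem ha hb') (mul_mem ha' hb)) (by push_cast; rw [e, e']; ring)]
    push_cast
    rw [E.cjf_eq ha hb e, E.cjf_eq ha' hb' e']; ring
  map_add' := by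
    intro y y'
    obtain ⟨a, ha, b, hb, e⟩ := E.rep y y.2
    obtain ⟨a', ha', b', hb', e'⟩ := E.rep y' y'.2
    apply Subtype.ext
    rw [E.cjf_eq (a := a + a') (b := b + b') (add_mem ha ha')
      (add_mem hb hb') (by push_cast; rw [e, e']; ring)]
    push_cast
    rw [E.cjf_eq ha hb e, E.cjf_eq ha' hb' e']; ring

/-- value in `ℂ` of an algebraic integer -/
noncomputable def vO (M : IntermediateField ℚ ℂ) : 𝓞 M →+* ℂ :=
  (algebraMap M ℂ).comp (algebraMap (𝓞 M) M)

theorem vO_inj (M : IntermediateField ℚ ℂ) : Function.Injective (vO M) :=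
  (algebraMap M ℂ).injective.comp RingOfIntegers.coe_injective

theorem vO_mem (y : 𝓞 M) : vO M y ∈ M := ((y : M)).2

theorem int_coe {y : ℂ} (h : y ∈ M) : IsIntegral ℤ (⟨y, h⟩ : M) ↔ IsIntegral ℤ y := by
  have := isIntegral_algHom_iff (x := (⟨y, h⟩ : M)) ((algebraMap M ℂ).toIntAlgHom)
    (algebraMap M ℂ).injective
  exact this.symm

theorem vO_int (y : 𝓞 M) : IsIntegral ℤ (vO M y) := (int_coe (M := M) (vO_mem y)).1 y.2

theorem exists_O {y : ℂ} (h : y ∈ M) (hi : IsIntegral ℤ y) : ∃ r : 𝓞 M, vO M r = y :=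
  ⟨⟨⟨y, h⟩, (int_coe h).2 hi⟩, rfl⟩

/-- inclusion of rings of integers -/
noncomputable def inc (h : B ≤ M) : 𝓞 B →+* 𝓞 M :=
  RingOfIntegers.mapRingHom (IntermediateField.inclusion h : B →+* M)

theorem inc_v (h : B ≤ M) (r : 𝓞 B) : vO M (inc h r) = vO B r := rfl

noncomputable def Ext.s (E : Ext B M s0) : 𝓞 M ≃+* 𝓞 M := RingOfIntegers.mapRingEquiv E.cj

theorem Ext.s_v (E : Ext B M s0) {y : 𝓞 M} {a b : ℂ} (ha : a ∈ B) (hb : b ∈ B)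
    (h : vO M y = a + b * s0) : vO M (E.s y) = a - b * s0 := E.cjf_eq ha hb h

theorem Ext.s_neg (E : Ext B M s0) {y : 𝓞 M} (h : vO M y = s0) : E.s y = -y := by
  apply vO_inj
  rw [E.s_v (zero_mem B) (one_mem B) (by rw [h]; ring), map_neg, h]; ring

theorem Ext.quad (E : Ext B M s0) : Quad (inc E.le) E.s where
  inj := by
    intro a b h
    apply vO_inj
    rw [← inc_v E.le, h, inc_v]
  invol := by
    intro x
    obtain ⟨a, ha, b, hb, e⟩ := E.rep _ (vO_mem x)
    apply vO_inj
    rw [E.s_v ha (neg_mem hb) (by rw [E.s_v ha hb e]; ring), e]; ring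
  fix := by
    intro r
    apply vO_inj
    rw [E.s_v (vO_mem r) (zero_mem B) (by rw [inc_v]; ring), inc_v]; ring
  mem := by
    intro x h
    obtain ⟨a, ha, b, hb, e⟩ := E.rep _ (vO_mem x)
    have h1 := E.s_v ha hb e
    rw [h, e] at h1
    obtain ⟨-, h2⟩ := E.uniq (b' := -b) ha hb ha (neg_mem hb) (by rw [h1]; ring)
    have h3 : b = 0 := by linear_combination h2 / 2
    rw [h3, zero_mul, add_zero] at e
    obtain ⟨r, hr⟩ := exists_O ha (by rw [← e]; exact vO_int x)
    exact ⟨r, vO_inj M (by rw [inc_v, hr, e])⟩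
  skew := by
    obtain ⟨y, hy⟩ := exists_O E.mem E.int
    refine ⟨y, ?_, E.s_neg hy⟩
    rintro rfl
    apply E.nmem
    rw [← hy, map_zero]; exact zero_mem B

theorem Ext.finrank (E : Ext B M s0) [FiniteDimensional ℚ B] :
    Module.finrank ℚ M = 2 * Module.finrank ℚ B := by
  let T : (B × B) →ₗ[ℚ] M :=
    { toFun := fun z => ⟨(z.1 : ℂ) + z.2 * s0, E.mk_mem z.1.2 z.2.2⟩
      map_add' := by
        intro a b; apply Subtype.ext; push_cast; simp only [Prod.fst_add, Prod.snd_add]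
        push_cast; ring
      map_smul' := by
        intro a b; apply Subtype.ext
        change (a • (b.1 : ℂ)) + (a • (b.2 : ℂ)) * s0 = a • ((b.1 : ℂ) + b.2 * s0)
        rw [smul_add, smul_mul_assoc] }
  have hT : Function.Bijective T := by
    constructor
    · rintro ⟨a, b⟩ ⟨a', b'⟩ h
      have h' : (a : ℂ) + b * s0 = a' + b' * s0 := congrArg (Subtype.val) h
      obtain ⟨h1, h2⟩ := E.uniq a.2 b.2 a'.2 b'.2 h'
      rw [Prod.mk.injEq]
      exact ⟨Subtype.ext h1, Subtype.ext h2⟩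
    · intro y
      obtain ⟨a, ha, b, hb, e⟩ := E.rep y y.2
      exact ⟨(⟨a, ha⟩, ⟨b, hb⟩), Subtype.ext e.symm⟩
  rw [← (LinearEquiv.ofBijective T hT).finrank_eq, Module.finrank_prod]; ring

/-- squares roots in a quadratic extension -/
theorem Ext.sqrt (E : Ext B M s0) {t : ℂ} (h : t ∈ M) (h2 : t ^ 2 ∈ B) : t ∈ B ∨ t * s0 ∈ B := by
  obtain ⟨a, ha, b, hb, rfl⟩ := E.rep t h
  obtain ⟨-, h1⟩ := E.uniq0 (a := a ^ 2 + b ^ 2 * s0 ^ 2 - (a + b * s0) ^ 2) (b := 2 * (a * b))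
    (sub_mem (add_mem (pow_mem ha 2) (mul_mem (pow_mem hb 2) E.sq)) h2)
    (mul_mem (ofNat_mem B 2) (mul_mem ha hb)) (by ring)
  rcases mul_eq_zero.1 h1 with h1 | h1
  · norm_num at h1
  rcases mul_eq_zero.1 h1 with rfl | rfl
  · right
    rw [zero_add, mul_assoc, ← pow_two]; exact mul_mem hb E.sq
  · left
    simpa using ha

/-- adjunction of one element -/
noncomputable def adj (B : IntermediateField ℚ ℂ) (s0 : ℂ) : IntermediateField ℚ ℂ :=
  B ⊔ IntermediateField.adjoin ℚ {s0}

theorem adj_le : B ≤ adj B s0 := le_sup_left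

theorem adj_mem : s0 ∈ adj B s0 :=
  (le_sup_right : _ ≤ adj B s0) (IntermediateField.mem_adjoin_simple_self ℚ s0)

theorem adj_le_of {C : IntermediateField ℚ ℂ} (h1 : B ≤ C) (h2 : s0 ∈ C) : adj B s0 ≤ C :=
  sup_le h1 (IntermediateField.adjoin_simple_le_iff.2 h2)

theorem adj_rep (h : s0 ^ 2 ∈ B) : ∀ y ∈ adj B s0, ∃ a ∈ B, ∃ b ∈ B, y = a + b * s0 := by
  let C : IntermediateField ℚ ℂ :=
    { carrier := {y | ∃ a ∈ B, ∃ b ∈ B, y = a + b * s0}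
      mul_mem' := by
        rintro _ _ ⟨a, ha, b, hb, rfl⟩ ⟨a', ha', b', hb', rfl⟩
        exact ⟨a * a' + b * b' * s0 ^ 2, add_mem (mul_mem ha ha') (mul_mem (mul_mem hb hb') h),
          a * b' + a' * b, add_mem (mul_mem ha hb') (mul_mem ha' hb), by ring⟩
      add_mem' := by
        rintro _ _ ⟨a, ha, b, hb, rfl⟩ ⟨a', ha', b', hb', rfl⟩
        exact ⟨a + a', add_mem ha ha', b + b', add_mem hb hb', by ring⟩
      algebraMap_mem' := fun r => ⟨algebraMap ℚ ℂ r, _root_.algebraMap_mem B r, 0, zero_mem B, by ring⟩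
      inv_mem' := by
        rintro _ ⟨a, ha, b, hb, rfl⟩
        by_cases h0 : a + b * s0 = 0
        · exact ⟨0, zero_mem B, 0, zero_mem B, by rw [h0]; simp⟩
        by_cases h1 : a - b * s0 = 0
        · refine ⟨(2 * a)⁻¹, inv_mem (mul_mem (ofNat_mem B 2) ha), 0, zero_mem B, ?_⟩
          have : a + b * s0 = 2 * a := by linear_combination -h1
          rw [this]; ring
        · have hn : a ^ 2 - b ^ 2 * s0 ^ 2 ∈ B :=
            sub_mem (pow_mem ha 2) (mul_mem (pow_mem hb 2) h)
          have hn0 : a ^ 2 - b ^ 2 * s0 ^ 2 ≠ 0 := by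
            have := mul_ne_zero h0 h1
            intro h2; apply this; linear_combination h2
          refine ⟨a / (a ^ 2 - b ^ 2 * s0 ^ 2), div_mem ha hn, -b / (a ^ 2 - b ^ 2 * s0 ^ 2),
            div_mem (neg_mem hb) hn, ?_⟩
          apply mul_left_cancel₀ h0
          rw [mul_inv_cancel₀ h0]
          field_simp
          ring }
  have : adj B s0 ≤ C := adj_le_of
    (fun y hy => ⟨y, hy, 0, zero_mem B, by ring⟩) ⟨0, zero_mem B, 1, one_mem B, by ring⟩
  exact fun y hy => this hy

theorem ext_of (h : s0 ^ 2 ∈ B) (hn : s0 ∉ B) (hi : IsIntegral ℤ s0) (hM : M = adj B s0) :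
    Ext B M s0 := by
  subst hM
  exact ⟨adj_le, adj_mem, h, hn, hi, adj_rep h⟩

theorem adj_fin [FiniteDimensional ℚ B] (hi : IsIntegral ℤ s0) :
    FiniteDimensional ℚ (adj B s0) := by
  haveI : FiniteDimensional ℚ (IntermediateField.adjoin ℚ {s0}) :=
    IntermediateField.adjoin.finiteDimensional hi.tower_top
  unfold adj
  infer_instance

end Flds
end TCG
end Part12

section Part13
open Ideal
namespace TCG

section Tower
open NumberField

noncomputable def xr : ℕ → ℝ
  | 0 => 0
  | n + 1 => Real.sqrt (2 + xr n)

noncomputable def yr : ℕ → ℝ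
  | 0 => 2
  | n + 1 => yr n / xr (n + 1)

theorem xr_nonneg (n : ℕ) : 0 ≤ xr n := by
  cases n with
  | zero => exact le_refl _
  | succ n => exact Real.sqrt_nonneg _

theorem xr_sq (n : ℕ) : xr (n + 1) ^ 2 = 2 + xr n :=
  Real.sq_sqrt (by have := xr_nonneg n; linarith)

theorem xr_ne (n : ℕ) : xr (n + 1) ≠ 0 := by
  intro h
  have := xr_sq n
  rw [h] at this
  have := xr_nonneg n
  linarith

theorem xy_sq (n : ℕ) : xr n ^ 2 + yr n ^ 2 = 4 := by
  induction n with
  | zero => simp [xr, yr]; norm_num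
  | succ n ih =>
    have h0 : (2 + xr n) ≠ 0 := by have := xr_nonneg n; linarith
    have h1 : yr (n + 1) ^ 2 = 2 - xr n := by
      change (yr n / xr (n + 1)) ^ 2 = _
      rw [div_pow, xr_sq, div_eq_iff h0]
      linear_combination ih
    rw [h1, xr_sq]; ring

noncomputable def xx (n : ℕ) : ℂ := (xr n : ℂ)

theorem xx_sq (n : ℕ) : xx (n + 1) ^ 2 = 2 + xx n := by
  unfold xx; exact_mod_cast xr_sq n

theorem xx_int (n : ℕ) : IsIntegral ℤ (xx n) := by
  induction n with
  | zero => simpa [xx, xr] using (isIntegral_zero : IsIntegral ℤ (0 : ℂ))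
  | succ n ih =>
    apply IsIntegral.of_pow (n := 2) (by norm_num)
    rw [xx_sq]
    exact IsIntegral.add (by simpa using isIntegral_algebraMap (R := ℤ) (A := ℂ) (x := 2)) ih

noncomputable def Qn : ℕ → IntermediateField ℚ ℂ
  | 0 => ⊥
  | n + 1 => adj (Qn n) (xx (n + 1))

theorem xx_mem (n : ℕ) : xx n ∈ Qn n := by
  cases n with
  | zero => simp [xx, xr]
  | succ n => exact adj_mem

theorem xx_sq_mem (n : ℕ) : xx (n + 1) ^ 2 ∈ Qn n := by
  rw [xx_sq]; exact add_mem (ofNat_mem _ 2) (xx_mem n)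

theorem yy_mem (n : ℕ) : (yr n : ℂ) ∈ Qn n := by
  induction n with
  | zero => simpa [yr] using (ofNat_mem (Qn 0) 2)
  | succ n ih =>
    change ((yr n / xr (n + 1) : ℝ) : ℂ) ∈ _
    push_cast
    exact div_mem (adj_le ih) (xx_mem (n + 1))

theorem Qn_real (n : ℕ) : ∀ y ∈ Qn n, y.im = 0 := by
  induction n with
  | zero =>
    intro y hy
    obtain ⟨r, rfl⟩ := IntermediateField.mem_bot.1 hy
    simp
  | succ n ih =>
    intro y hy
    obtain ⟨a, ha, b, hb, rfl⟩ := adj_rep (xx_sq_mem n) y hy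
    simp [xx, ih a ha, ih b hb]

theorem Qn_fin (n : ℕ) : FiniteDimensional ℚ (Qn n) := by
  induction n with
  | zero => change FiniteDimensional ℚ (⊥ : IntermediateField ℚ ℂ); infer_instance
  | succ n ih => exact adj_fin (xx_int (n + 1))

instance Qn_nf (n : ℕ) : NumberField (Qn n) :=
  { to_charZero := inferInstance, to_finiteDimensional := Qn_fin n }

noncomputable def mkO {M : IntermediateField ℚ ℂ} {y : ℂ} (h : y ∈ M) (hi : IsIntegral ℤ y) : 𝓞 M :=
  ⟨⟨y, h⟩, (int_coe h).2 hi⟩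

theorem mkO_v {M : IntermediateField ℚ ℂ} {y : ℂ} (h : y ∈ M) (hi : IsIntegral ℤ y) :
    vO M (mkO h hi) = y := rfl

noncomputable def xO (n : ℕ) : 𝓞 (Qn n) := mkO (xx_mem n) (xx_int n)

theorem xO_zero : xO 0 = 0 := by
  apply vO_inj
  rw [xO, mkO_v, map_zero]; simp [xx, xr]

variable {p q : ℕ}

theorem Lev.extQ {n : ℕ} {ν : 𝓞 (Qn n) →* ℤ} {N : ℕ} (L : Lev p q (xO n) ν N) :
    Ext (Qn n) (Qn (n + 1)) (xx (n + 1)) := by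
  refine ext_of (xx_sq_mem n) ?_ (xx_int _) rfl
  intro h
  obtain ⟨r, hr⟩ := exists_O h (xx_int _)
  have h1 : r ^ 2 = 2 + xO n := by
    apply vO_inj
    rw [map_pow, hr, xx_sq, map_add, map_ofNat, xO, mkO_v]
  have h2 := L.nu1
  rw [← h1, map_pow] at h2
  have h3 : (ν r).natAbs ^ 2 = 2 := by
    rw [← Int.natAbs_pow, h2]; rfl
  have : (ν r).natAbs < 2 := by nlinarith
  interval_cases (ν r).natAbs <;> omega

theorem Lev.stepQ {n : ℕ} {ν : 𝓞 (Qn n) →* ℤ} {N : ℕ} (L : Lev p q (xO n) ν N) :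
    Step (inc L.extQ.le) L.extQ.s (xO n) (xO (n + 1)) where
  quad := L.extQ.quad
  sqX := by
    apply vO_inj
    rw [map_pow, inc_v, map_add, map_ofNat, xO, xO, mkO_v, mkO_v, xx_sq]
  neg := L.extQ.s_neg (mkO_v _ _)

theorem Lev.idx {n : ℕ} {ν : 𝓞 (Qn n) →* ℤ} {N : ℕ} (L : Lev p q (xO n) ν N) :
    N = Module.finrank ℚ (Qn n) := by
  have h := units_index L.real
  rw [L.card] at h
  exact Nat.pow_right_injective (le_refl 2) h

noncomputable def eqZ : 𝓞 (Qn 0) ≃+* ℤ :=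
  (RingOfIntegers.mapRingEquiv ((IntermediateField.botEquiv ℚ ℂ) :
    (⊥ : IntermediateField ℚ ℂ) ≃+* ℚ)).trans Rat.ringOfIntegersEquiv

theorem lev_ex (ar : Ari p q) (n : ℕ) : ∃ ν N, Lev p q (xO n) ν N := by
  induction n with
  | zero =>
    rw [xO_zero]
    exact ⟨_, _, lev_base ar eqZ⟩
  | succ n ih =>
    obtain ⟨ν, N, L⟩ := ih
    refine ⟨_, _, L.stepQ.lev L ?_ ar.hp ar.p2 (not_dvd_of ar.p_two) ar.hq ar.q2
      (not_dvd_of ar.q_two)⟩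
    rw [units_index (L.stepQ.real L), L.extQ.finrank, L.idx]

end Tower
end TCG
end Part13

section Part14
open Ideal
namespace TCG

section Tower2
open NumberField

/-- `√(pq)` -/
noncomputable def dr (p q : ℕ) : ℂ := ((Real.sqrt (p * q) : ℝ) : ℂ)

/-- `√(-pq)` -/
noncomputable def gi (p q : ℕ) : ℂ := Complex.I * dr p q

variable {p q : ℕ}

theorem dr_sq (p q : ℕ) : dr p q ^ 2 = (p : ℂ) * q := by
  unfold dr
  rw [← Complex.ofReal_pow, Real.sq_sqrt (by positivity)]
  push_cast; rfl

theorem gi_sq (p q : ℕ) : gi p q ^ 2 = -((p : ℂ) * q) := by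
  unfold gi
  rw [mul_pow, dr_sq, Complex.I_sq]; ring

theorem nat_int (m : ℕ) : IsIntegral ℤ (m : ℂ) := by
  simpa using isIntegral_algebraMap (R := ℤ) (A := ℂ) (x := (m : ℤ))

theorem I_int : IsIntegral ℤ Complex.I := by
  apply IsIntegral.of_pow (n := 2) (by norm_num)
  rw [Complex.I_sq]; exact isIntegral_one.neg

theorem dr_int (p q : ℕ) : IsIntegral ℤ (dr p q) := by
  apply IsIntegral.of_pow (n := 2) (by norm_num)
  rw [dr_sq]; exact (nat_int p).mul (nat_int q)

theorem gi_int (p q : ℕ) : IsIntegral ℤ (gi p q) := I_int.mul (dr_int p q)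

theorem quad_int {y b c : ℂ} (hb : IsIntegral ℤ b) (hc : IsIntegral ℤ c)
    (h : y ^ 2 = b * y + c) : IsIntegral ℤ y := by
  have h1 : IsIntegral (integralClosure ℤ ℂ) y := by
    refine ⟨Polynomial.X ^ 2 - (Polynomial.C (⟨b, hb⟩ : integralClosure ℤ ℂ) * Polynomial.X
      + Polynomial.C (⟨c, hc⟩ : integralClosure ℤ ℂ)), ?_, ?_⟩
    · exact Polynomial.monic_X_pow_sub (lt_of_le_of_lt Polynomial.degree_linear_le (by norm_num))
    · simp only [Polynomial.eval₂_sub, Polynomial.eval₂_add, Polynomial.eval₂_mul,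
        Polynomial.eval₂_pow, Polynomial.eval₂_X, Polynomial.eval₂_C]
      change y ^ 2 - (b * y + c) = 0
      rw [h]; ring
  exact isIntegral_trans y h1

theorem om_int (ar : Ari p q) : IsIntegral ℤ ((1 + gi p q) / 2) := by
  have h8 : (p * q) % 8 = 7 := by rw [Nat.mul_mod, ar.hp8, ar.hq8]
  obtain ⟨k, hk⟩ : ∃ k, p * q = 8 * k + 7 := ⟨p * q / 8, by omega⟩
  have hk' : (p : ℂ) * q = 8 * k + 7 := by exact_mod_cast hk
  refine quad_int (b := 1) (c := -((2 * k + 2 : ℕ) : ℂ)) isIntegral_one (nat_int _).neg ?_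
  have := gi_sq p q
  rw [hk'] at this
  push_cast
  linear_combination this / 4

noncomputable def Fn (p q n : ℕ) : IntermediateField ℚ ℂ := adj (Qn n) (gi p q)
noncomputable def Kn (n : ℕ) : IntermediateField ℚ ℂ := adj (Qn n) Complex.I
noncomputable def Mn (p q n : ℕ) : IntermediateField ℚ ℂ := adj (Qn n) (dr p q)
noncomputable def Ln (p q n : ℕ) : IntermediateField ℚ ℂ := adj (Kn n) (dr p q)

instance Fn_nf (n : ℕ) : NumberField (Fn p q n) :=
  { to_charZero := inferInstance, to_finiteDimensional := adj_fin (gi_int p q) }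
instance Kn_nf (n : ℕ) : NumberField (Kn n) :=
  { to_charZero := inferInstance, to_finiteDimensional := adj_fin I_int }
instance Mn_nf (n : ℕ) : NumberField (Mn p q n) :=
  { to_charZero := inferInstance, to_finiteDimensional := adj_fin (dr_int p q) }
instance Ln_nf (n : ℕ) : NumberField (Ln p q n) :=
  { to_charZero := inferInstance, to_finiteDimensional := adj_fin (dr_int p q) }

theorem pq_mem (B : IntermediateField ℚ ℂ) : (p : ℂ) * q ∈ B := mul_mem (_root_.natCast_mem B p) (_root_.natCast_mem B q)

theorem dr_sq_mem (B : IntermediateField ℚ ℂ) : dr p q ^ 2 ∈ B := by rw [dr_sq]; exact pq_mem B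
theorem gi_sq_mem (B : IntermediateField ℚ ℂ) : gi p q ^ 2 ∈ B := by
  rw [gi_sq]; exact neg_mem (pq_mem B)
theorem I_sq_mem (B : IntermediateField ℚ ℂ) : Complex.I ^ 2 ∈ B := by
  rw [Complex.I_sq]; exact neg_mem (one_mem B)

theorem sqrt_ne (ar : Ari p q) : Real.sqrt (p * q) ≠ 0 := by
  have := ar.hp.pos
  have := ar.hq.pos
  positivity

theorem I_nm (n : ℕ) : Complex.I ∉ Qn n := fun h => by simpa using Qn_real n _ h

theorem gi_nm (ar : Ari p q) (n : ℕ) : gi p q ∉ Qn n := fun h => by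
  have := Qn_real n _ h
  simp only [gi, dr, Complex.mul_im, Complex.I_re, Complex.I_im, Complex.ofReal_re,
    Complex.ofReal_im, zero_mul, one_mul, zero_add] at this
  exact sqrt_ne ar this

theorem xgi_nm (ar : Ari p q) (n : ℕ) : xx (n + 1) * gi p q ∉ Qn n := fun h => by
  have := Qn_real n _ h
  simp only [xx, gi, dr, Complex.mul_im, Complex.mul_re, Complex.I_re, Complex.I_im,
    Complex.ofReal_re, Complex.ofReal_im, zero_mul, one_mul, zero_add, add_zero] at this
  exact mul_ne_zero (xr_ne n) (sqrt_ne ar) this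

theorem dr_nm (ar : Ari p q) (n : ℕ) : dr p q ∉ Qn n := fun h => by
  obtain ⟨ν, N, L⟩ := lev_ex ar n
  obtain ⟨r, hr⟩ := exists_O h (dr_int p q)
  apply L.not_sq ar r
  apply vO_inj
  rw [map_pow, hr, dr_sq, map_mul, map_natCast, map_natCast]

theorem eFQ (ar : Ari p q) (n : ℕ) : Ext (Qn n) (Fn p q n) (gi p q) :=
  ext_of (gi_sq_mem _) (gi_nm ar n) (gi_int p q) rfl

theorem eKQ (n : ℕ) : Ext (Qn n) (Kn n) Complex.I :=
  ext_of (I_sq_mem _) (I_nm n) I_int rfl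

theorem eMQ (ar : Ari p q) (n : ℕ) : Ext (Qn n) (Mn p q n) (dr p q) :=
  ext_of (dr_sq_mem _) (dr_nm ar n) (dr_int p q) rfl

theorem eLK (ar : Ari p q) (n : ℕ) : Ext (Kn n) (Ln p q n) (dr p q) := by
  refine ext_of (dr_sq_mem _) ?_ (dr_int p q) rfl
  intro h
  rcases (eKQ n).sqrt h (dr_sq_mem _) with h | h
  · exact dr_nm ar n h
  · rw [mul_comm] at h
    exact gi_nm ar n h

theorem I_mul_gi (p q : ℕ) : Complex.I * gi p q = -dr p q := by
  unfold gi
  linear_combination dr p q * Complex.I_sq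

theorem eLF (ar : Ari p q) (n : ℕ) : Ext (Fn p q n) (Ln p q n) Complex.I := by
  refine ext_of (I_sq_mem _) ?_ I_int ?_
  · intro h
    rcases (eFQ ar n).sqrt h (I_sq_mem _) with h | h
    · exact I_nm n h
    · rw [I_mul_gi] at h
      exact dr_nm ar n (by simpa using neg_mem h)
  · apply le_antisymm
    · apply adj_le_of (adj_le_of (adj_le.trans adj_le) adj_mem)
      have : dr p q = -(Complex.I * gi p q) := by rw [I_mul_gi, neg_neg]
      rw [this]
      exact neg_mem (mul_mem adj_mem (adj_le adj_mem))
    · apply adj_le_of (adj_le_of (adj_le.trans adj_le) (mul_mem (adj_le adj_mem) adj_mem))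
        (adj_le adj_mem)

theorem eLM (ar : Ari p q) (n : ℕ) : Ext (Mn p q n) (Ln p q n) Complex.I := by
  refine ext_of (I_sq_mem _) ?_ I_int ?_
  · intro h
    rcases (eMQ ar n).sqrt h (I_sq_mem _) with h | h
    · exact I_nm n h
    · exact gi_nm ar n h
  · apply le_antisymm
    · exact adj_le_of (adj_le_of (adj_le.trans adj_le) adj_mem) (adj_le adj_mem)
    · exact adj_le_of (adj_le_of (adj_le.trans adj_le) adj_mem) (adj_le adj_mem)

theorem eFF (ar : Ari p q) (n : ℕ) : Ext (Fn p q n) (Fn p q (n + 1)) (xx (n + 1)) := by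
  obtain ⟨ν, N, L⟩ := lev_ex ar n
  refine ext_of (adj_le (xx_sq_mem n)) ?_ (xx_int _) (sup_right_comm _ _ _)
  intro h
  rcases (eFQ ar n).sqrt h (xx_sq_mem n) with h | h
  · exact L.extQ.nmem h
  · exact xgi_nm ar n h

theorem gi_memF (p q n : ℕ) : gi p q ∈ Fn p q n := adj_mem

theorem om_memF (p q n : ℕ) : (1 + gi p q) / 2 ∈ Fn p q n :=
  div_mem (add_mem (one_mem _) (gi_memF p q n)) (ofNat_mem _ 2)

noncomputable def gO (p q n : ℕ) : 𝓞 (Fn p q n) := mkO (gi_memF p q n) (gi_int p q)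

noncomputable def omO (ar : Ari p q) (n : ℕ) : 𝓞 (Fn p q n) := mkO (om_memF p q n) (om_int ar)

theorem gO_v (p q n : ℕ) : vO (Fn p q n) (gO p q n) = gi p q := mkO_v _ _

theorem omO_v (ar : Ari p q) (n : ℕ) : vO (Fn p q n) (omO ar n) = (1 + gi p q) / 2 := mkO_v _ _

theorem fd (ar : Ari p q) (n : ℕ) :
    FD p q (inc (eFQ ar n).le) (eFQ ar n).s (gO p q n) (omO ar n) where
  quad := (eFQ ar n).quad
  neg := (eFQ ar n).s_neg (gO_v p q n)
  sqg := by
    apply vO_inj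
    rw [map_pow, map_neg, map_mul, map_natCast, map_natCast, gO_v, gi_sq]
  om := by
    apply vO_inj
    rw [map_mul, map_add, map_one, map_ofNat, gO_v, omO_v]; ring

theorem kron {M : IntermediateField ℚ ℂ} [NumberField M] (ε : 𝓞 M)
    (h : ∀ φ : 𝓞 M →+* ℂ, ‖φ ε‖ = 1) : ∃ n, 0 < n ∧ ε ^ n = 1 := by
  obtain ⟨n, hn, e⟩ := Embeddings.pow_eq_one_of_norm_eq_one M ℂ (x := (ε : M)) ε.2
    (fun φ => h (φ.comp (algebraMap (𝓞 M) M)))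
  refine ⟨n, hn, RingOfIntegers.coe_injective ?_⟩
  rw [map_pow, e, map_one]

theorem tw_gen {B F B' F' : IntermediateField ℚ ℂ} {g x : ℂ} (E : Ext B F g) (E' : Ext B' F' g)
    (E2 : Ext B B' x) (E3 : Ext F F' x) (om : 𝓞 F) (om' : 𝓞 F') (ho : vO F om = vO F' om') :
    Tw (inc E.le) E.s (inc E'.le) E'.s (inc E2.le) E2.s (inc E3.le) E3.s om om' where
  quad := E3.quad
  c1 r := by apply vO_inj; simp only [inc_v]
  c2 r := by
    obtain ⟨a, ha, b, hb, e⟩ := E2.rep _ (vO_mem r)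
    apply vO_inj
    rw [inc_v, E3.s_v (E.le ha) (E.le hb) (by rw [inc_v, e]), E2.s_v ha hb e]
  c3 y := by
    obtain ⟨a, ha, b, hb, e⟩ := E.rep _ (vO_mem y)
    apply vO_inj
    rw [inc_v, E'.s_v (E2.le ha) (E2.le hb) (by rw [inc_v, e]), E.s_v ha hb e]
  c4 y := by
    obtain ⟨A, hA, B, hB, e⟩ := E3.rep _ (vO_mem y)
    obtain ⟨a, ha, a', ha', rfl⟩ := E.rep _ hA
    obtain ⟨b, hb, b', hb', rfl⟩ := E.rep _ hB
    have e1 := E'.s_v (E2.mk_mem ha hb) (E2.mk_mem ha' hb') (y := y) (by rw [e]; ring)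
    have e2 := E3.s_v hA hB e
    apply vO_inj
    rw [E3.s_v (E.mk_mem ha (neg_mem ha')) (E.mk_mem hb (neg_mem hb')) (by rw [e1]; ring),
      E'.s_v (E2.mk_mem ha (neg_mem hb)) (E2.mk_mem ha' (neg_mem hb')) (by rw [e2]; ring)]
    ring
  om := by apply vO_inj; rw [inc_v, ho]

theorem tw (ar : Ari p q) (n : ℕ) {ν : 𝓞 (Qn n) →* ℤ} {N : ℕ} (L : Lev p q (xO n) ν N) :
    Tw (inc (eFQ ar n).le) (eFQ ar n).s (inc (eFQ ar (n + 1)).le) (eFQ ar (n + 1)).s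
      (inc L.extQ.le) L.extQ.s (inc (eFF ar n).le) (eFF ar n).s (omO ar n) (omO ar (n + 1)) :=
  tw_gen _ _ _ _ _ _ (by rw [omO_v, omO_v])

theorem ord_n (ar : Ari p q) (n : ℕ) :
    Ord (gen (inc (eFQ ar n).le (2 - xO n)) (omO ar n)) (n + 2) := by
  induction n with
  | zero =>
    have := (fd ar 0).base (lev_base ar eqZ) ar eqZ
    rw [← xO_zero] at this
    exact this
  | succ n ih =>
    obtain ⟨ν, N, L⟩ := lev_ex ar n
    obtain ⟨ν', N', L'⟩ := lev_ex ar (n + 1)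
    exact (tw ar n L).ord (fd ar n) (fd ar (n + 1)) L L' L.stepQ ar (vO _) kron ih

end Tower2
end TCG
end Part14

section Part15
open Ideal
namespace TCG

section Tower3
open NumberField

variable {p q : ℕ}

/-- compatibility of the conjugations in a biquadratic extension -/
theorem dia_gen {B F K M L : IntermediateField ℚ ℂ} {g i d : ℂ} (hg : g = i * d) (hi : i ^ 2 = -1)
    (EF : Ext B F g) (EK : Ext B K i) (EM : Ext B M d) (LF : Ext F L i) (LK : Ext K L d)
    (LM : Ext M L i) {x : 𝓞 B} {gF om : 𝓞 F} {j z : 𝓞 K} {gm : 𝓞 M}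
    (hF : FD p q (inc EF.le) EF.s gF om) (hj : vO K j = i) (hz : z * EK.s z = 1)
    (hzx : z + EK.s z = inc EK.le x) (hm : vO M gm = d) (hm2 : d ^ 2 = (p : ℂ) * q) :
    Dia p q x (inc EF.le) EF.s gF om (inc EK.le) EK.s j z (inc EM.le) EM.s gm (inc LF.le)
      (inc LK.le) (inc LM.le) LF.s LK.s LM.s where
  F := hF
  K := EK.quad
  hj := EK.s_neg hj
  hj2 := by apply vO_inj; rw [map_pow, hj, hi, map_neg, map_one]
  hz := hz
  hzx := hzx
  M := EM.quad
  hm := EM.s_neg hm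
  hm2 := by apply vO_inj; rw [map_pow, hm, hm2, map_mul, map_natCast, map_natCast]
  qF := LF.quad
  qK := LK.quad
  qM := LM.quad
  cFK r := by apply vO_inj; simp only [inc_v]
  cFM r := by apply vO_inj; simp only [inc_v]
  rho y := by
    obtain ⟨A, hA, B, hB, e⟩ := LF.rep _ (vO_mem y)
    obtain ⟨a, ha, a', ha', rfl⟩ := EF.rep _ hA
    obtain ⟨b, hb, b', hb', rfl⟩ := EF.rep _ hB
    have e1 := LK.s_v (EK.mk_mem ha hb) (EK.mk_mem (neg_mem hb') ha') (y := y)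
      (by rw [e, hg]; linear_combination b' * d * hi)
    apply vO_inj
    rw [LF.s_v hA hB e, LM.s_v (EM.mk_mem ha hb') (EM.mk_mem hb (neg_mem ha'))
      (by rw [e1]; ring), hg]
    linear_combination -b' * d * hi
  comm y := by
    obtain ⟨A, hA, B, hB, e⟩ := LF.rep _ (vO_mem y)
    obtain ⟨a, ha, a', ha', rfl⟩ := EF.rep _ hA
    obtain ⟨b, hb, b', hb', rfl⟩ := EF.rep _ hB
    have e1 := LK.s_v (EK.mk_mem ha hb) (EK.mk_mem (neg_mem hb') ha') (y := y)
      (by rw [e, hg]; linear_combination b' * d * hi)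
    have e2 := LM.s_v (EM.mk_mem ha (neg_mem hb')) (EM.mk_mem hb ha') (y := y)
      (by rw [e, hg]; linear_combination b' * d * hi)
    apply vO_inj
    rw [LM.s_v (EM.mk_mem ha hb') (EM.mk_mem hb (neg_mem ha')) (by rw [e1]; ring),
      LK.s_v (EK.mk_mem ha (neg_mem hb)) (EK.mk_mem (neg_mem hb') (neg_mem ha'))
        (by rw [e2]; ring)]
    ring
  F1 y := by
    obtain ⟨a, ha, b, hb, e⟩ := EF.rep _ (vO_mem y)
    apply vO_inj
    rw [inc_v, LM.s_v (EM.le ha) (mul_mem (EM.le hb) EM.mem)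
      (by rw [inc_v, e, hg]; ring), EF.s_v ha hb e, hg]
    ring
  K1 y := by
    obtain ⟨a, ha, b, hb, e⟩ := EK.rep _ (vO_mem y)
    apply vO_inj
    rw [inc_v, LM.s_v (EM.le ha) (EM.le hb) (by rw [inc_v, e]), EK.s_v ha hb e]
  M1 y := by
    obtain ⟨a, ha, b, hb, e⟩ := EM.rep _ (vO_mem y)
    apply vO_inj
    rw [inc_v, LK.s_v (EK.le ha) (EK.le hb) (by rw [inc_v, e]), EM.s_v ha hb e]

/-- a real quadratic extension of a totally real ring is totally real -/
theorem quad_real {R S : Type*} [CommRing R] [CommRing S] [IsDedekindDomain R]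
    [IsDedekindDomain S] {f : R →+* S} {s : S ≃+* S}
    (Q : Quad f s) (h : TReal R) {g : S} (hg : s g = -g) (g2 : g ^ 2 = (p : S) * q)
    (hp : 0 < p) (hq : 0 < q) : TReal S := by
  intro φ y
  have hX : ∃ c : ℝ, φ g = c ∧ c ≠ 0 := by
    have h1 : (φ g) ^ 2 = ((Real.sqrt (p * q) : ℝ) : ℂ) ^ 2 := by
      rw [← map_pow, g2, ← Complex.ofReal_pow, Real.sq_sqrt (by positivity)]
      simp
    have h0 : Real.sqrt (p * q) ≠ 0 := by positivity
    rcases sq_eq_sq_iff_eq_or_eq_neg.1 h1 with h | h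
    · exact ⟨_, h, h0⟩
    · exact ⟨-Real.sqrt (p * q), by rw [h]; simp, neg_ne_zero.2 h0⟩
  obtain ⟨c, hc, hc0⟩ := hX
  obtain ⟨a, ha⟩ := Q.tr y
  obtain ⟨b, hb⟩ := Q.mem ((y - s y) * g) (by
    rw [map_mul, map_sub, Q.invol, hg]; ring)
  obtain ⟨ta, ea⟩ := h (φ.comp f) a
  obtain ⟨tb, eb⟩ := h (φ.comp f) b
  refine ⟨(ta + tb / c) / 2, ?_⟩
  have h1 : φ (y + s y) = ta := by rw [← ha, ← ea]; rfl
  have h2 : φ (y - s y) * c = tb := by rw [← hc, ← map_mul, ← hb, ← eb]; rfl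
  rw [map_add] at h1
  rw [map_sub] at h2
  have hc' : (c : ℂ) ≠ 0 := by exact_mod_cast hc0
  push_cast
  rw [← h1, ← h2]
  field_simp
  ring

/-- the root of unity `ζ_{2^(n+2)}` -/
noncomputable def zc (n : ℕ) : ℂ := xx n / 2 + (yr n : ℂ) / 2 * Complex.I

theorem xyc_sq (n : ℕ) : xx n ^ 2 + (yr n : ℂ) ^ 2 = 4 := by
  unfold xx; exact_mod_cast xy_sq n

theorem zc_mul (n : ℕ) : zc n * (xx n / 2 - (yr n : ℂ) / 2 * Complex.I) = 1 := by
  unfold zc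
  linear_combination xyc_sq n / 4 - (yr n : ℂ) ^ 2 / 4 * Complex.I_sq

theorem zc_int (n : ℕ) : IsIntegral ℤ (zc n) := by
  refine quad_int (b := xx n) (c := -1) (xx_int n) isIntegral_one.neg ?_
  have := zc_mul n
  have h : xx n / 2 - (yr n : ℂ) / 2 * Complex.I = xx n - zc n := by unfold zc; ring
  rw [h] at this
  linear_combination -this

theorem zc_zero : zc 0 = Complex.I := by
  unfold zc xx xr yr; push_cast; ring

theorem zc_sq (n : ℕ) : zc (n + 1) ^ 2 = zc n := by
  have h1 := xyc_sq (n + 1)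
  have h2 := xx_sq n
  have h3 : xx (n + 1) * (yr (n + 1) : ℂ) = yr n := by
    unfold xx
    rw [← Complex.ofReal_mul]
    congr 1
    rw [yr]
    have := xr_ne n
    field_simp
  unfold zc
  linear_combination h2 / 2 - h1 / 4 + h3 * Complex.I / 2 +
    (yr (n + 1) : ℂ) ^ 2 / 4 * Complex.I_sq

theorem zc_pow (n : ℕ) : zc n ^ 2 ^ n = Complex.I := by
  induction n with
  | zero => rw [pow_zero, pow_one, zc_zero]
  | succ n ih => rw [pow_succ', pow_mul, zc_sq, ih]

theorem zc_pow1 (n : ℕ) : zc n ^ 2 ^ (n + 1) = -1 := by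
  rw [pow_succ, pow_mul, zc_pow, Complex.I_sq]

theorem zc_pow2 (n : ℕ) : zc n ^ 2 ^ (n + 2) = 1 := by
  rw [pow_succ, pow_mul, zc_pow1]; norm_num

theorem zc_prim (n : ℕ) : IsPrimitiveRoot (zc n) (2 ^ (n + 2)) := by
  have h : orderOf (zc n) = 2 ^ (n + 1 + 1) :=
    orderOf_eq_prime_pow (by rw [zc_pow1]; norm_num) (zc_pow2 n)
  have := IsPrimitiveRoot.orderOf (zc n)
  rwa [h] at this

theorem I_memK (n : ℕ) : Complex.I ∈ Kn n := adj_mem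
theorem dr_memM (p q n : ℕ) : dr p q ∈ Mn p q n := adj_mem
theorem dr_memL (p q n : ℕ) : dr p q ∈ Ln p q n := adj_mem
theorem K_le_L (p q n : ℕ) : Kn n ≤ Ln p q n := adj_le

theorem half_mem {B : IntermediateField ℚ ℂ} {a : ℂ} (h : a ∈ B) : a / 2 ∈ B :=
  div_mem h (ofNat_mem _ 2)

theorem zc_mem (n : ℕ) : zc n ∈ Kn n :=
  (eKQ n).mk_mem (half_mem (xx_mem n)) (half_mem (yy_mem n))

noncomputable def jO (n : ℕ) : 𝓞 (Kn n) := mkO (I_memK n) I_int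
noncomputable def zO (n : ℕ) : 𝓞 (Kn n) := mkO (zc_mem n) (zc_int n)
noncomputable def gmO (p q n : ℕ) : 𝓞 (Mn p q n) := mkO (dr_memM p q n) (dr_int p q)

theorem jO_v (n : ℕ) : vO (Kn n) (jO n) = Complex.I := mkO_v _ _
theorem zO_v (n : ℕ) : vO (Kn n) (zO n) = zc n := mkO_v _ _
theorem gmO_v (p q n : ℕ) : vO (Mn p q n) (gmO p q n) = dr p q := mkO_v _ _
theorem xO_v (n : ℕ) : vO (Qn n) (xO n) = xx n := mkO_v _ _

theorem zO_s (n : ℕ) : vO (Kn n) ((eKQ n).s (zO n)) = xx n / 2 - (yr n : ℂ) / 2 * Complex.I :=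
  (eKQ n).s_v (half_mem (xx_mem n)) (half_mem (yy_mem n)) (zO_v n)

theorem dia (ar : Ari p q) (n : ℕ) :
    Dia p q (xO n) (inc (eFQ ar n).le) (eFQ ar n).s (gO p q n) (omO ar n) (inc (eKQ n).le)
      (eKQ n).s (jO n) (zO n) (inc (eMQ ar n).le) (eMQ ar n).s (gmO p q n) (inc (eLF ar n).le)
      (inc (eLK ar n).le) (inc (eLM ar n).le) (eLF ar n).s (eLK ar n).s (eLM ar n).s := by
  refine dia_gen rfl Complex.I_sq _ _ _ _ _ _ (fd ar n) (jO_v n) ?_ ?_ (gmO_v p q n) (dr_sq p q)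
  · apply vO_inj
    rw [map_mul, zO_s, zO_v, zc_mul, map_one]
  · apply vO_inj
    rw [map_add, zO_s, zO_v, inc_v, xO_v]
    unfold zc; ring

theorem index_M (ar : Ari p q) (n : ℕ) {ν : 𝓞 (Qn n) →* ℤ} {N : ℕ} (L : Lev p q (xO n) ν N) :
    (sqS (𝓞 (Mn p q n))ˣ).index = 2 ^ (2 * N) := by
  have D := dia ar n
  rw [units_index (quad_real D.M L.real D.hm D.hm2 ar.hp.pos ar.hq.pos), (eMQ ar n).finrank,
    L.idx]

theorem main_Ln (ar : Ari p q) (n : ℕ) :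
    Nonempty (CommGroup.primaryComponent (ClassGroup (𝓞 (Ln p q n))) 2 ≃*
      Multiplicative (ZMod (2 ^ (n + 2)))) := by
  obtain ⟨ν, N, L⟩ := lev_ex ar n
  exact (dia ar n).final L ar (index_M ar n L) (ord_n ar n)

theorem Qn_le_of {M : IntermediateField ℚ ℂ} (n : ℕ) (h : ∀ k ≤ n, xx k ∈ M) : Qn n ≤ M := by
  induction n with
  | zero => rw [Qn]; exact bot_le
  | succ n ih =>
    rw [Qn]
    exact adj_le_of (ih fun k hk => h k (by omega)) (h _ le_rfl)

theorem adjoin_eq (p q n : ℕ) : IntermediateField.adjoin ℚ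
    ({z : ℂ | z ^ 2 ^ (n + 2) = 1} ∪ {z : ℂ | z ^ 2 = (((p : ℤ) * q : ℤ) : ℂ)}) = Ln p q n := by
  have hd : dr p q ^ 2 = (((p : ℤ) * q : ℤ) : ℂ) := by rw [dr_sq]; push_cast; rfl
  apply le_antisymm
  · rw [IntermediateField.adjoin_le_iff]
    rintro z (hz | hz)
    · obtain ⟨i, -, rfl⟩ := (zc_prim n).eq_pow_of_pow_eq_one hz
      exact K_le_L p q n (pow_mem (zc_mem n) i)
    · rw [Set.mem_ofPred_eq, ← hd] at hz
      rcases sq_eq_sq_iff_eq_or_eq_neg.1 hz with rfl | rfl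
      · exact dr_memL p q n
      · exact neg_mem (dr_memL p q n)
  · set A := IntermediateField.adjoin ℚ
      ({z : ℂ | z ^ 2 ^ (n + 2) = 1} ∪ {z : ℂ | z ^ 2 = (((p : ℤ) * q : ℤ) : ℂ)}) with hA
    have h1 : ∀ k ≤ n, zc k ∈ A := by
      intro k hk
      apply IntermediateField.subset_adjoin
      left
      change zc k ^ 2 ^ (n + 2) = 1
      obtain ⟨m, rfl⟩ := Nat.exists_eq_add_of_le hk
      rw [show k + m + 2 = (k + 2) + m by ring, pow_add, pow_mul, zc_pow2, one_pow]
    have h2 : ∀ k ≤ n, xx k ∈ A := by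
      intro k hk
      have e : xx k = zc k + (zc k)⁻¹ := by
        rw [inv_eq_of_mul_eq_one_right (zc_mul k)]; unfold zc; ring
      rw [e]
      exact add_mem (h1 k hk) (inv_mem (h1 k hk))
    refine adj_le_of (adj_le_of (Qn_le_of n h2) ?_) ?_
    · rw [← zc_zero]; exact h1 0 (Nat.zero_le n)
    · exact IntermediateField.subset_adjoin _ _ (Or.inr hd)

theorem main_final (ar : Ari p q) (n : ℕ) (M : IntermediateField ℚ ℂ) (h : M = Ln p q n) :
    Nonempty (CommGroup.primaryComponent (ClassGroup (𝓞 M)) 2 ≃*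
      Multiplicative (ZMod (2 ^ (n + 2)))) := by
  subst h
  exact main_Ln ar n

end Tower3
end TCG
end Part15

/-- for primes `p ≡ 5 (mod 8)` and `q ≡ 3 (mod 8)` with `(p/q) = 1`
and `q` a fourth power residue mod `p`, and `d = pq`, the 2-class group of
`L_{n,d}` is `ℤ/2^{n+2}ℤ` for all `n ≥ 1`. -/
theorem twoClassGroup_Lfield_pq_pos_legendre_quartic
    (p q : ℕ) (hp : p.Prime) (hq : q.Prime)
    (hp8 : p % 8 = 5) (hq8 : q % 8 = 3)
    (hleg : jacobiSym (p : ℤ) q = 1)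
    (h4 : ∃ x : ZMod p, x ^ 4 = (q : ZMod p))
    (n : ℕ) (hn : 1 ≤ n) :
    Nonempty ((twoClassGroup (Lfield n ((p : ℤ) * q))) ≃*
      Multiplicative (ZMod (2 ^ (n + 2)))) := by
  exact TCG.main_final ⟨hp, hq, hp8, hq8, h4⟩ n _ (TCG.adjoin_eq p q n)
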